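/- arXiv:1001.0094 — 3 statements merged into one kernel-verified Lean document; each statement's English description precedes it below -/
import Mathlib

section
/- Let X and Y be Polish spaces, (Ω,F,P) a probability space, μ a probability kernel from Ω to X, ν a probability kernel from Ω to Y, and c : Ω×X×Y → [0,∞) a jointly measurable bounded function such that for each ω the map (x,y) ↦ c(ω,x,y) is Lipschitz continuous and for each (x,y) the map ω ↦ c(ω,x,y) is F-measurable. Then there exist bounded jointly measurable functions ψ : Ω×X → ℝ and ψ^c : Ω×Y → ℝ, with x ↦ ψ(ω,x) and y ↦ ψ^c(ω,y) Lipschitz continuous for each ω, satisfying ψ^c(ω,y) − ψ(ω,x) ≤ c(ω,x,y) for all (ω,x,y), such that C^stoch(c,μ,ν) = E( ∫_Y ψ^c(ω,y) ν_ω(dy) − ∫_X ψ(ω,x) μ_ω(dx) ). -/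
open MeasureTheory ProbabilityTheory Filter ENNReal NNReal

/-- The stochastic Monge–Kantorovich cost: the infimum, over all probability kernels `π`
from `Ω` to `X × Y` whose marginal kernels are `μ` and `ν`, of
`E ∫ c(ω,x,y) π_ω(dx,dy)`. -/
noncomputable def stochCost {Ω X Y : Type*} [MeasurableSpace Ω] [MeasurableSpace X]
    [MeasurableSpace Y] (P : Measure Ω) (c : Ω → X → Y → ℝ)
    (μ : Kernel Ω X) (ν : Kernel Ω Y) : ℝ≥0∞ :=
  ⨅ π ∈ {π : Kernel Ω (X × Y) | IsMarkovKernel π ∧ π.fst = μ ∧ π.snd = ν},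
    ∫⁻ ω, ∫⁻ q, ENNReal.ofReal (c ω q.1 q.2) ∂(π ω) ∂P

section HB
variable {Ω : Type*} [MeasurableSpace Ω] {P : Measure Ω}

lemma L2_inner_eq (f g : Lp ℝ 2 P) : inner ℝ f g = ∫ ω, f ω * g ω ∂P := by
  rw [L2.inner_def]
  congr 1; ext ω; simp [mul_comm]

lemma L2_inner_nonneg {f g : Lp ℝ 2 P} (hf : 0 ≤ f) (hg : 0 ≤ g) : 0 ≤ inner ℝ f g := by
  rw [L2_inner_eq]
  apply integral_nonneg_of_ae
  filter_upwards [(Lp.coeFn_nonneg f).2 hf, (Lp.coeFn_nonneg g).2 hg] with ω h1 h2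
  exact mul_nonneg h1 h2

lemma L2_nonneg_of_inner {m : Lp ℝ 2 P} (h : ∀ g : Lp ℝ 2 P, 0 ≤ g → 0 ≤ inner ℝ m g) : 0 ≤ m := by
  have h1 := h ((-m) ⊔ 0) le_sup_right
  have h2 : 0 ≤ inner ℝ (m ⊔ 0) ((-m) ⊔ 0) := L2_inner_nonneg le_sup_right le_sup_right
  have hzero : inner ℝ (m + ((-m) ⊔ 0)) ((-m) ⊔ 0) = 0 := by
    rw [L2_inner_eq]
    apply integral_eq_zero_of_ae
    filter_upwards [Lp.coeFn_add m ((-m) ⊔ 0), Lp.coeFn_sup (-m) 0, Lp.coeFn_neg m, Lp.coeFn_zero ℝ 2 P] with ω e1 e2 e3 e4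
    rw [e1]
    simp only [Pi.add_apply, e2, Pi.sup_apply, e3, e4, Pi.neg_apply, Pi.zero_apply]
    rcases le_total 0 (m ω) with hm | hm
    · rw [sup_eq_right.2 (by linarith)]; simp
    · rw [sup_eq_left.2 (by linarith)]; simp
  rw [inner_add_left, real_inner_self_eq_norm_sq] at hzero
  have h3 : ‖(-m) ⊔ 0‖ = 0 := by nlinarith [sq_nonneg ‖(-m) ⊔ 0‖]
  have h4 : (-m) ⊔ 0 = 0 := norm_eq_zero.1 h3
  have h5 : -m ≤ 0 := h4 ▸ le_sup_left
  simpa using h5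

lemma hb_duality {I J : Type*} [Fintype I] [Fintype J] [Nonempty I] [Nonempty J]
    [DecidableEq I] [DecidableEq J]
    (u : I → Lp ℝ 2 P) (v : J → Lp ℝ 2 P) (hu : ∀ i, 0 ≤ u i) (hv : ∀ j, 0 ≤ v j)
    (huv : ∑ i, u i = ∑ j, v j) (F : I → J → Lp ℝ 2 P) :
    ∃ m : I → J → Lp ℝ 2 P, (∀ i j, 0 ≤ m i j) ∧ (∀ i, ∑ j, m i j = u i) ∧
      (∀ j, ∑ i, m i j = v j) ∧
      ∀ ε : ℝ, 0 < ε → ∃ (a : I → Lp ℝ 2 P) (b : J → Lp ℝ 2 P), (∀ i j, F i j ≤ a i + b j) ∧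
        (∑ i, inner ℝ (u i) (a i)) + (∑ j, inner ℝ (v j) (b j))
          ≤ (∑ i, ∑ j, inner ℝ (m i j) (F i j)) + ε := by
  classical
  let val : (I → Lp ℝ 2 P) → (J → Lp ℝ 2 P) → ℝ := fun a b =>
    (∑ i, inner ℝ (u i) (a i)) + (∑ j, inner ℝ (v j) (b j))
  have val_add : ∀ a b a' b', val (a + a') (b + b') = val a b + val a' b' := by
    intro a b a' b'
    simp only [val, Pi.add_apply, inner_add_right, Finset.sum_add_distrib]; ring
  have val_smul : ∀ (t : ℝ) a b, val (t • a) (t • b) = t * val a b := by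
    intro t a b
    simp only [val, Pi.smul_apply, inner_smul_right, ← Finset.mul_sum]; ring
  have val_nonneg : ∀ a b, (∀ i j, 0 ≤ a i + b j) → 0 ≤ val a b := by
    intro a b hab
    let s := Finset.univ.inf' Finset.univ_nonempty a
    have h1 : ∀ i, s ≤ a i := fun i => Finset.inf'_le _ (Finset.mem_univ i)
    have h2 : ∀ j, -s ≤ b j := by
      intro j
      have : -(b j) ≤ s := Finset.le_inf' _ _ (fun i _ => neg_le_iff_add_nonneg.2 (hab i j))
      exact neg_le.1 this
    have e1 : ∑ i, inner ℝ (u i) s ≤ ∑ i, inner ℝ (u i) (a i) := by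
      refine Finset.sum_le_sum fun i _ => ?_
      have := L2_inner_nonneg (hu i) (sub_nonneg.2 (h1 i))
      rw [inner_sub_right] at this; linarith
    have e2 : ∑ j, inner ℝ (v j) (-s) ≤ ∑ j, inner ℝ (v j) (b j) := by
      refine Finset.sum_le_sum fun j _ => ?_
      have := L2_inner_nonneg (hv j) (sub_nonneg.2 (h2 j))
      rw [inner_sub_right] at this; linarith
    rw [← sum_inner, huv] at e1
    rw [← sum_inner, inner_neg_right] at e2
    simp only [val]; linarith
  let V : (I → J → Lp ℝ 2 P) → Set ℝ := fun F =>
    {r | ∃ a b, (∀ i j, F i j ≤ a i + b j) ∧ r = val a b}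
  have Vne : ∀ F, (V F).Nonempty := by
    intro F
    refine ⟨_, fun i => ∑ j, |F i j|, 0, fun i j => ?_, rfl⟩
    simp only [Pi.zero_apply, add_zero]
    exact (le_abs_self _).trans
      (Finset.single_le_sum (f := fun j => |F i j|) (fun j _ => abs_nonneg _) (Finset.mem_univ j))
  have Vbdd : ∀ F, BddBelow (V F) := by
    intro F
    obtain ⟨_, a', b', h', rfl⟩ := Vne (-F)
    refine ⟨- val a' b', ?_⟩
    rintro _ ⟨a, b, h, rfl⟩
    have := val_nonneg (a + a') (b + b') (fun i j => by
      have := add_le_add (h i j) (h' i j)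
      simp only [Pi.neg_apply, add_neg_cancel] at this
      simp only [Pi.add_apply]
      calc (0 : Lp ℝ 2 P) ≤ _ := this
        _ = _ := by abel)
    rw [val_add] at this; linarith
  let p : (I → J → Lp ℝ 2 P) → ℝ := fun F => sInf (V F)
  have p_le : ∀ F a b, (∀ i j, F i j ≤ a i + b j) → p F ≤ val a b :=
    fun F a b h => csInf_le (Vbdd F) ⟨a, b, h, rfl⟩
  have p_add : ∀ F G, p (F + G) ≤ p F + p G := by
    intro F G
    refine le_of_forall_pos_lt_add fun ε hε => ?_
    obtain ⟨_, ⟨a, b, h, rfl⟩, h1⟩ := Real.lt_sInf_add_pos (Vne F) (half_pos hε)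
    obtain ⟨_, ⟨a', b', h', rfl⟩, h1'⟩ := Real.lt_sInf_add_pos (Vne G) (half_pos hε)
    have := p_le (F + G) (a + a') (b + b') (fun i j => by
      have := add_le_add (h i j) (h' i j)
      simp only [Pi.add_apply]
      calc _ ≤ _ := this
        _ = _ := by abel)
    rw [val_add] at this
    simp only [p] at *
    linarith
  have smul_le : ∀ (t : ℝ) (x y : Lp ℝ 2 P), 0 ≤ t → x ≤ y → t • x ≤ t • y := by
    intro t x y ht hxy
    rw [← Lp.coeFn_le] at hxy ⊢
    filter_upwards [hxy, Lp.coeFn_smul t x, Lp.coeFn_smul t y] with ω h e1 e2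
    rw [e1, e2]; exact mul_le_mul_of_nonneg_left h ht
  have p_smul_le : ∀ t : ℝ, 0 < t → ∀ F, p (t • F) ≤ t * p F := by
    intro t ht F
    rw [← div_le_iff₀' ht]
    refine le_csInf (Vne F) ?_
    rintro _ ⟨a, b, h, rfl⟩
    rw [div_le_iff₀' ht, ← val_smul]
    exact p_le _ _ _ (fun i j => by
      simp only [Pi.smul_apply, ← smul_add]
      exact smul_le _ _ _ ht.le (h i j))
  have p_smul : ∀ t : ℝ, 0 < t → ∀ F, p (t • F) = t * p F := by
    intro t ht F
    refine le_antisymm (p_smul_le t ht F) ?_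
    have := p_smul_le t⁻¹ (inv_pos.2 ht) (t • F)
    rw [smul_smul, inv_mul_cancel₀ ht.ne', one_smul] at this
    calc t * p F ≤ t * (t⁻¹ * p (t • F)) := mul_le_mul_of_nonneg_left this ht.le
      _ = _ := by field_simp
  have p_zero : p 0 = 0 := by
    have := p_smul 2 two_pos 0
    rw [smul_zero] at this; linarith
  have p_neg : ∀ F, - p (-F) ≤ p F := by
    intro F
    have := p_add F (-F)
    rw [add_neg_cancel, p_zero] at this; linarith
  obtain ⟨L, hLF, hLp⟩ : ∃ L : (I → J → Lp ℝ 2 P) →ₗ[ℝ] ℝ, L F = p F ∧ ∀ G, L G ≤ p G := by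
    have H : ∀ t : ℝ, t • F = 0 → (RingHom.id ℝ) t • p F = 0 := by
      intro t ht
      rcases smul_eq_zero.1 ht with h | h
      · simp [h]
      · simp [h, p_zero]
    obtain ⟨g, hg1, hg2⟩ := exists_extension_of_le_sublinear
      (LinearPMap.mkSpanSingleton' F (p F) H) p p_smul p_add (by
        rintro ⟨x, hx⟩
        obtain ⟨t, rfl⟩ := Submodule.mem_span_singleton.1 hx
        rw [LinearPMap.mkSpanSingleton'_apply]
        simp only [RingHom.id_apply, smul_eq_mul]
        rcases lt_trichotomy t 0 with ht | ht | ht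
        · have := p_smul (-t) (by linarith) (-F)
          rw [neg_smul_neg] at this
          rw [this]
          nlinarith [p_neg F]
        · simp [ht, p_zero]
        · rw [p_smul t ht])
    refine ⟨g, ?_, hg2⟩
    have := hg1 ⟨F, Submodule.mem_span_singleton_self F⟩
    exact this.trans (LinearPMap.mkSpanSingleton'_apply_self F (p F) H _)
  have hLge : ∀ G, -p (-G) ≤ L G := by
    intro G
    have := hLp (-G)
    rw [map_neg] at this; linarith
  have L_pos : ∀ G, (∀ i j, 0 ≤ G i j) → 0 ≤ L G := by
    intro G hG
    have h1 := hLge G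
    have h2 := p_le (-G) 0 0 (fun i j => by simpa using hG i j)
    have h3 : val 0 0 = 0 := by simp [val]
    linarith
  have L_mono : ∀ G G', (∀ i j, G i j ≤ G' i j) → L G ≤ L G' := by
    intro G G' h
    have := L_pos (G' - G) (fun i j => by simpa using h i j)
    rw [map_sub] at this; linarith
  have L_val : ∀ a b, L (fun i j => a i + b j) = val a b := by
    intro a b
    refine le_antisymm ((hLp _).trans (p_le _ _ _ fun i j => le_rfl)) ?_
    have h1 := hLge (fun i j => a i + b j)
    have h2 := p_le (-(fun i j => a i + b j)) (-a) (-b) (fun i j => by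
      simp only [Pi.neg_apply]; exact le_of_eq (by abel))
    have h3 : val (-a) (-b) = - val a b := by
      have := val_smul (-1) a b
      simpa using this
    linarith
  let sg : I → J → Lp ℝ 2 P →ₗ[ℝ] (I → J → Lp ℝ 2 P) := fun i j =>
    (LinearMap.single ℝ (fun _ : I => (J → Lp ℝ 2 P)) i) ∘ₗ (LinearMap.single ℝ (fun _ : J => Lp ℝ 2 P) j)
  have sg_apply : ∀ i j g i' j', sg i j g i' j' = if i = i' ∧ j = j' then g else 0 := by
    intro i j g i' j'
    simp only [sg, LinearMap.comp_apply, LinearMap.single_apply, Pi.single_apply]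
    by_cases h1 : i' = i
    · subst h1
      by_cases h2 : j' = j
      · subst h2; simp
      · simp [h2, Ne.symm h2]
    · simp [h1, Ne.symm h1]
  have hbd : ∀ i j g, ‖(L ∘ₗ sg i j) g‖ ≤ ‖u i‖ * ‖g‖ := by
    intro i j g
    have key : ∀ g, L (sg i j g) ≤ ‖u i‖ * ‖g‖ := by
      intro g
      have h1 := L_mono (sg i j g) (fun i' j' => Pi.single (M := fun _ : I => Lp ℝ 2 P) i |g| i' + (0 : J → Lp ℝ 2 P) j') (by
        intro i' j'
        rw [sg_apply]
        simp only [Pi.single_apply, Pi.zero_apply, add_zero]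
        split_ifs with h1 h2 h2
        · exact le_abs_self _
        · exact absurd h1.1.symm h2
        · exact abs_nonneg _
        · exact le_rfl)
      rw [L_val] at h1
      have h2 : val (Pi.single i |g|) 0 = inner ℝ (u i) |g| := by
        simp only [val, Pi.zero_apply, inner_zero_right, Finset.sum_const_zero, add_zero]
        rw [Finset.sum_eq_single i]
        · simp
        · intro i' _ h; simp [h]
        · simp
      rw [h2] at h1
      refine h1.trans ((real_inner_le_norm _ _).trans ?_)
      rw [norm_abs_eq_norm]
    rw [Real.norm_eq_abs, abs_le]
    constructor
    · have := key (-g)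
      rw [map_neg, map_neg, norm_neg] at this
      simp only [LinearMap.comp_apply]; linarith
    · exact key g
  let m : I → J → Lp ℝ 2 P := fun i j =>
    (InnerProductSpace.toDual ℝ (Lp ℝ 2 P)).symm ((L ∘ₗ sg i j).mkContinuous ‖u i‖ (hbd i j))
  have hm : ∀ i j g, inner ℝ (m i j) g = L (sg i j g) := by
    intro i j g
    simp only [m, InnerProductSpace.toDual_symm_apply, LinearMap.mkContinuous_apply, LinearMap.comp_apply]
  have hLm : ∀ G, L G = ∑ i, ∑ j, inner ℝ (m i j) (G i j) := by
    intro G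
    have : G = ∑ i, ∑ j, sg i j (G i j) := by
      funext i' j'
      simp only [Finset.sum_apply, sg_apply, ite_and]
      simp
    conv_lhs => rw [this]
    simp only [map_sum, hm]
  refine ⟨m, ?_, ?_, ?_, ?_⟩
  · intro i j
    refine L2_nonneg_of_inner fun g hg => ?_
    rw [hm]
    refine L_pos _ fun i' j' => ?_
    rw [sg_apply]; split_ifs
    · exact hg
    · exact le_rfl
  · intro i
    refine ext_inner_right ℝ fun g => ?_
    have h1 := L_val (Pi.single i g) 0
    rw [hLm] at h1
    simp only [val, Pi.zero_apply, inner_zero_right, Finset.sum_const_zero, add_zero] at h1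
    rw [Finset.sum_eq_single i (by intro i' _ h; simp [h]) (by simp)] at h1
    rw [Finset.sum_eq_single i (by intro i' _ h; simp [h]) (by simp)] at h1
    simpa [sum_inner] using h1
  · intro j
    refine ext_inner_right ℝ fun g => ?_
    have h1 := L_val 0 (Pi.single j g)
    rw [hLm, Finset.sum_comm] at h1
    simp only [val, Pi.zero_apply, inner_zero_right, Finset.sum_const_zero, zero_add] at h1
    rw [Finset.sum_eq_single j (by intro i' _ h; simp [h]) (by simp)] at h1
    rw [Finset.sum_eq_single j (by intro i' _ h; simp [h]) (by simp)] at h1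
    simpa [sum_inner] using h1
  · intro ε hε
    obtain ⟨_, ⟨a, b, h, rfl⟩, h1⟩ := Real.lt_sInf_add_pos (Vne F) hε
    refine ⟨a, b, h, ?_⟩
    rw [← hLm, hLF]
    exact h1.le
end HB

section Coupling
lemma exists_coupling {Ω X Y : Type*} [MeasurableSpace Ω] [MeasurableSpace X] [MeasurableSpace Y]
    (μ : Kernel Ω X) [IsMarkovKernel μ] (ν : Kernel Ω Y) [IsMarkovKernel ν]
    {I J : Type*} [Fintype I] [Fintype J] [MeasurableSpace I] [MeasurableSpace J]
    [MeasurableSingletonClass I] [MeasurableSingletonClass J]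
    (s : X → I) (t : Y → J) (hs : Measurable s) (ht : Measurable t)
    (m : Ω → I → J → ℝ≥0∞) (hm : ∀ i j, Measurable (fun ω => m ω i j))
    (hrow : ∀ ω i, ∑ j, m ω i j = μ ω (s ⁻¹' {i})) (hcol : ∀ ω j, ∑ i, m ω i j = ν ω (t ⁻¹' {j})) :
    ∃ π : Kernel Ω (X × Y), IsMarkovKernel π ∧ π.fst = μ ∧ π.snd = ν ∧
      ∀ ω (g : I → J → ℝ≥0∞), ∫⁻ q, g (s q.1) (t q.2) ∂(π ω) = ∑ i, ∑ j, m ω i j * g i j := by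
  classical
  let u : Ω → I → ℝ≥0∞ := fun ω i => μ ω (s ⁻¹' {i})
  let v : Ω → J → ℝ≥0∞ := fun ω j => ν ω (t ⁻¹' {j})
  have hsi : ∀ i, MeasurableSet (s ⁻¹' {i}) := fun i => hs (measurableSet_singleton i)
  have htj : ∀ j, MeasurableSet (t ⁻¹' {j}) := fun j => ht (measurableSet_singleton j)
  have hu : ∀ i, Measurable (fun ω => u ω i) := fun i => μ.measurable_coe (hsi i)
  have hv : ∀ j, Measurable (fun ω => v ω j) := fun j => ν.measurable_coe (htj j)
  let Q : Ω → I → J → ℝ≥0∞ := fun ω i j => m ω i j / (u ω i * v ω j)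
  have hQ : ∀ i j, Measurable (fun ω => Q ω i j) := fun i j =>
    (hm i j).div ((hu i).mul (hv j))
  have hut : ∀ ω i, u ω i ≠ ∞ := fun ω i => measure_ne_top _ _
  have hvt : ∀ ω j, v ω j ≠ ∞ := fun ω j => measure_ne_top _ _
  have hmu : ∀ ω i j, m ω i j ≤ u ω i := fun ω i j => by
    simp only [u]; rw [← hrow]
    exact Finset.single_le_sum (f := fun j => m ω i j) (fun _ _ => zero_le) (Finset.mem_univ j)
  have hmv : ∀ ω i j, m ω i j ≤ v ω j := fun ω i j => by
    simp only [v]; rw [← hcol]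
    exact Finset.single_le_sum (f := fun i => m ω i j) (fun _ _ => zero_le) (Finset.mem_univ i)
  have hkey : ∀ ω i j, u ω i * v ω j * Q ω i j = m ω i j := by
    intro ω i j
    by_cases h0 : u ω i * v ω j = 0
    · have : m ω i j = 0 := by
        rcases mul_eq_zero.1 h0 with h | h
        · exact le_antisymm (h ▸ hmu ω i j) zero_le
        · exact le_antisymm (h ▸ hmv ω i j) zero_le
      simp [h0, this]
    · exact ENNReal.mul_div_cancel h0 (ENNReal.mul_ne_top (hut ω i) (hvt ω j))
  have hQrow : ∀ ω i, u ω i ≠ 0 → ∑ j, v ω j * Q ω i j = 1 := by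
    intro ω i h0
    have : u ω i * ∑ j, v ω j * Q ω i j = u ω i * 1 := by
      rw [Finset.mul_sum, mul_one]
      simp only [← mul_assoc, hkey]
      exact hrow ω i
    exact (ENNReal.mul_right_inj h0 (hut ω i)).1 this
  have hQcol : ∀ ω j, v ω j ≠ 0 → ∑ i, u ω i * Q ω i j = 1 := by
    intro ω j h0
    have : v ω j * ∑ i, u ω i * Q ω i j = v ω j * 1 := by
      rw [Finset.mul_sum, mul_one]
      refine Eq.trans ?_ (hcol ω j)
      refine Finset.sum_congr rfl fun i _ => ?_
      rw [← hkey ω i j]; ring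
    exact (ENNReal.mul_right_inj h0 (hvt ω j)).1 this
  have hfib_t : ∀ ω (k : J → ℝ≥0∞), ∫⁻ y, k (t y) ∂(ν ω) = ∑ j, v ω j * k j := by
    intro ω k
    rw [← lintegral_map (f := k) (measurable_of_countable k) ht, lintegral_fintype]
    refine Finset.sum_congr rfl fun j _ => ?_
    rw [Measure.map_apply ht (measurableSet_singleton j), mul_comm]
  have hfib_s : ∀ ω (k : I → ℝ≥0∞), ∫⁻ x, k (s x) ∂(μ ω) = ∑ i, u ω i * k i := by
    intro ω k
    rw [← lintegral_map (f := k) (measurable_of_countable k) hs, lintegral_fintype]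
    refine Finset.sum_congr rfl fun j _ => ?_
    rw [Measure.map_apply hs (measurableSet_singleton j), mul_comm]
  have haes : ∀ ω, ∀ᵐ x ∂(μ ω), u ω (s x) ≠ 0 := by
    intro ω
    rw [ae_iff]
    refine measure_mono_null (t := ⋃ i ∈ {i | u ω i = 0}, s ⁻¹' {i}) ?_ ?_
    · intro x hx
      simp only [ne_eq, not_not, Set.mem_ofPred_eq] at hx
      simp [hx]
    · exact (measure_biUnion_null_iff (Set.to_countable _)).2 fun i hi => hi
  have haet : ∀ ω, ∀ᵐ y ∂(ν ω), v ω (t y) ≠ 0 := by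
    intro ω
    rw [ae_iff]
    refine measure_mono_null (t := ⋃ j ∈ {j | v ω j = 0}, t ⁻¹' {j}) ?_ ?_
    · intro x hx
      simp only [ne_eq, not_not, Set.mem_ofPred_eq] at hx
      simp [hx]
    · exact (measure_biUnion_null_iff (Set.to_countable _)).2 fun i hi => hi
  let h : Ω → X × Y → ℝ≥0∞ := fun ω q => Q ω (s q.1) (t q.2)
  have hh : Measurable (Function.uncurry h) := by
    have h1 : Measurable (fun z : Ω × (I × J) => Q z.1 z.2.1 z.2.2) :=
      measurable_from_prod_countable_left (fun z => hQ z.1 z.2)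
    exact h1.comp (f := fun z : Ω × (X × Y) => (z.1, (s z.2.1, t z.2.2))) (by fun_prop)
  have hhω : ∀ ω, Measurable (h ω) := fun ω => hh.comp measurable_prodMk_left
  let π : Kernel Ω (X × Y) := Kernel.withDensity (μ ×ₖ ν) h
  have hπ : ∀ ω (f : X × Y → ℝ≥0∞), Measurable f →
      ∫⁻ q, f q ∂(π ω) = ∫⁻ q, h ω q * f q ∂((μ ω).prod (ν ω)) := by
    intro ω f hf
    simp only [π]
    rw [Kernel.lintegral_withDensity _ hh _ hf, Kernel.prod_apply]
  have hπ1 : ∀ ω (f : X × Y → ℝ≥0∞), Measurable f →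
      ∫⁻ q, f q ∂(π ω) = ∫⁻ x, ∫⁻ y, h ω (x, y) * f (x, y) ∂(ν ω) ∂(μ ω) := by
    intro ω f hf
    rw [hπ ω f hf]
    exact lintegral_prod _ ((hhω ω).mul hf).aemeasurable
  have hπ2 : ∀ ω (f : X × Y → ℝ≥0∞), Measurable f →
      ∫⁻ q, f q ∂(π ω) = ∫⁻ y, ∫⁻ x, h ω (x, y) * f (x, y) ∂(μ ω) ∂(ν ω) := by
    intro ω f hf
    rw [hπ ω f hf]
    exact lintegral_prod_symm _ ((hhω ω).mul hf).aemeasurable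
  have hfst : π.fst = μ := by
    ext ω A hA
    rw [Kernel.fst_apply' _ _ hA]
    change π ω (Prod.fst ⁻¹' A) = _
    rw [← lintegral_indicator_one (measurable_fst hA), hπ1 ω _ (by exact measurable_one.indicator (measurable_fst hA)),
      ← lintegral_indicator_one hA]
    refine lintegral_congr_ae ?_
    filter_upwards [haes ω] with x hx
    have : ∀ y, (Prod.fst ⁻¹' A : Set (X × Y)).indicator (1 : X × Y → ℝ≥0∞) (x, y) = A.indicator 1 x := by
      intro y; by_cases hxA : x ∈ A <;> simp [hxA]
    simp only [this]
    rw [lintegral_mul_const (f := fun y => h ω (x, y)) _ ((hhω ω).comp measurable_prodMk_left)]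
    simp only [h]
    rw [hfib_t ω (fun j => Q ω (s x) j), hQrow ω _ hx, one_mul]
  have hsnd : π.snd = ν := by
    ext ω A hA
    rw [Kernel.snd_apply' _ _ hA]
    change π ω (Prod.snd ⁻¹' A) = _
    rw [← lintegral_indicator_one (measurable_snd hA), hπ2 ω _ (by exact measurable_one.indicator (measurable_snd hA)),
      ← lintegral_indicator_one hA]
    refine lintegral_congr_ae ?_
    filter_upwards [haet ω] with y hy
    have : ∀ x, (Prod.snd ⁻¹' A : Set (X × Y)).indicator (1 : X × Y → ℝ≥0∞) (x, y) = A.indicator 1 y := by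
      intro x; by_cases hxA : y ∈ A <;> simp [hxA]
    simp only [this]
    rw [lintegral_mul_const (f := fun x => h ω (x, y)) _ ((hhω ω).comp measurable_prodMk_right)]
    simp only [h]
    rw [hfib_s ω (fun i => Q ω i (t y)), hQcol ω _ hy, one_mul]
  refine ⟨π, ⟨fun ω => ⟨?_⟩⟩, hfst, hsnd, ?_⟩
  · have : π.fst ω Set.univ = 1 := by rw [hfst]; exact measure_univ
    rwa [Kernel.fst_apply' _ _ MeasurableSet.univ] at this
  · intro ω g
    have hg : Measurable (fun q : X × Y => g (s q.1) (t q.2)) :=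
      (measurable_of_countable (fun z : I × J => g z.1 z.2)).comp
        (f := fun q : X × Y => (s q.1, t q.2)) (by fun_prop)
    rw [hπ1 ω _ hg]
    simp only [h]
    have : ∀ x, ∫⁻ y, Q ω (s x) (t y) * g (s x) (t y) ∂(ν ω) = ∑ j, v ω j * (Q ω (s x) j * g (s x) j) :=
      fun x => hfib_t ω (fun j => Q ω (s x) j * g (s x) j)
    simp only [this]
    rw [hfib_s ω (fun i => ∑ j, v ω j * (Q ω i j * g i j))]
    refine Finset.sum_congr rfl fun i _ => ?_
    rw [Finset.mul_sum]
    refine Finset.sum_congr rfl fun j _ => ?_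
    rw [← hkey ω i j]; ring
end Coupling

section Attain

lemma exists_seq_max {H : Type*} [NormedAddCommGroup H] [InnerProductSpace ℝ H] [CompleteSpace H]
    (S : Set H) (hS : Convex ℝ S) (hne : S.Nonempty) (R : ℝ) (hR : ∀ z ∈ S, ‖z‖ ≤ R)
    (L : H →L[ℝ] ℝ) :
    ∃ (z : ℕ → H) (z0 : H), (∀ n, z n ∈ S) ∧ Tendsto z atTop (nhds z0) ∧ ∀ w ∈ S, L w ≤ L z0 := by
  have hbdd : BddAbove (L '' S) := by
    refine ⟨‖L‖ * R, ?_⟩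
    rintro _ ⟨z, hz, rfl⟩
    exact (le_abs_self _).trans ((L.le_opNorm z).trans
      (mul_le_mul_of_nonneg_left (hR z hz) (norm_nonneg _)))
  set M := sSup (L '' S) with hM
  let δ : ℕ → ℝ := fun n => 1 / ((n : ℝ) + 1)
  have hδpos : ∀ n, 0 < δ n := fun n => Nat.one_div_pos_of_nat
  have hδanti : ∀ m n, m ≤ n → δ n ≤ δ m := fun m n h => Nat.one_div_le_one_div h
  have hδ0 : Tendsto δ atTop (nhds 0) := tendsto_one_div_add_atTop_nhds_zero_nat
  let T : ℕ → Set H := fun n => {z ∈ S | M - δ n ≤ L z}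
  have hTne : ∀ n, (T n).Nonempty := by
    intro n
    obtain ⟨_, ⟨z, hz, rfl⟩, h⟩ := exists_lt_of_lt_csSup (hne.image L) (sub_lt_self M (hδpos n))
    exact ⟨z, hz, h.le⟩
  have hTanti : ∀ m n, m ≤ n → T n ⊆ T m := by
    intro m n h z hz
    exact ⟨hz.1, by have := hz.2; have := hδanti m n h; linarith⟩
  have hTconv : ∀ n, ∀ x ∈ T n, ∀ y ∈ T n, (1 / 2 : ℝ) • x + (1 / 2 : ℝ) • y ∈ T n := by
    intro n x hx y hy
    refine ⟨hS hx.1 hy.1 (by norm_num) (by norm_num) (by norm_num), ?_⟩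
    rw [map_add, map_smul, map_smul]
    have := hx.2; have := hy.2
    simp only [smul_eq_mul]; linarith
  let d : ℕ → ℝ := fun n => sInf (norm '' T n)
  have hbb : ∀ n, BddBelow (norm '' T n) := by
    intro n
    refine ⟨0, ?_⟩
    rintro _ ⟨z, _, rfl⟩; exact norm_nonneg z
  have hdle : ∀ n, ∀ z ∈ T n, d n ≤ ‖z‖ := fun n z hz => csInf_le (hbb n) ⟨z, hz, rfl⟩
  have hd0 : ∀ n, 0 ≤ d n := fun n => le_csInf ((hTne n).image _) (by
    rintro _ ⟨z, _, rfl⟩; exact norm_nonneg z)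
  have hdmono : Monotone d := by
    intro m n h
    exact csInf_le_csInf (hbb m) ((hTne n).image _) (Set.image_mono (hTanti m n h))
  have hdR : ∀ n, d n ≤ R := by
    intro n
    obtain ⟨z, hz⟩ := hTne n
    exact (hdle n z hz).trans (hR z hz.1)
  have hdb : BddAbove (Set.range d) := ⟨R, by rintro _ ⟨n, rfl⟩; exact hdR n⟩
  have hdt := tendsto_atTop_ciSup hdmono hdb
  set D := ⨆ n, d n with hD
  have hdD : ∀ n, d n ≤ D := fun n => le_ciSup hdb n
  have hex : ∀ n, ∃ z ∈ T n, ‖z‖ < d n + δ n := by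
    intro n
    obtain ⟨_, ⟨z, hz, rfl⟩, h⟩ := Real.lt_sInf_add_pos ((hTne n).image norm) (hδpos n)
    exact ⟨z, hz, h⟩
  choose z hzT hzn using hex
  have hC : CauchySeq z := by
    refine cauchySeq_of_le_tendsto_0 (fun N => Real.sqrt (4 * (D + δ N) ^ 2 - 4 * (d N) ^ 2)) ?_ ?_
    · intro n m N hn hm
      rw [dist_eq_norm]
      apply Real.le_sqrt_of_sq_le
      have h1 : ‖z n‖ ≤ D + δ N := by have := hzn n; have := hdD n; have := hδanti N n hn; linarith
      have h2 : ‖z m‖ ≤ D + δ N := by have := hzn m; have := hdD m; have := hδanti N m hm; linarith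
      have h3 := hdle N _ (hTconv N _ (hTanti N n hn (hzT n)) _ (hTanti N m hm (hzT m)))
      rw [← smul_add, norm_smul] at h3
      have h4 : 2 * d N ≤ ‖z n + z m‖ := by
        rw [Real.norm_of_nonneg (by norm_num)] at h3; linarith
      have h5 := parallelogram_law_with_norm ℝ (z n) (z m)
      have h6 := hd0 N
      have h7 := pow_le_pow_left₀ (norm_nonneg _) h1 2
      have h8 := pow_le_pow_left₀ (norm_nonneg _) h2 2
      have h9 := pow_le_pow_left₀ (by linarith) h4 2
      nlinarith
    · have : Tendsto (fun N => Real.sqrt (4 * (D + δ N) ^ 2 - 4 * (d N) ^ 2)) atTop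
          (nhds (Real.sqrt (4 * (D + 0) ^ 2 - 4 * D ^ 2))) := by
        refine (Real.continuous_sqrt.tendsto _).comp ?_
        exact (((tendsto_const_nhds.add hδ0).pow 2).const_mul 4).sub ((hdt.pow 2).const_mul 4)
      simpa using this
  obtain ⟨z0, hz0⟩ := cauchySeq_tendsto_of_complete hC
  refine ⟨z, z0, fun n => (hzT n).1, hz0, fun w hw => ?_⟩
  have h1 : L w ≤ M := le_csSup hbdd ⟨w, hw, rfl⟩
  have h2 : Tendsto (fun n => M - δ n) atTop (nhds (M - 0)) := tendsto_const_nhds.sub hδ0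
  have h3 : Tendsto (fun n => L (z n)) atTop (nhds (L z0)) := (L.continuous.tendsto _).comp hz0
  have := le_of_tendsto_of_tendsto' h2 h3 (fun n => (hzT n).2)
  linarith

/-- The dual competitors. -/
structure IsDual {Ω X Y : Type*} [MeasurableSpace Ω] [PseudoMetricSpace X] [MeasurableSpace X]
    [PseudoMetricSpace Y] [MeasurableSpace Y] (c : Ω → X → Y → ℝ) (K : Ω → ℝ≥0) (C : ℝ)
    (ψ : Ω → X → ℝ) (ψc : Ω → Y → ℝ) : Prop where
  m1 : Measurable (fun q : Ω × X => ψ q.1 q.2)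
  m2 : Measurable (fun q : Ω × Y => ψc q.1 q.2)
  b1 : ∀ ω x, |ψ ω x| ≤ C
  b2 : ∀ ω y, |ψc ω y| ≤ C
  l1 : ∀ ω x x', ψ ω x ≤ ψ ω x' + K ω * dist x x'
  l2 : ∀ ω y y', ψc ω y ≤ ψc ω y' + K ω * dist y y'
  le : ∀ ω x y, ψc ω y - ψ ω x ≤ c ω x y

lemma limsup_le_add {a b : ℕ → ℝ} {C r : ℝ} (ha : ∀ n, |a n| ≤ C) (hb : ∀ n, |b n| ≤ C)
    (h : ∀ n, a n ≤ b n + r) : limsup a atTop ≤ limsup b atTop + r := by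
  have ba : IsBoundedUnder (· ≤ ·) atTop b := isBoundedUnder_of ⟨C, fun n => (abs_le.1 (hb n)).2⟩
  have bb : IsBoundedUnder (· ≥ ·) atTop b := isBoundedUnder_of ⟨-C, fun n => (abs_le.1 (hb n)).1⟩
  have ab : IsBoundedUnder (· ≥ ·) atTop a := isBoundedUnder_of ⟨-C, fun n => (abs_le.1 (ha n)).1⟩
  rw [← limsup_add_const atTop b r ba bb.isCoboundedUnder_le]
  refine limsup_le_limsup (Eventually.of_forall h) ab.isCoboundedUnder_le ?_
  exact isBoundedUnder_of ⟨C + r, fun n => by have := (abs_le.1 (hb n)).2; linarith⟩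

lemma abs_limsup_le {a : ℕ → ℝ} {C : ℝ} (ha : ∀ n, |a n| ≤ C) : |limsup a atTop| ≤ C := by
  have ba : IsBoundedUnder (· ≤ ·) atTop a := isBoundedUnder_of ⟨C, fun n => (abs_le.1 (ha n)).2⟩
  have bb : IsBoundedUnder (· ≥ ·) atTop a := isBoundedUnder_of ⟨-C, fun n => (abs_le.1 (ha n)).1⟩
  rw [abs_le]
  constructor
  · exact le_limsup_of_frequently_le (Frequently.of_forall fun n => (abs_le.1 (ha n)).1) ba
  · exact limsup_le_of_le bb.isCoboundedUnder_le (Eventually.of_forall fun n => (abs_le.1 (ha n)).2)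

section
variable {Ω X Y : Type*} [MeasurableSpace Ω] [PseudoMetricSpace X] [MeasurableSpace X]
    [PseudoMetricSpace Y] [MeasurableSpace Y] {c : Ω → X → Y → ℝ} {K : Ω → ℝ≥0} {C : ℝ}

lemma IsDual.limsup {ψ : ℕ → Ω → X → ℝ} {ψc : ℕ → Ω → Y → ℝ} (h : ∀ n, IsDual c K C (ψ n) (ψc n)) :
    IsDual c K C (fun ω x => limsup (fun n => ψ n ω x) atTop)
      (fun ω y => limsup (fun n => ψc n ω y) atTop) where
  m1 := Measurable.limsup fun n => (h n).m1
  m2 := Measurable.limsup fun n => (h n).m2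
  b1 ω x := abs_limsup_le fun n => (h n).b1 ω x
  b2 ω x := abs_limsup_le fun n => (h n).b2 ω x
  l1 ω x x' := limsup_le_add (fun n => (h n).b1 ω x) (fun n => (h n).b1 ω x') (fun n => (h n).l1 ω x x')
  l2 ω x x' := limsup_le_add (fun n => (h n).b2 ω x) (fun n => (h n).b2 ω x') (fun n => (h n).l2 ω x x')
  le ω x y := by
    have := limsup_le_add (r := c ω x y) (fun n => (h n).b2 ω y) (fun n => (h n).b1 ω x)
      (fun n => by have := (h n).le ω x y; linarith)
    linarith

lemma IsDual.convex {ψ φ : Ω → X → ℝ} {ψc φc : Ω → Y → ℝ} (h : IsDual c K C ψ ψc)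
    (h' : IsDual c K C φ φc) {a b : ℝ} (ha : 0 ≤ a) (hb : 0 ≤ b) (hab : a + b = 1) :
    IsDual c K C (fun ω x => a * ψ ω x + b * φ ω x) (fun ω y => a * ψc ω y + b * φc ω y) := by
  obtain rfl : b = 1 - a := by linarith
  refine ⟨(h.m1.const_mul a).add (h'.m1.const_mul _), (h.m2.const_mul a).add (h'.m2.const_mul _), ?_, ?_, ?_, ?_, ?_⟩
  · intro ω x
    have h1 := abs_le.1 (h.b1 ω x); have h2 := abs_le.1 (h'.b1 ω x)
    rw [abs_le]; constructor <;> nlinarith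
  · intro ω x
    have h1 := abs_le.1 (h.b2 ω x); have h2 := abs_le.1 (h'.b2 ω x)
    rw [abs_le]; constructor <;> nlinarith
  · intro ω x x'
    nlinarith [mul_le_mul_of_nonneg_left (h.l1 ω x x') ha, mul_le_mul_of_nonneg_left (h'.l1 ω x x') hb]
  · intro ω x x'
    nlinarith [mul_le_mul_of_nonneg_left (h.l2 ω x x') ha, mul_le_mul_of_nonneg_left (h'.l2 ω x x') hb]
  · intro ω x y
    nlinarith [mul_le_mul_of_nonneg_left (h.le ω x y) ha, mul_le_mul_of_nonneg_left (h'.le ω x y) hb]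

lemma integral_bdd_compProd {Z : Type*} [MeasurableSpace Z] (P : Measure Ω) [IsProbabilityMeasure P]
    (μ : Kernel Ω Z) [IsMarkovKernel μ] {ψ : Ω → Z → ℝ}
    (hm : Measurable (fun q : Ω × Z => ψ q.1 q.2)) (hb : ∀ ω x, |ψ ω x| ≤ C) :
    Integrable (fun q : Ω × Z => ψ q.1 q.2) (P ⊗ₘ μ) ∧
    Integrable (fun ω => ∫ x, ψ ω x ∂(μ ω)) P ∧
    ∫ q, ψ q.1 q.2 ∂(P ⊗ₘ μ) = ∫ ω, ∫ x, ψ ω x ∂(μ ω) ∂P := by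
  have h1 : Integrable (fun q : Ω × Z => ψ q.1 q.2) (P ⊗ₘ μ) :=
    Integrable.of_bound hm.aestronglyMeasurable C (Eventually.of_forall fun q => hb q.1 q.2)
  refine ⟨h1, Integrable.of_bound (C := C) ?_ (Eventually.of_forall fun ω => ?_), Measure.integral_compProd h1⟩
  · exact (StronglyMeasurable.integral_kernel_prod_right (κ := μ) (f := ψ)
      hm.stronglyMeasurable).aestronglyMeasurable
  · have := norm_integral_le_of_norm_le_const (μ := μ ω) (f := ψ ω) (C := C)
      (Eventually.of_forall fun x => hb ω x)
    simpa using this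

lemma dual_value_eq (P : Measure Ω) [IsProbabilityMeasure P]
    (μ : Kernel Ω X) [IsMarkovKernel μ] (ν : Kernel Ω Y) [IsMarkovKernel ν]
    {ψ : Ω → X → ℝ} {ψc : Ω → Y → ℝ} (h : IsDual c K C ψ ψc) :
    ∫ ω, ((∫ y, ψc ω y ∂(ν ω)) - (∫ x, ψ ω x ∂(μ ω))) ∂P
      = ∫ q, ψc q.1 q.2 ∂(P ⊗ₘ ν) - ∫ q, ψ q.1 q.2 ∂(P ⊗ₘ μ) := by
  obtain ⟨_, h1, h2⟩ := integral_bdd_compProd P μ h.m1 h.b1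
  obtain ⟨_, h3, h4⟩ := integral_bdd_compProd P ν h.m2 h.b2
  rw [h2, h4, integral_sub h3 h1]

lemma dual_attained (P : Measure Ω) [IsProbabilityMeasure P]
    (μ : Kernel Ω X) [IsMarkovKernel μ] (ν : Kernel Ω Y) [IsMarkovKernel ν]
    (hC : 0 ≤ C) (hne : ∃ ψ ψc, IsDual c K C ψ ψc) :
    ∃ ψ ψc, IsDual c K C ψ ψc ∧ ∀ φ φc, IsDual c K C φ φc →
      ∫ ω, ((∫ y, φc ω y ∂(ν ω)) - (∫ x, φ ω x ∂(μ ω))) ∂P ≤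
      ∫ ω, ((∫ y, ψc ω y ∂(ν ω)) - (∫ x, ψ ω x ∂(μ ω))) ∂P := by
  let H := WithLp 2 (Lp ℝ 2 (P ⊗ₘ μ) × Lp ℝ 2 (P ⊗ₘ ν))
  let S : Set H := {z | ∃ ψ ψc, IsDual c K C ψ ψc ∧
    (z.fst : Ω × X → ℝ) =ᵐ[P ⊗ₘ μ] (fun q => ψ q.1 q.2) ∧
    (z.snd : Ω × Y → ℝ) =ᵐ[P ⊗ₘ ν] (fun q => ψc q.1 q.2)}
  have hmem : ∀ φ φc, IsDual c K C φ φc → ∃ z : H, z ∈ S ∧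
      (z.fst : Ω × X → ℝ) =ᵐ[P ⊗ₘ μ] (fun q => φ q.1 q.2) ∧
      (z.snd : Ω × Y → ℝ) =ᵐ[P ⊗ₘ ν] (fun q => φc q.1 q.2) := by
    intro φ φc h
    have h1 : MemLp (fun q : Ω × X => φ q.1 q.2) 2 (P ⊗ₘ μ) :=
      MemLp.of_bound h.m1.aestronglyMeasurable C (Eventually.of_forall fun q => h.b1 q.1 q.2)
    have h2 : MemLp (fun q : Ω × Y => φc q.1 q.2) 2 (P ⊗ₘ ν) :=
      MemLp.of_bound h.m2.aestronglyMeasurable C (Eventually.of_forall fun q => h.b2 q.1 q.2)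
    refine ⟨WithLp.toLp 2 (h1.toLp, h2.toLp), ⟨φ, φc, h, ?_, ?_⟩, ?_, ?_⟩
    exacts [h1.coeFn_toLp, h2.coeFn_toLp, h1.coeFn_toLp, h2.coeFn_toLp]
  have hSconv : Convex ℝ S := by
    rintro x ⟨ψ, ψc, h, e1, e2⟩ y ⟨φ, φc, h', e1', e2'⟩ a b ha hb hab
    refine ⟨_, _, h.convex h' ha hb hab, ?_, ?_⟩
    · change ((a • x.fst + b • y.fst : Lp ℝ 2 (P ⊗ₘ μ)) : _ → ℝ) =ᵐ[_] _
      filter_upwards [e1, e1', Lp.coeFn_add (a • x.fst) (b • y.fst), Lp.coeFn_smul a x.fst,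
        Lp.coeFn_smul b y.fst] with q h1 h2 h3 h4 h5
      rw [h3, Pi.add_apply, h4, h5, Pi.smul_apply, Pi.smul_apply, h1, h2]; rfl
    · change ((a • x.snd + b • y.snd : Lp ℝ 2 (P ⊗ₘ ν)) : _ → ℝ) =ᵐ[_] _
      filter_upwards [e2, e2', Lp.coeFn_add (a • x.snd) (b • y.snd), Lp.coeFn_smul a x.snd,
        Lp.coeFn_smul b y.snd] with q h1 h2 h3 h4 h5
      rw [h3, Pi.add_apply, h4, h5, Pi.smul_apply, Pi.smul_apply, h1, h2]; rfl
  have hSne : S.Nonempty := by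
    obtain ⟨ψ, ψc, h⟩ := hne
    obtain ⟨z, hz, _⟩ := hmem _ _ h
    exact ⟨z, hz⟩
  have hSb : ∀ z ∈ S, ‖z‖ ≤ C + C := by
    rintro z ⟨ψ, ψc, h, e1, e2⟩
    have h1 : ‖z.fst‖ ≤ C := by
      have := Lp.norm_le_of_ae_bound (f := z.fst) hC (by
        filter_upwards [e1] with q hq; rw [hq]; exact h.b1 q.1 q.2)
      simpa [measureUnivNNReal] using this
    have h2 : ‖z.snd‖ ≤ C := by
      have := Lp.norm_le_of_ae_bound (f := z.snd) hC (by
        filter_upwards [e2] with q hq; rw [hq]; exact h.b2 q.1 q.2)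
      simpa [measureUnivNNReal] using this
    have h3 := WithLp.prod_norm_sq_eq_of_L2 z
    have h4 := norm_nonneg z.fst
    have h5 := norm_nonneg z.snd
    refine abs_le_of_sq_le_sq' ?_ (by linarith) |>.2
    nlinarith
  have o1 : MemLp (fun _ : Ω × X => (1 : ℝ)) 2 (P ⊗ₘ μ) := memLp_const 1
  have o2 : MemLp (fun _ : Ω × Y => (1 : ℝ)) 2 (P ⊗ₘ ν) := memLp_const 1
  let w : H := WithLp.toLp 2 (-o1.toLp, o2.toLp)
  have hval : ∀ (z : H) φ φc, IsDual c K C φ φc →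
      (z.fst : Ω × X → ℝ) =ᵐ[P ⊗ₘ μ] (fun q => φ q.1 q.2) →
      (z.snd : Ω × Y → ℝ) =ᵐ[P ⊗ₘ ν] (fun q => φc q.1 q.2) →
      innerSL ℝ w z = ∫ ω, ((∫ y, φc ω y ∂(ν ω)) - (∫ x, φ ω x ∂(μ ω))) ∂P := by
    intro z φ φc h e1 e2
    rw [dual_value_eq P μ ν h, innerSL_apply_apply, WithLp.prod_inner_apply]
    simp only [w]
    change inner ℝ (-o1.toLp) z.fst + inner ℝ o2.toLp z.snd = _
    rw [inner_neg_left, L2.inner_def, L2.inner_def]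
    have i1 : ∫ q, inner ℝ ((o1.toLp : Lp ℝ 2 (P ⊗ₘ μ)) q) (z.fst q) ∂(P ⊗ₘ μ) = ∫ q, φ q.1 q.2 ∂(P ⊗ₘ μ) := by
      refine integral_congr_ae ?_
      filter_upwards [e1, o1.coeFn_toLp] with q h1 h2
      rw [h1, h2]; simp
    have i2 : ∫ q, inner ℝ ((o2.toLp : Lp ℝ 2 (P ⊗ₘ ν)) q) (z.snd q) ∂(P ⊗ₘ ν) = ∫ q, φc q.1 q.2 ∂(P ⊗ₘ ν) := by
      refine integral_congr_ae ?_
      filter_upwards [e2, o2.coeFn_toLp] with q h1 h2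
      rw [h1, h2]; simp
    rw [i1, i2]; ring
  obtain ⟨z, z0, hzS, hz, hmax⟩ := exists_seq_max S hSconv hSne _ hSb (innerSL ℝ w)
  choose ψ ψc hd e1 e2 using hzS
  have t1 : Tendsto (fun n => (z n).fst) atTop (nhds z0.fst) :=
    ((WithLp.prod_continuous_ofLp 2 _ _).fst.tendsto z0).comp hz
  have t2 : Tendsto (fun n => (z n).snd) atTop (nhds z0.snd) :=
    ((WithLp.prod_continuous_ofLp 2 _ _).snd.tendsto z0).comp hz
  obtain ⟨n1, hn1, a1⟩ := (tendstoInMeasure_of_tendsto_Lp t1).exists_seq_tendsto_ae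
  obtain ⟨n2, hn2, a2⟩ := (tendstoInMeasure_of_tendsto_Lp
    (t2.comp hn1.tendsto_atTop)).exists_seq_tendsto_ae
  have hd' := IsDual.limsup (fun k => hd (n1 (n2 k)))
  refine ⟨_, _, hd', fun φ φc h => ?_⟩
  obtain ⟨y, hyS, y1, y2⟩ := hmem φ φc h
  rw [← hval y φ φc h y1 y2]
  refine (hmax y hyS).trans (le_of_eq (hval z0 _ _ hd' ?_ ?_))
  · filter_upwards [a1, ae_all_iff.2 e1] with q h1 h2
    have h3 := (h1.comp hn2.tendsto_atTop).limsup_eq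
    rw [← h3]
    congr 1
    ext k
    simp [h2]
  · filter_upwards [a2, ae_all_iff.2 e2] with q h1 h2
    have h3 := h1.limsup_eq
    rw [← h3]
    congr 1
    ext k
    simp [h2]
end
end Attain


section Primal

lemma lintegral_ofReal_compProd {Ω Z : Type*} [MeasurableSpace Ω] [MeasurableSpace Z]
    (P : Measure Ω) [IsProbabilityMeasure P] (μ : Kernel Ω Z) [IsMarkovKernel μ] {e : Ω → Z → ℝ}
    {C : ℝ} (hm : Measurable (fun q : Ω × Z => e q.1 q.2)) (h0 : ∀ ω x, 0 ≤ e ω x)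
    (hb : ∀ ω x, e ω x ≤ C) :
    ∫⁻ ω, ∫⁻ x, ENNReal.ofReal (e ω x) ∂(μ ω) ∂P = ENNReal.ofReal (∫ q, e q.1 q.2 ∂(P ⊗ₘ μ)) := by
  have h1 : Integrable (fun q : Ω × Z => e q.1 q.2) (P ⊗ₘ μ) :=
    Integrable.of_bound hm.aestronglyMeasurable C (Eventually.of_forall fun q => by
      rw [Real.norm_of_nonneg (h0 _ _)]; exact hb q.1 q.2)
  rw [ofReal_integral_eq_lintegral_ofReal h1 (Eventually.of_forall fun q => h0 q.1 q.2),
    Measure.lintegral_compProd hm.ennreal_ofReal]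

lemma sum_preimage_one {Z I : Type*} [MeasurableSpace Z] (μ : Measure Z) [IsProbabilityMeasure μ]
    [Fintype I] [MeasurableSpace I] [MeasurableSingletonClass I] {s : Z → I} (hs : Measurable s) :
    ∑ i, μ (s ⁻¹' {i}) = 1 := by
  rw [sum_measure_preimage_singleton Finset.univ (fun i _ => hs (measurableSet_singleton i))]
  simp

lemma primal_bound {Ω X Y : Type*} [MeasurableSpace Ω] [MeasurableSpace X] [MeasurableSpace Y]
    (P : Measure Ω) [IsProbabilityMeasure P]
    (μ : Kernel Ω X) [IsMarkovKernel μ] (ν : Kernel Ω Y) [IsMarkovKernel ν]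
    {I J : Type*} [Fintype I] [Fintype J] [MeasurableSpace I] [MeasurableSpace J]
    [MeasurableSingletonClass I] [MeasurableSingletonClass J]
    (s : X → I) (t : Y → J) (hs : Measurable s) (ht : Measurable t) (ex : I → X) (ey : J → Y)
    (c : Ω → X → Y → ℝ) {B : ℝ} (hc0 : ∀ ω x y, 0 ≤ c ω x y)
    (e1 : Ω → X → ℝ) (e2 : Ω → Y → ℝ) 
    (he1m : Measurable (fun q : Ω × X => e1 q.1 q.2)) (he10 : ∀ ω x, 0 ≤ e1 ω x)
    (he1B : ∀ ω x, e1 ω x ≤ B)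
    (he2m : Measurable (fun q : Ω × Y => e2 q.1 q.2)) (he20 : ∀ ω x, 0 ≤ e2 ω x)
    (he2B : ∀ ω x, e2 ω x ≤ B)
    (hce : ∀ ω x y, c ω x y ≤ c ω (ex (s x)) (ey (t y)) + e1 ω x + e2 ω y)
    (m : I → J → Ω → ℝ) (hm : ∀ i j, Measurable (m i j)) (hm0 : ∀ i j, 0 ≤ᵐ[P] m i j)
    (hmc : ∀ i j, Integrable (fun ω => m i j ω * c ω (ex i) (ey j)) P)
    (hrow : ∀ i, ∀ᵐ ω ∂P, ∑ j, m i j ω = (μ ω).real (s ⁻¹' {i}))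
    (hcol : ∀ j, ∀ᵐ ω ∂P, ∑ i, m i j ω = (ν ω).real (t ⁻¹' {j})) :
    ∃ π : Kernel Ω (X × Y), (IsMarkovKernel π ∧ π.fst = μ ∧ π.snd = ν) ∧
      ∫⁻ ω, ∫⁻ q, ENNReal.ofReal (c ω q.1 q.2) ∂(π ω) ∂P ≤ ENNReal.ofReal
        ((∑ i, ∑ j, ∫ ω, m i j ω * c ω (ex i) (ey j) ∂P)
          + ∫ q, e1 q.1 q.2 ∂(P ⊗ₘ μ) + ∫ q, e2 q.1 q.2 ∂(P ⊗ₘ ν)) := by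
  classical
  have hsi : ∀ i, MeasurableSet (s ⁻¹' {i}) := fun i => hs (measurableSet_singleton i)
  have htj : ∀ j, MeasurableSet (t ⁻¹' {j}) := fun j => ht (measurableSet_singleton j)
  have hu : ∀ i, Measurable (fun ω => μ ω (s ⁻¹' {i})) := fun i => μ.measurable_coe (hsi i)
  have hv : ∀ j, Measurable (fun ω => ν ω (t ⁻¹' {j})) := fun j => ν.measurable_coe (htj j)
  let G : Set Ω := (⋂ i, ⋂ j, {ω | 0 ≤ m i j ω}) ∩ (⋂ i, {ω | ∑ j, m i j ω = (μ ω).real (s ⁻¹' {i})})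
    ∩ (⋂ j, {ω | ∑ i, m i j ω = (ν ω).real (t ⁻¹' {j})})
  have hG : MeasurableSet G := by
    refine MeasurableSet.inter (MeasurableSet.inter ?_ ?_) ?_
    · exact MeasurableSet.iInter fun i => MeasurableSet.iInter fun j =>
        measurableSet_le measurable_const (hm i j)
    · exact MeasurableSet.iInter fun i => measurableSet_eq_fun
        (Finset.measurable_sum _ fun j _ => hm i j) (hu i).ennreal_toReal
    · exact MeasurableSet.iInter fun j => measurableSet_eq_fun
        (Finset.measurable_sum _ fun i _ => hm i j) (hv j).ennreal_toReal
  have hG' : ∀ᵐ ω ∂P, ω ∈ G := by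
    filter_upwards [ae_all_iff.2 fun i => ae_all_iff.2 fun j => hm0 i j, ae_all_iff.2 hrow,
      ae_all_iff.2 hcol] with ω h1 h2 h3
    refine ⟨⟨?_, ?_⟩, ?_⟩
    · exact Set.mem_iInter.2 fun i => Set.mem_iInter.2 fun j => h1 i j
    · exact Set.mem_iInter.2 fun i => h2 i
    · exact Set.mem_iInter.2 fun i => h3 i
  have g1 : ∀ ω ∈ G, ∀ i j, 0 ≤ m i j ω := fun ω h i j =>
    Set.mem_iInter.1 (Set.mem_iInter.1 h.1.1 i) j
  have g2 : ∀ ω ∈ G, ∀ i, ∑ j, m i j ω = (μ ω).real (s ⁻¹' {i}) := fun ω h i =>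
    Set.mem_iInter.1 h.1.2 i
  have g3 : ∀ ω ∈ G, ∀ j, ∑ i, m i j ω = (ν ω).real (t ⁻¹' {j}) := fun ω h i =>
    Set.mem_iInter.1 h.2 i
  let m' : Ω → I → J → ℝ≥0∞ := fun ω i j =>
    if ω ∈ G then ENNReal.ofReal (m i j ω) else μ ω (s ⁻¹' {i}) * ν ω (t ⁻¹' {j})
  obtain ⟨π, hπM, hπ1, hπ2, hπ⟩ := exists_coupling μ ν s t hs ht m'
    (fun i j => Measurable.ite hG (ENNReal.measurable_ofReal.comp (hm i j)) ((hu i).mul (hv j)))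
    (by
      intro ω i
      simp only [m']
      split_ifs with h
      · rw [← ENNReal.ofReal_sum_of_nonneg fun j _ => g1 ω h i j, g2 ω h i, ofReal_measureReal]
      · rw [← Finset.mul_sum, sum_preimage_one _ ht, mul_one])
    (by
      intro ω j
      simp only [m']
      split_ifs with h
      · rw [← ENNReal.ofReal_sum_of_nonneg fun i _ => g1 ω h i j, g3 ω h j, ofReal_measureReal]
      · rw [← Finset.sum_mul, sum_preimage_one _ hs, one_mul])
  refine ⟨π, ⟨hπM, hπ1, hπ2⟩, ?_⟩
  have me1 : ∀ ω, Measurable (e1 ω) := fun ω => he1m.comp measurable_prodMk_left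
  have me2 : ∀ ω, Measurable (e2 ω) := fun ω => he2m.comp measurable_prodMk_left
  have hω : ∀ ω, ∫⁻ q, ENNReal.ofReal (c ω q.1 q.2) ∂(π ω) ≤
      (∑ i, ∑ j, m' ω i j * ENNReal.ofReal (c ω (ex i) (ey j)))
        + ∫⁻ x, ENNReal.ofReal (e1 ω x) ∂(μ ω) + ∫⁻ y, ENNReal.ofReal (e2 ω y) ∂(ν ω) := by
    intro ω
    have i1 : ∫⁻ q, ENNReal.ofReal (e1 ω q.1) ∂(π ω) = ∫⁻ x, ENNReal.ofReal (e1 ω x) ∂(μ ω) := by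
      conv_rhs => rw [← hπ1]
      rw [Kernel.fst_apply, lintegral_map (me1 ω).ennreal_ofReal measurable_fst]
    have i2 : ∫⁻ q, ENNReal.ofReal (e2 ω q.2) ∂(π ω) = ∫⁻ x, ENNReal.ofReal (e2 ω x) ∂(ν ω) := by
      conv_rhs => rw [← hπ2]
      rw [Kernel.snd_apply, lintegral_map (me2 ω).ennreal_ofReal measurable_snd]
    rw [← hπ ω (fun i j => ENNReal.ofReal (c ω (ex i) (ey j))), ← i1, ← i2,
      ← lintegral_add_right _ (g := fun q : X × Y => ENNReal.ofReal (e1 ω q.1))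
        ((me1 ω).comp measurable_fst).ennreal_ofReal,
      ← lintegral_add_right _ (g := fun q : X × Y => ENNReal.ofReal (e2 ω q.2))
        ((me2 ω).comp measurable_snd).ennreal_ofReal]
    refine lintegral_mono fun q => ?_
    rw [← ENNReal.ofReal_add (hc0 _ _ _) (he10 _ _),
      ← ENNReal.ofReal_add (add_nonneg (hc0 _ _ _) (he10 _ _)) (he20 _ _)]
    exact ENNReal.ofReal_le_ofReal (hce ω q.1 q.2)
  have E1 := lintegral_ofReal_compProd P μ he1m he10 he1B
  have E2 := lintegral_ofReal_compProd P ν he2m he20 he2B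
  have meas1 : Measurable fun ω => ∫⁻ x, ENNReal.ofReal (e1 ω x) ∂(μ ω) :=
    Measurable.lintegral_kernel_prod_right' (κ := μ) (f := fun q : Ω × X => ENNReal.ofReal (e1 q.1 q.2))
      (ENNReal.measurable_ofReal.comp he1m)
  have meas2 : Measurable fun ω => ∫⁻ x, ENNReal.ofReal (e2 ω x) ∂(ν ω) :=
    Measurable.lintegral_kernel_prod_right' (κ := ν) (f := fun q : Ω × Y => ENNReal.ofReal (e2 q.1 q.2))
      (ENNReal.measurable_ofReal.comp he2m)
  have E0 : ∫⁻ ω, (∑ i, ∑ j, m' ω i j * ENNReal.ofReal (c ω (ex i) (ey j))) ∂P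
      = ENNReal.ofReal (∑ i, ∑ j, ∫ ω, m i j ω * c ω (ex i) (ey j) ∂P) := by
    have hS : ∑ i, ∑ j, ∫ ω, m i j ω * c ω (ex i) (ey j) ∂P
        = ∫ ω, ∑ i, ∑ j, m i j ω * c ω (ex i) (ey j) ∂P := by
      rw [integral_finsetSum _ fun i _ => integrable_finsetSum _ fun j _ => hmc i j]
      refine Finset.sum_congr rfl fun i _ => ?_
      rw [integral_finsetSum _ fun j _ => hmc i j]
    rw [hS, ofReal_integral_eq_lintegral_ofReal
      (integrable_finsetSum _ fun i _ => integrable_finsetSum _ fun j _ => hmc i j)]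
    · refine lintegral_congr_ae ?_
      filter_upwards [hG'] with ω h
      rw [ENNReal.ofReal_sum_of_nonneg fun i _ => Finset.sum_nonneg fun j _ =>
        mul_nonneg (g1 ω h i j) (hc0 _ _ _)]
      refine Finset.sum_congr rfl fun i _ => ?_
      rw [ENNReal.ofReal_sum_of_nonneg fun j _ => mul_nonneg (g1 ω h i j) (hc0 _ _ _)]
      refine Finset.sum_congr rfl fun j _ => ?_
      simp only [m', if_pos h]
      rw [ENNReal.ofReal_mul (g1 ω h i j)]
    · filter_upwards [hG'] with ω h
      exact Finset.sum_nonneg fun i _ => Finset.sum_nonneg fun j _ =>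
        mul_nonneg (g1 ω h i j) (hc0 _ _ _)
  have N0 : 0 ≤ ∑ i, ∑ j, ∫ ω, m i j ω * c ω (ex i) (ey j) ∂P :=
    Finset.sum_nonneg fun i _ => Finset.sum_nonneg fun j _ => integral_nonneg_of_ae (by
      filter_upwards [hG'] with ω h
      exact mul_nonneg (g1 ω h i j) (hc0 _ _ _))
  have N1 : 0 ≤ ∫ q, e1 q.1 q.2 ∂(P ⊗ₘ μ) := integral_nonneg fun q => he10 _ _
  have N2 : 0 ≤ ∫ q, e2 q.1 q.2 ∂(P ⊗ₘ ν) := integral_nonneg fun q => he20 _ _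
  rw [ENNReal.ofReal_add (add_nonneg N0 N1) N2, ENNReal.ofReal_add N0 N1, ← E0, ← E1, ← E2,
    ← lintegral_add_right _ meas1, ← lintegral_add_right _ meas2]
  exact lintegral_mono hω

end Primal


section DualBound

lemma integral_fibre {Z I : Type*} [MeasurableSpace Z] (μ : Measure Z) [IsProbabilityMeasure μ]
    [Fintype I] [MeasurableSpace I] [MeasurableSingletonClass I] {s : Z → I} (hs : Measurable s)
    (a : I → ℝ) : Integrable (fun x => a (s x)) μ ∧
      ∫ x, a (s x) ∂μ = ∑ i, μ.real (s ⁻¹' {i}) * a i := by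
  have hp : IsProbabilityMeasure (μ.map s) := Measure.isProbabilityMeasure_map hs.aemeasurable
  have h1 : Integrable a (μ.map s) := Integrable.of_finite
  refine ⟨h1.comp_measurable hs, ?_⟩
  rw [← integral_map (f := a) hs.aemeasurable h1.aestronglyMeasurable, integral_fintype h1]
  refine Finset.sum_congr rfl fun i _ => ?_
  rw [map_measureReal_apply hs (measurableSet_singleton i), smul_eq_mul]

lemma lip_fst {X Y : Type*} [PseudoMetricSpace X] [PseudoMetricSpace Y] {f : X → Y → ℝ} {K : ℝ≥0}
    (h : LipschitzWith K (fun q : X × Y => f q.1 q.2)) (x x' : X) (y : Y) :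
    |f x y - f x' y| ≤ K * dist x x' := by
  have := h.dist_le_mul (x, y) (x', y)
  simpa [Real.dist_eq, Prod.dist_eq] using this

lemma lip_snd {X Y : Type*} [PseudoMetricSpace X] [PseudoMetricSpace Y] {f : X → Y → ℝ} {K : ℝ≥0}
    (h : LipschitzWith K (fun q : X × Y => f q.1 q.2)) (x : X) (y y' : Y) :
    |f x y - f x y'| ≤ K * dist y y' := by
  have := h.dist_le_mul (x, y) (x, y')
  simpa [Real.dist_eq, Prod.dist_eq] using this

lemma dual_construct {Ω X Y : Type*} [MeasurableSpace Ω]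
    [PseudoMetricSpace X] [MeasurableSpace X]
    [PseudoMetricSpace Y] [SecondCountableTopology Y] [MeasurableSpace Y] [Nonempty Y]
    {I J : Type*} [Fintype I] [Nonempty I]
    (s : X → I) (t : Y → J) (ex : I → X) (ey : J → Y)
    (c : Ω → X → Y → ℝ) {B : ℝ} (hc0 : ∀ ω x y, 0 ≤ c ω x y) (hcB : ∀ ω x y, c ω x y ≤ B)
    (hcm : Measurable (fun q : Ω × X × Y => c q.1 q.2.1 q.2.2))
    (K : Ω → ℝ≥0) (hK : ∀ ω, LipschitzWith (K ω) (fun q : X × Y => c ω q.1 q.2))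
    (e1 : Ω → X → ℝ) (e2 : Ω → Y → ℝ)
    (he1 : ∀ ω x y, |c ω x y - c ω (ex (s x)) y| ≤ e1 ω x)
    (he2 : ∀ ω x y, |c ω x y - c ω x (ey (t y))| ≤ e2 ω y)
    (a : I → Ω → ℝ) (ha : ∀ i, Measurable (a i)) (b : J → Ω → ℝ) :
    ∃ (ψ : Ω → X → ℝ) (ψc : Ω → Y → ℝ) (r : Ω → ℝ), IsDual c K B ψ ψc ∧
      (∀ ω x, ψ ω x ≤ a (s x) ω - r ω + e1 ω x) ∧
      (∀ ω, (∀ i j, - c ω (ex i) (ey j) ≤ a i ω + b j ω) → ∀ y,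
        - b (t y) ω - r ω - e2 ω y ≤ ψc ω y) := by
  have hun : (Finset.univ : Finset I).Nonempty := Finset.univ_nonempty
  let r : Ω → ℝ := fun ω => Finset.univ.inf' hun fun i => a i ω
  let yd := TopologicalSpace.denseSeq Y
  let ψc : Ω → Y → ℝ := fun ω y => (Finset.univ.inf' hun fun i => c ω (ex i) y + a i ω) - r ω
  let ψ : Ω → X → ℝ := fun ω x => ⨆ k, (ψc ω (yd k) - c ω x (yd k))
  have hr : ∀ ω i, r ω ≤ a i ω := fun ω i => Finset.inf'_le _ (Finset.mem_univ i)
  have rm : Measurable r := by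
    simp only [r, Finset.inf'_univ_eq_ciInf]
    exact Measurable.iInf ha
  have hψc_le : ∀ ω y i, ψc ω y ≤ c ω (ex i) y + a i ω - r ω := fun ω y i =>
    sub_le_sub_right (Finset.inf'_le _ (Finset.mem_univ i)) _
  have hle_ψc : ∀ ω y z, (∀ i, z ≤ c ω (ex i) y + a i ω - r ω) → z ≤ ψc ω y := by
    intro ω y z h
    rw [le_sub_iff_add_le]
    exact Finset.le_inf' _ _ fun i _ => by linarith [h i]
  have h0 : ∀ ω y, 0 ≤ ψc ω y := fun ω y => hle_ψc ω y 0 fun i => by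
    linarith [hc0 ω (ex i) y, hr ω i]
  have hB : ∀ ω y, ψc ω y ≤ B := by
    intro ω y
    obtain ⟨i, _, hi⟩ := Finset.exists_mem_eq_inf' hun fun i => a i ω
    have := hψc_le ω y i
    have h2 : r ω = a i ω := hi
    linarith [hcB ω (ex i) y]
  have hBdd : ∀ ω x, BddAbove (Set.range fun k => ψc ω (yd k) - c ω x (yd k)) := by
    intro ω x
    refine ⟨B, ?_⟩
    rintro _ ⟨k, rfl⟩
    have := hB ω (yd k)
    have := hc0 ω x (yd k)
    simp only; linarith
  have hψge : ∀ ω x k, ψc ω (yd k) - c ω x (yd k) ≤ ψ ω x := fun ω x k => le_ciSup (hBdd ω x) k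
  have hl2 : ∀ ω y y', ψc ω y ≤ ψc ω y' + K ω * dist y y' := by
    intro ω y y'
    rw [← sub_le_iff_le_add]
    refine hle_ψc ω y' _ fun i => ?_
    have h1 := hψc_le ω y i
    have h2 := (abs_le.1 (lip_snd (hK ω) (ex i) y y')).2
    linarith
  have m2 : Measurable (fun q : Ω × Y => ψc q.1 q.2) := by
    refine Measurable.sub ?_ (rm.comp measurable_fst)
    simp only [Finset.inf'_univ_eq_ciInf]
    exact Measurable.iInf fun i =>
      Measurable.add (hcm.comp (measurable_fst.prodMk (measurable_const.prodMk measurable_snd)))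
        ((ha i).comp measurable_fst)
  refine ⟨ψ, ψc, r, ⟨?_, m2, ?_, ?_, ?_, hl2, ?_⟩, ?_, ?_⟩
  · refine Measurable.iSup fun k => Measurable.sub ?_ ?_
    · exact m2.comp (measurable_fst.prodMk measurable_const)
    · exact hcm.comp (measurable_fst.prodMk (measurable_snd.prodMk measurable_const))
  · intro ω x
    rw [abs_le]
    constructor
    · have := hψge ω x 0
      linarith [h0 ω (yd 0), hcB ω x (yd 0)]
    · exact ciSup_le fun k => by linarith [hB ω (yd k), hc0 ω x (yd k)]
  · intro ω y
    rw [abs_of_nonneg (h0 ω y)]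
    exact hB ω y
  · intro ω x x'
    refine ciSup_le fun k => ?_
    have h1 := hψge ω x' k
    have h2 := (abs_le.1 (lip_fst (hK ω) x x' (yd k))).1
    linarith
  · intro ω x
    have cψc : Continuous (ψc ω) := (LipschitzWith.of_le_add_mul (K ω) (hl2 ω)).continuous
    have cc : Continuous (fun y => c ω x y) :=
      (hK ω).continuous.comp (Continuous.prodMk_right x)
    intro y
    have : ψc ω y - c ω x y ≤ ψ ω x := by
      refine (TopologicalSpace.denseRange_denseSeq Y).induction_on
        (p := fun y => ψc ω y - c ω x y ≤ ψ ω x) y ?_ (fun k => hψge ω x k)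
      exact isClosed_le (cψc.sub cc) continuous_const
    linarith
  · intro ω x
    refine ciSup_le fun k => ?_
    have h1 := hψc_le ω (yd k) (s x)
    have h2 := (abs_le.1 (he1 ω x (yd k))).1
    linarith
  · intro ω h y
    refine hle_ψc ω y _ fun i => ?_
    have h1 := h i (t y)
    have h2 := (abs_le.1 (he2 ω (ex i) y)).1
    linarith

lemma dual_bound {Ω X Y : Type*} [MeasurableSpace Ω]
    [PseudoMetricSpace X] [MeasurableSpace X]
    [PseudoMetricSpace Y] [SecondCountableTopology Y] [MeasurableSpace Y] [Nonempty Y]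
    (P : Measure Ω) [IsProbabilityMeasure P]
    (μ : Kernel Ω X) [IsMarkovKernel μ] (ν : Kernel Ω Y) [IsMarkovKernel ν]
    {I J : Type*} [Fintype I] [Fintype J] [MeasurableSpace I] [MeasurableSpace J]
    [MeasurableSingletonClass I] [MeasurableSingletonClass J] [Nonempty I]
    (s : X → I) (t : Y → J) (hs : Measurable s) (ht : Measurable t) (ex : I → X) (ey : J → Y)
    (c : Ω → X → Y → ℝ) {B : ℝ} (hc0 : ∀ ω x y, 0 ≤ c ω x y) (hcB : ∀ ω x y, c ω x y ≤ B)
    (hcm : Measurable (fun q : Ω × X × Y => c q.1 q.2.1 q.2.2))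
    (K : Ω → ℝ≥0) (hK : ∀ ω, LipschitzWith (K ω) (fun q : X × Y => c ω q.1 q.2))
    (e1 : Ω → X → ℝ) (e2 : Ω → Y → ℝ)
    (he1m : Measurable (fun q : Ω × X => e1 q.1 q.2)) (he10 : ∀ ω x, 0 ≤ e1 ω x)
    (he1B : ∀ ω x, e1 ω x ≤ B)
    (he2m : Measurable (fun q : Ω × Y => e2 q.1 q.2)) (he20 : ∀ ω x, 0 ≤ e2 ω x)
    (he2B : ∀ ω x, e2 ω x ≤ B)
    (he1 : ∀ ω x y, |c ω x y - c ω (ex (s x)) y| ≤ e1 ω x)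
    (he2 : ∀ ω x y, |c ω x y - c ω x (ey (t y))| ≤ e2 ω y)
    (a : I → Ω → ℝ) (ha : ∀ i, Measurable (a i)) (b : J → Ω → ℝ)
    (hab : ∀ i j, ∀ᵐ ω ∂P, - c ω (ex i) (ey j) ≤ a i ω + b j ω)
    (hia : ∀ i, Integrable (fun ω => (μ ω).real (s ⁻¹' {i}) * a i ω) P)
    (hib : ∀ j, Integrable (fun ω => (ν ω).real (t ⁻¹' {j}) * b j ω) P) :
    ∃ (ψ : Ω → X → ℝ) (ψc : Ω → Y → ℝ), IsDual c K B ψ ψc ∧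
      -((∑ i, ∫ ω, (μ ω).real (s ⁻¹' {i}) * a i ω ∂P) +
        ∑ j, ∫ ω, (ν ω).real (t ⁻¹' {j}) * b j ω ∂P)
        - ∫ q, e1 q.1 q.2 ∂(P ⊗ₘ μ) - ∫ q, e2 q.1 q.2 ∂(P ⊗ₘ ν) ≤
      ∫ ω, ((∫ y, ψc ω y ∂(ν ω)) - (∫ x, ψ ω x ∂(μ ω))) ∂P := by
  obtain ⟨ψ, ψc, r, hd, h1, h2⟩ :=
    dual_construct s t ex ey c hc0 hcB hcm K hK e1 e2 he1 he2 a ha b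
  refine ⟨ψ, ψc, hd, ?_⟩
  obtain ⟨_, i1, -⟩ := integral_bdd_compProd P μ hd.m1 hd.b1
  obtain ⟨_, i2, -⟩ := integral_bdd_compProd P ν hd.m2 hd.b2
  obtain ⟨_, j1, k1⟩ := integral_bdd_compProd P μ (C := B) he1m fun ω x => by
    rw [abs_of_nonneg (he10 _ _)]; exact he1B ω x
  obtain ⟨_, j2, k2⟩ := integral_bdd_compProd P ν (C := B) he2m fun ω x => by
    rw [abs_of_nonneg (he20 _ _)]; exact he2B ω x
  have ia : Integrable (fun ω => ∑ i, (μ ω).real (s ⁻¹' {i}) * a i ω) P :=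
    integrable_finsetSum _ fun i _ => hia i
  have ib : Integrable (fun ω => ∑ j, (ν ω).real (t ⁻¹' {j}) * b j ω) P :=
    integrable_finsetSum _ fun i _ => hib i
  have iab : Integrable (fun ω => -((∑ i, (μ ω).real (s ⁻¹' {i}) * a i ω) +
      ∑ j, (ν ω).real (t ⁻¹' {j}) * b j ω)) P := (ia.add ib).neg
  have iab1 : Integrable (fun ω => -((∑ i, (μ ω).real (s ⁻¹' {i}) * a i ω) +
      ∑ j, (ν ω).real (t ⁻¹' {j}) * b j ω) - ∫ x, e1 ω x ∂(μ ω)) P := iab.sub j1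
  rw [k1, k2, ← integral_finsetSum _ fun i _ => hia i, ← integral_finsetSum _ fun i _ => hib i,
    ← integral_add ia ib, ← integral_neg, ← integral_sub iab j1, ← integral_sub iab1 j2]
  refine integral_mono_ae (iab1.sub j2) (i2.sub i1) ?_
  filter_upwards [ae_all_iff.2 fun i => ae_all_iff.2 fun j => hab i j] with ω hω
  have be1 : Integrable (e1 ω) (μ ω) := Integrable.of_bound
    (he1m.comp measurable_prodMk_left).aestronglyMeasurable B (Eventually.of_forall fun x => by
      rw [Real.norm_of_nonneg (he10 _ _)]; exact he1B ω x)
  have be2 : Integrable (e2 ω) (ν ω) := Integrable.of_bound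
    (he2m.comp measurable_prodMk_left).aestronglyMeasurable B (Eventually.of_forall fun x => by
      rw [Real.norm_of_nonneg (he20 _ _)]; exact he2B ω x)
  have bp1 : Integrable (ψ ω) (μ ω) := Integrable.of_bound
    (hd.m1.comp measurable_prodMk_left).aestronglyMeasurable B (Eventually.of_forall fun x =>
      hd.b1 ω x)
  have bp2 : Integrable (ψc ω) (ν ω) := Integrable.of_bound
    (hd.m2.comp measurable_prodMk_left).aestronglyMeasurable B (Eventually.of_forall fun x =>
      hd.b2 ω x)
  obtain ⟨fa, fa'⟩ := integral_fibre (μ ω) hs fun i => a i ω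
  obtain ⟨fb, fb'⟩ := integral_fibre (ν ω) ht fun j => b j ω
  have A1 : ∫ x, ψ ω x ∂(μ ω) ≤
      (∑ i, (μ ω).real (s ⁻¹' {i}) * a i ω) - r ω + ∫ x, e1 ω x ∂(μ ω) := by
    have := integral_mono bp1 ((fa.sub (integrable_const (r ω))).add be1) (h1 ω)
    refine this.trans_eq ?_
    simp only [Pi.add_apply, Pi.sub_apply]
    have q1 : Integrable (fun x => a (s x) ω - r ω) (μ ω) := fa.sub (integrable_const (r ω))
    rw [integral_add q1 be1, integral_sub fa (integrable_const _),
      fa']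
    simp
  have A2 : -(∑ j, (ν ω).real (t ⁻¹' {j}) * b j ω) - r ω - ∫ x, e2 ω x ∂(ν ω) ≤
      ∫ y, ψc ω y ∂(ν ω) := by
    have := integral_mono ((fb.neg.sub (integrable_const (r ω))).sub be2) bp2 (h2 ω hω)
    refine this.trans_eq' ?_
    simp only [Pi.neg_apply, Pi.sub_apply]
    have q0 : Integrable (fun x => - b (t x) ω) (ν ω) := fb.neg
    have q1 : Integrable (fun x => - b (t x) ω - r ω) (ν ω) := q0.sub (integrable_const (r ω))
    rw [integral_sub q1 be2,
      integral_sub q0 (integrable_const _), integral_neg, fb']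
    simp
  linarith

end DualBound

section Approx

lemma quantize {Ω X Y : Type*} [MeasurableSpace Ω]
    [PseudoMetricSpace X] [SecondCountableTopology X] [MeasurableSpace X] [OpensMeasurableSpace X]
    [Nonempty X] [PseudoMetricSpace Y] [SecondCountableTopology Y] [MeasurableSpace Y] [Nonempty Y]
    (P : Measure Ω) [IsProbabilityMeasure P] (μ : Kernel Ω X) [IsMarkovKernel μ]
    (c : Ω → X → Y → ℝ) {B : ℝ} (hc0 : ∀ ω x y, 0 ≤ c ω x y) (hcB : ∀ ω x y, c ω x y ≤ B)
    (hcm : Measurable (fun q : Ω × X × Y => c q.1 q.2.1 q.2.2))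
    (K : Ω → ℝ≥0) (hK : ∀ ω x x' y, |c ω x y - c ω x' y| ≤ K ω * dist x x')
    (hcont : ∀ ω x, Continuous (c ω x)) (ε : ℝ) (hε : 0 < ε) :
    ∃ (n : ℕ) (s : X → Fin (n + 1)) (ex : Fin (n + 1) → X) (e1 : Ω → X → ℝ),
      Measurable s ∧ Measurable (fun q : Ω × X => e1 q.1 q.2) ∧ (∀ ω x, 0 ≤ e1 ω x) ∧
      (∀ ω x, e1 ω x ≤ B) ∧ (∀ ω x y, |c ω x y - c ω (ex (s x)) y| ≤ e1 ω x) ∧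
      ∫ q, e1 q.1 q.2 ∂(P ⊗ₘ μ) ≤ ε := by
  let xd := TopologicalSpace.denseSeq X
  let yd := TopologicalSpace.denseSeq Y
  let p : ℕ → X → X := fun n x => SimpleFunc.nearestPt xd n x
  have hp : ∀ n, Measurable (p n) := fun n => (SimpleFunc.nearestPt xd n).measurable
  let e : ℕ → Ω → X → ℝ := fun n ω x => ⨆ k, |c ω x (yd k) - c ω (p n x) (yd k)|
  have hbd : ∀ ω x x' y, |c ω x y - c ω x' y| ≤ B := by
    intro ω x x' y
    rw [abs_le]
    constructor <;> linarith [hc0 ω x y, hc0 ω x' y, hcB ω x y, hcB ω x' y]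
  have hBdd : ∀ n ω x, BddAbove (Set.range fun k => |c ω x (yd k) - c ω (p n x) (yd k)|) := by
    intro n ω x
    refine ⟨B, ?_⟩
    rintro _ ⟨k, rfl⟩
    exact hbd _ _ _ _
  have em : ∀ n, Measurable (fun q : Ω × X => e n q.1 q.2) := by
    intro n
    refine Measurable.iSup fun k => ?_
    have h1 : Measurable (fun q : Ω × X => c q.1 q.2 (yd k)) :=
      hcm.comp (measurable_fst.prodMk (measurable_snd.prodMk measurable_const))
    have h2 : Measurable (fun q : Ω × X => c q.1 (p n q.2) (yd k)) :=
      hcm.comp (measurable_fst.prodMk (((hp n).comp measurable_snd).prodMk measurable_const))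
    exact (h1.sub h2).abs
  have e0 : ∀ n ω x, 0 ≤ e n ω x := fun n ω x => (abs_nonneg _).trans (le_ciSup (hBdd n ω x) 0)
  have eB : ∀ n ω x, e n ω x ≤ B := fun n ω x => ciSup_le fun k => hbd _ _ _ _
  have ele : ∀ n ω x y, |c ω x y - c ω (p n x) y| ≤ e n ω x := by
    intro n ω x y
    refine (TopologicalSpace.denseRange_denseSeq Y).induction_on
        (p := fun y => |c ω x y - c ω (p n x) y| ≤ e n ω x) y ?_
        (fun k => le_ciSup (hBdd n ω x) k)
    exact isClosed_le ((hcont ω x).sub (hcont ω _)).abs continuous_const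
  have elim : ∀ ω x, Tendsto (fun n => e n ω x) atTop (nhds 0) := by
    intro ω x
    have h1 : Tendsto (fun n => p n x) atTop (nhds x) :=
      SimpleFunc.tendsto_nearestPt (TopologicalSpace.denseRange_denseSeq X x)
    have h2 : Tendsto (fun n => (K ω : ℝ) * dist x (p n x)) atTop (nhds 0) := by
      have := (tendsto_const_nhds (x := x)).dist h1
      rw [dist_self] at this
      simpa using this.const_mul (K ω : ℝ)
    exact squeeze_zero (fun n => e0 n ω x) (fun n => ciSup_le fun k => hK ω _ _ _) h2
  have Elim : Tendsto (fun n => ∫ q, e n q.1 q.2 ∂(P ⊗ₘ μ)) atTop (nhds 0) := by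
    have := tendsto_integral_of_dominated_convergence (μ := P ⊗ₘ μ)
      (F := fun n (q : Ω × X) => e n q.1 q.2) (f := fun _ => (0 : ℝ)) (fun _ => B)
      (fun n => (em n).aestronglyMeasurable) (integrable_const _)
      (fun n => Eventually.of_forall fun q => by
        rw [Real.norm_of_nonneg (e0 _ _ _)]; exact eB _ _ _)
      (Eventually.of_forall fun q => elim q.1 q.2)
    simpa using this
  obtain ⟨n, hn⟩ := (Elim.eventually (gt_mem_nhds hε)).exists
  refine ⟨n, fun x => ⟨SimpleFunc.nearestPtInd xd n x,
    Nat.lt_succ_of_le (SimpleFunc.nearestPtInd_le xd n x)⟩, fun i => xd i, e n, ?_, em n, e0 n, eB n,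
    fun ω x y => ele n ω x y, hn.le⟩
  refine measurable_to_countable' fun i => ?_
  have : (fun x => (⟨SimpleFunc.nearestPtInd xd n x,
      Nat.lt_succ_of_le (SimpleFunc.nearestPtInd_le xd n x)⟩ : Fin (n + 1))) ⁻¹' {i}
      = SimpleFunc.nearestPtInd xd n ⁻¹' {(i : ℕ)} := by
    ext x
    simp [Fin.ext_iff]
  rw [this]
  exact (SimpleFunc.nearestPtInd xd n).measurableSet_preimage _

lemma approx_duality {Ω X Y : Type*} [MeasurableSpace Ω]
    [PseudoMetricSpace X] [SecondCountableTopology X] [MeasurableSpace X] [OpensMeasurableSpace X]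
    [Nonempty X] [PseudoMetricSpace Y] [SecondCountableTopology Y] [MeasurableSpace Y]
    [OpensMeasurableSpace Y] [Nonempty Y]
    (P : Measure Ω) [IsProbabilityMeasure P] (μ : Kernel Ω X) [IsMarkovKernel μ]
    (ν : Kernel Ω Y) [IsMarkovKernel ν]
    (c : Ω → X → Y → ℝ) {B : ℝ} (hc0 : ∀ ω x y, 0 ≤ c ω x y) (hcB : ∀ ω x y, c ω x y ≤ B)
    (hcm : Measurable (fun q : Ω × X × Y => c q.1 q.2.1 q.2.2))
    (K : Ω → ℝ≥0) (hK : ∀ ω, LipschitzWith (K ω) (fun q : X × Y => c ω q.1 q.2))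
    (ε : ℝ) (hε : 0 < ε) :
    ∃ (ψ : Ω → X → ℝ) (ψc : Ω → Y → ℝ) (π : Kernel Ω (X × Y)), IsDual c K B ψ ψc ∧
      (IsMarkovKernel π ∧ π.fst = μ ∧ π.snd = ν) ∧
      ∫⁻ ω, ∫⁻ q, ENNReal.ofReal (c ω q.1 q.2) ∂(π ω) ∂P ≤ ENNReal.ofReal
        ((∫ ω, ((∫ y, ψc ω y ∂(ν ω)) - (∫ x, ψ ω x ∂(μ ω))) ∂P) + 5 * ε) := by
  classical
  obtain ⟨n, s, ex, e1, hs, e1m, e10, e1B, e1le, E1⟩ := quantize P μ c hc0 hcB hcm K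
    (fun ω x x' y => lip_fst (hK ω) x x' y)
    (fun ω x => (hK ω).continuous.comp (Continuous.prodMk_right x)) ε hε
  obtain ⟨n', t, ey, e2, ht, e2m, e20, e2B, e2le, E2⟩ := quantize P ν (fun ω y x => c ω x y)
    (fun ω y x => hc0 ω x y) (fun ω y x => hcB ω x y)
    (hcm.comp (measurable_fst.prodMk (measurable_snd.snd.prodMk measurable_snd.fst))) K
    (fun ω y y' x => lip_snd (hK ω) x y y')
    (fun ω y => (hK ω).continuous.comp (Continuous.prodMk_left y)) ε hε
  have e2le' : ∀ ω x y, |c ω x y - c ω x (ey (t y))| ≤ e2 ω y := fun ω x y => e2le ω y x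
  have hum : ∀ i, Measurable (fun ω => (μ ω).real (s ⁻¹' {i})) := fun i =>
    (μ.measurable_coe (hs (measurableSet_singleton i))).ennreal_toReal
  have hvm : ∀ j, Measurable (fun ω => (ν ω).real (t ⁻¹' {j})) := fun j =>
    (ν.measurable_coe (ht (measurableSet_singleton j))).ennreal_toReal
  have hcij : ∀ i j, Measurable (fun ω => - c ω (ex i) (ey j)) := fun i j =>
    Measurable.neg (f := fun ω => c ω (ex i) (ey j))
      (hcm.comp (measurable_id.prodMk (measurable_const (a := (ex i, ey j)))))
  have huL : ∀ i, MemLp (fun ω => (μ ω).real (s ⁻¹' {i})) 2 P := fun i =>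
    MemLp.of_bound (hum i).aestronglyMeasurable 1 (Eventually.of_forall fun ω => by
      rw [Real.norm_of_nonneg measureReal_nonneg]; exact measureReal_le_one)
  have hvL : ∀ j, MemLp (fun ω => (ν ω).real (t ⁻¹' {j})) 2 P := fun j =>
    MemLp.of_bound (hvm j).aestronglyMeasurable 1 (Eventually.of_forall fun ω => by
      rw [Real.norm_of_nonneg measureReal_nonneg]; exact measureReal_le_one)
  have hFL : ∀ i j, MemLp (fun ω => - c ω (ex i) (ey j)) 2 P := fun i j =>
    MemLp.of_bound (hcij i j).aestronglyMeasurable B (Eventually.of_forall fun ω => by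
      rw [norm_neg, Real.norm_of_nonneg (hc0 _ _ _)]; exact hcB _ _ _)
  let u : Fin (n + 1) → Lp ℝ 2 P := fun i => (huL i).toLp _
  let v : Fin (n' + 1) → Lp ℝ 2 P := fun j => (hvL j).toLp _
  let F : Fin (n + 1) → Fin (n' + 1) → Lp ℝ 2 P := fun i j => (hFL i j).toLp _
  have hu : ∀ i, u i =ᵐ[P] fun ω => (μ ω).real (s ⁻¹' {i}) := fun i => MemLp.coeFn_toLp _
  have hv : ∀ j, v j =ᵐ[P] fun ω => (ν ω).real (t ⁻¹' {j}) := fun j => MemLp.coeFn_toLp _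
  have hF : ∀ i j, F i j =ᵐ[P] fun ω => - c ω (ex i) (ey j) := fun i j => MemLp.coeFn_toLp _
  have hu0 : ∀ i, 0 ≤ u i := fun i => (Lp.coeFn_nonneg _).1 (by
    filter_upwards [hu i] with ω h
    rw [h]; exact measureReal_nonneg)
  have hv0 : ∀ i, 0 ≤ v i := fun i => (Lp.coeFn_nonneg _).1 (by
    filter_upwards [hv i] with ω h
    rw [h]; exact measureReal_nonneg)
  have hsum : ∀ {N : ℕ} (f : Fin N → Lp ℝ 2 P),
      ((∑ i, f i : Lp ℝ 2 P) : Ω → ℝ) =ᵐ[P] fun ω => ∑ i, f i ω := fun f => by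
    filter_upwards [Lp.coeFn_finsetSum Finset.univ f] with ω h
    rw [h, Finset.sum_apply]
  have hsumone : ∀ ω, ∑ i, (μ ω).real (s ⁻¹' {i}) = 1 := fun ω => by
    have := (integral_fibre (μ ω) hs fun _ => (1 : ℝ)).2
    simpa using this.symm
  have htumone : ∀ ω, ∑ i, (ν ω).real (t ⁻¹' {i}) = 1 := fun ω => by
    have := (integral_fibre (ν ω) ht fun _ => (1 : ℝ)).2
    simpa using this.symm
  have huv : ∑ i, u i = ∑ j, v j := by
    refine Lp.ext ?_
    filter_upwards [hsum u, hsum v, ae_all_iff.2 hu, ae_all_iff.2 hv] with ω h1 h2 h3 h4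
    rw [h1, h2]
    simp only [h3, h4, hsumone, htumone]
  obtain ⟨m, hm0, hmr, hmc, hm⟩ := hb_duality u v hu0 hv0 huv F
  obtain ⟨a, b, hab, hval⟩ := hm ε hε
  have hprod : ∀ f g : Lp ℝ 2 P, Integrable (fun ω => f ω * g ω) P := fun f g =>
    MemLp.integrable_mul (Lp.memLp f) (Lp.memLp g)
  have hmF : ∀ i j, (fun ω => m i j ω * F i j ω) =ᵐ[P] fun ω => -(m i j ω * c ω (ex i) (ey j)) := by
    intro i j
    filter_upwards [hF i j] with ω h
    rw [h]; ring
  have hua : ∀ i, (fun ω => u i ω * a i ω) =ᵐ[P] fun ω => (μ ω).real (s ⁻¹' {i}) * a i ω := by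
    intro i
    filter_upwards [hu i] with ω h
    rw [h]
  have hvb : ∀ i, (fun ω => v i ω * b i ω) =ᵐ[P] fun ω => (ν ω).real (t ⁻¹' {i}) * b i ω := by
    intro i
    filter_upwards [hv i] with ω h
    rw [h]
  simp only [L2_inner_eq] at hval
  simp only [integral_congr_ae (hua _), integral_congr_ae (hvb _), integral_congr_ae (hmF _ _),
    integral_neg, Finset.sum_neg_distrib] at hval
  obtain ⟨π, hπ, hcost⟩ := primal_bound P μ ν s t hs ht ex ey c hc0 e1 e2 e1m e10 e1B e2m e20 e2B
    (fun ω x y => by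
      have h1 := (abs_le.1 (e1le ω x y)).2
      have h2 := (abs_le.1 (e2le' ω (ex (s x)) y)).2
      linarith)
    (fun i j => m i j) (fun i j => (Lp.stronglyMeasurable _).measurable)
    (fun i j => (Lp.coeFn_nonneg _).2 (hm0 i j))
    (fun i j => by
      have := ((hprod (m i j) (F i j)).congr (hmF i j)).neg
      simpa [Pi.neg_def] using this)
    (fun i => by
      filter_upwards [hsum (m i), hu i] with ω h1 h2
      rw [← h1, hmr, h2])
    (fun j => by
      filter_upwards [hsum (fun i => m i j), hv j] with ω h1 h2
      rw [← h1, hmc, h2])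
  obtain ⟨ψ, ψc, hd, hdv⟩ := dual_bound P μ ν s t hs ht ex ey c hc0 hcB hcm K hK e1 e2 e1m e10 e1B
    e2m e20 e2B e1le e2le' (fun i => a i) (fun i => (Lp.stronglyMeasurable _).measurable)
    (fun j => b j)
    (fun i j => by
      filter_upwards [hF i j, (Lp.coeFn_le _ _).2 (hab i j), Lp.coeFn_add (a i) (b j)]
        with ω h1 h2 h3
      rw [← h1]
      refine h2.trans_eq ?_
      rw [h3]; rfl)
    (fun i => (hprod _ _).congr (hua i)) (fun i => (hprod _ _).congr (hvb i))
  refine ⟨ψ, ψc, π, hd, hπ, hcost.trans (ENNReal.ofReal_le_ofReal ?_)⟩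
  linarith

lemma weak_duality {Ω X Y : Type*} [MeasurableSpace Ω]
    [PseudoMetricSpace X] [MeasurableSpace X] [PseudoMetricSpace Y] [MeasurableSpace Y]
    (P : Measure Ω) [IsProbabilityMeasure P] (μ : Kernel Ω X) [IsMarkovKernel μ]
    (ν : Kernel Ω Y) [IsMarkovKernel ν]
    (c : Ω → X → Y → ℝ) {B C : ℝ} (hc0 : ∀ ω x y, 0 ≤ c ω x y) (hcB : ∀ ω x y, c ω x y ≤ B)
    (hcm : Measurable (fun q : Ω × X × Y => c q.1 q.2.1 q.2.2))
    {K : Ω → ℝ≥0} {ψ : Ω → X → ℝ} {ψc : Ω → Y → ℝ} (hd : IsDual c K C ψ ψc)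
    (π : Kernel Ω (X × Y)) [IsMarkovKernel π] (h1 : π.fst = μ) (h2 : π.snd = ν) :
    ENNReal.ofReal (∫ ω, ((∫ y, ψc ω y ∂(ν ω)) - (∫ x, ψ ω x ∂(μ ω))) ∂P) ≤
      ∫⁻ ω, ∫⁻ q, ENNReal.ofReal (c ω q.1 q.2) ∂(π ω) ∂P := by
  obtain ⟨-, i1, -⟩ := integral_bdd_compProd P μ hd.m1 hd.b1
  obtain ⟨-, i2, -⟩ := integral_bdd_compProd P ν hd.m2 hd.b2
  obtain ⟨-, i3, k3⟩ := integral_bdd_compProd P π (C := B) (ψ := fun ω q => c ω q.1 q.2) hcm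
    fun ω q => by rw [abs_of_nonneg (hc0 _ _ _)]; exact hcB _ _ _
  have := lintegral_ofReal_compProd P π (e := fun ω q => c ω q.1 q.2) hcm
    (fun ω q => hc0 _ _ _) (fun ω q => hcB _ _ _)
  rw [this, k3]
  refine ENNReal.ofReal_le_ofReal (integral_mono (i2.sub i1) i3 fun ω => ?_)
  have mc : Measurable (fun q : X × Y => c ω q.1 q.2) := hcm.comp measurable_prodMk_left
  have m1 : Measurable (ψ ω) := hd.m1.comp measurable_prodMk_left
  have m2 : Measurable (ψc ω) := hd.m2.comp measurable_prodMk_left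
  have I1 : Integrable (fun q : X × Y => ψ ω q.1) (π ω) := Integrable.of_bound
    (m1.comp measurable_fst).aestronglyMeasurable C (Eventually.of_forall fun x => hd.b1 ω x.1)
  have I2 : Integrable (fun q : X × Y => ψc ω q.2) (π ω) := Integrable.of_bound
    (m2.comp measurable_snd).aestronglyMeasurable C (Eventually.of_forall fun x => hd.b2 ω x.2)
  have I3 : Integrable (fun q : X × Y => c ω q.1 q.2) (π ω) := Integrable.of_bound
    mc.aestronglyMeasurable B (Eventually.of_forall fun x => by
      rw [Real.norm_of_nonneg (hc0 _ _ _)]; exact hcB _ _ _)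
  have J1 : ∫ x, ψ ω x ∂(μ ω) = ∫ q, ψ ω q.1 ∂(π ω) := by
    rw [← h1, Kernel.fst_apply, integral_map measurable_fst.aemeasurable m1.aestronglyMeasurable]
  have J2 : ∫ x, ψc ω x ∂(ν ω) = ∫ q, ψc ω q.2 ∂(π ω) := by
    rw [← h2, Kernel.snd_apply, integral_map measurable_snd.aemeasurable m2.aestronglyMeasurable]
  show (∫ y, ψc ω y ∂(ν ω)) - (∫ x, ψ ω x ∂(μ ω)) ≤ ∫ q, c ω q.1 q.2 ∂(π ω)
  rw [J1, J2, ← integral_sub I2 I1]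
  exact integral_mono (I2.sub I1) I3 fun q => hd.le ω q.1 q.2

end Approx

/-- **Attainment of the stochastic Kantorovich duality for bounded Lipschitz costs.**
If `c` is bounded, jointly measurable, Lipschitz in `(x,y)` for each `ω` and measurable in
`ω`, then there is a dual pair `(ψ, ψᶜ)` of bounded, jointly measurable functions,
Lipschitz in the space variable for each `ω`, with `ψᶜ(ω,y) − ψ(ω,x) ≤ c(ω,x,y)`
everywhere, attaining the stochastic Monge–Kantorovich cost:
`C^stoch(c,μ,ν) = E( ∫ ψᶜ dν_ω − ∫ ψ dμ_ω )`. -/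
theorem stochastic_duality_attained_bounded_lipschitz
    {Ω X Y : Type*} [MeasurableSpace Ω]
    [MetricSpace X] [CompleteSpace X] [SecondCountableTopology X]
    [MeasurableSpace X] [BorelSpace X]
    [MetricSpace Y] [CompleteSpace Y] [SecondCountableTopology Y]
    [MeasurableSpace Y] [BorelSpace Y]
    (P : Measure Ω) [IsProbabilityMeasure P]
    (μ : Kernel Ω X) [IsMarkovKernel μ] (ν : Kernel Ω Y) [IsMarkovKernel ν]
    (c : Ω → X → Y → ℝ)
    (hc_nonneg : ∀ ω x y, 0 ≤ c ω x y)
    (hc_bdd : ∃ B : ℝ, ∀ ω x y, c ω x y ≤ B)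
    (hc_jointly_meas : Measurable (fun q : Ω × X × Y => c q.1 q.2.1 q.2.2))
    (hc_lip : ∀ ω, ∃ K : ℝ≥0, LipschitzWith K (fun q : X × Y => c ω q.1 q.2))
    (hc_meas : ∀ x y, Measurable (fun ω => c ω x y)) :
    ∃ (ψ : Ω → X → ℝ) (ψc : Ω → Y → ℝ),
      Measurable (fun q : Ω × X => ψ q.1 q.2) ∧
      Measurable (fun q : Ω × Y => ψc q.1 q.2) ∧
      (∃ C : ℝ, ∀ ω x, |ψ ω x| ≤ C) ∧
      (∃ C : ℝ, ∀ ω y, |ψc ω y| ≤ C) ∧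
      (∀ ω, ∃ K : ℝ≥0, LipschitzWith K (ψ ω)) ∧
      (∀ ω, ∃ K : ℝ≥0, LipschitzWith K (ψc ω)) ∧
      (∀ ω x y, ψc ω y - ψ ω x ≤ c ω x y) ∧
      stochCost P c μ ν =
        ENNReal.ofReal
          (∫ ω, ((∫ y, ψc ω y ∂(ν ω)) - (∫ x, ψ ω x ∂(μ ω))) ∂P) := by
  classical
  have hΩ : Nonempty Ω := nonempty_of_isProbabilityMeasure P
  have hX : Nonempty X := nonempty_of_isProbabilityMeasure (μ hΩ.some)
  have hY : Nonempty Y := nonempty_of_isProbabilityMeasure (ν hΩ.some)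
  obtain ⟨B, hcB⟩ := hc_bdd
  choose K hK using hc_lip
  have hB : 0 ≤ B := (hc_nonneg hΩ.some hX.some hY.some).trans (hcB _ _ _)
  obtain ⟨ψ, ψc, hd, hmax⟩ := dual_attained (c := c) (K := K) (C := B) P μ ν hB
    ⟨fun _ _ => 0, fun _ _ => 0, measurable_const, measurable_const, by simpa using hB,
      by simpa using hB, fun ω x x' => by positivity, fun ω x x' => by positivity,
      fun ω x y => by simpa using hc_nonneg ω x y⟩
  refine ⟨ψ, ψc, hd.m1, hd.m2, ⟨B, hd.b1⟩, ⟨B, hd.b2⟩,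
    fun ω => ⟨K ω, LipschitzWith.of_le_add_mul (K ω) (hd.l1 ω)⟩,
    fun ω => ⟨K ω, LipschitzWith.of_le_add_mul (K ω) (hd.l2 ω)⟩, hd.le, le_antisymm ?_ ?_⟩
  · have key : ∀ ε : ℝ, 0 < ε → stochCost P c μ ν ≤ ENNReal.ofReal
        ((∫ ω, ((∫ y, ψc ω y ∂(ν ω)) - (∫ x, ψ ω x ∂(μ ω))) ∂P) + 5 * ε) := by
      intro ε hε
      obtain ⟨φ, φc, π, hφ, hπ, hle⟩ :=
        approx_duality P μ ν c hc_nonneg hcB hc_jointly_meas K hK ε hε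
      refine (iInf₂_le π hπ).trans (hle.trans (ENNReal.ofReal_le_ofReal ?_))
      linarith [hmax φ φc hφ]
    have lim : Tendsto (fun ε : ℝ => ENNReal.ofReal
        ((∫ ω, ((∫ y, ψc ω y ∂(ν ω)) - (∫ x, ψ ω x ∂(μ ω))) ∂P) + 5 * ε))
        (nhdsWithin 0 (Set.Ioi 0)) (nhds (ENNReal.ofReal
        ((∫ ω, ((∫ y, ψc ω y ∂(ν ω)) - (∫ x, ψ ω x ∂(μ ω))) ∂P) + 5 * 0))) :=
      (ENNReal.continuous_ofReal.comp
        (continuous_const.add (continuous_const.mul continuous_id))).continuousWithinAt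
    rw [mul_zero, add_zero] at lim
    refine ge_of_tendsto lim ?_
    filter_upwards [self_mem_nhdsWithin] with ε hε using key ε hε
  · refine le_iInf₂ fun π hπ => ?_
    obtain ⟨hM, h1, h2⟩ := hπ
    exact weak_duality P μ ν c hc_nonneg hcB hc_jointly_meas hd π h1 h2
end

section
/- Let (X,d_X) be a Polish space, (Ω,F,P) a probability space, and p ≥ 1. For probability kernels μ, ν from Ω to X satisfying E ∫_X d_X(x,x_0)^p μ_ω(dx) < ∞ and E ∫_X d_X(x,x_0)^p ν_ω(dx) < ∞ for some x_0 ∈ X, define W_p(μ,ν) := ( inf_{π ∈ K(μ,ν)} E ∫_{X×X} d_X(x,y)^p π_ω(dx,dy) )^{1/p}. Then W_p(μ,ν) = ( E [ W_p(μ_ω,ν_ω)^p ] )^{1/p}, where W_p(μ_ω,ν_ω) is the usual p-Wasserstein distance between the probability measures μ_ω and ν_ω. -/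
open MeasureTheory ProbabilityTheory Filter ENNReal

set_option linter.unusedSectionVars false

namespace SW

variable {X : Type*} [MeasurableSpace X]

/-- row marginal density of `h` -/
noncomputable def sL (h : X × X → ℝ≥0∞) (n : Measure X) (x : X) : ℝ≥0∞ := ∫⁻ y, h (x, y) ∂n

/-- column marginal density of `h` -/
noncomputable def sR (h : X × X → ℝ≥0∞) (m : Measure X) (y : X) : ℝ≥0∞ := ∫⁻ x, h (x, y) ∂m

/-- remaining mass -/
noncomputable def rem (h : X × X → ℝ≥0∞) (m n : Measure X) : ℝ≥0∞ := ∫⁻ x, (1 - sL h n x) ∂m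

/-- density of the completed coupling -/
noncomputable def dens (h : X × X → ℝ≥0∞) (m n : Measure X) (z : X × X) : ℝ≥0∞ :=
  h z + (1 - sL h n z.1) * (1 - sR h m z.2) / rem h m n

/-- `h` is a density of a sub-coupling -/
def Good (h : X × X → ℝ≥0∞) (m n : Measure X) : Prop :=
  (∀ᵐ x ∂m, sL h n x ≤ 1) ∧ (∀ᵐ y ∂n, sR h m y ≤ 1)

variable {h : X × X → ℝ≥0∞} {m n : Measure X} [IsProbabilityMeasure m] [IsProbabilityMeasure n]

lemma meas_sL (hh : Measurable h) : Measurable (sL h n) := hh.lintegral_prod_right'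

lemma meas_sR (hh : Measurable h) : Measurable (sR h m) := hh.lintegral_prod_left'

lemma rem_le : rem h m n ≤ 1 := by
  calc rem h m n ≤ ∫⁻ x, 1 ∂m := lintegral_mono fun x => tsub_le_self
    _ = 1 := by simp

lemma rem_eq (hh : Measurable h) (hg : Good h m n) : rem h m n = ∫⁻ y, (1 - sR h m y) ∂n := by
  have e1 : ∫⁻ x, sL h n x ∂m = ∫⁻ y, sR h m y ∂n := by
    unfold sL sR
    rw [← lintegral_prod _ hh.aemeasurable, ← lintegral_prod_symm _ hh.aemeasurable]
  have b1 : ∫⁻ x, sL h n x ∂m ≤ 1 := by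
    calc _ ≤ ∫⁻ x, 1 ∂m := lintegral_mono_ae hg.1
      _ = 1 := by simp
  unfold rem
  rw [lintegral_sub (meas_sL hh) (ne_top_of_le_ne_top one_ne_top b1) hg.1,
    lintegral_sub (meas_sR hh) (ne_top_of_le_ne_top one_ne_top (e1 ▸ b1)) hg.2, e1]
  simp

lemma meas_dens (hh : Measurable h) : Measurable (dens h m n) := by
  have := meas_sL (n := n) hh
  have := meas_sR (m := m) hh
  unfold dens
  fun_prop

lemma dens_left (hh : Measurable h) (hg : Good h m n) :
    ∀ᵐ x ∂m, ∫⁻ y, dens h m n (x, y) ∂n = 1 := by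
  have hsL := meas_sL (n := n) hh
  have hsR := meas_sR (m := m) hh
  have key : ∀ x, ∫⁻ y, dens h m n (x, y) ∂n
      = sL h n x + (1 - sL h n x) * (rem h m n / rem h m n) := by
    intro x
    unfold dens
    rw [lintegral_add_left (by fun_prop)]
    simp only [mul_div_assoc]
    rw [lintegral_const_mul _ (by fun_prop)]
    simp only [div_eq_mul_inv]
    rw [lintegral_mul_const _ (by fun_prop), ← rem_eq hh hg]
    rfl
  by_cases hr : rem h m n = 0
  · have : ∀ᵐ x ∂m, 1 - sL h n x = 0 := (lintegral_eq_zero_iff (by fun_prop)).1 hr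
    filter_upwards [this, hg.1] with x h1 h2
    rw [key, h1, zero_mul, add_zero]
    exact le_antisymm h2 (tsub_eq_zero_iff_le.1 h1)
  · filter_upwards [hg.1] with x h2
    rw [key, ENNReal.div_self hr (ne_top_of_le_ne_top one_ne_top rem_le), mul_one]
    exact add_tsub_cancel_of_le h2

lemma dens_right (hh : Measurable h) (hg : Good h m n) :
    ∀ᵐ y ∂n, ∫⁻ x, dens h m n (x, y) ∂m = 1 := by
  have hsL := meas_sL (n := n) hh
  have hsR := meas_sR (m := m) hh
  have key : ∀ y, ∫⁻ x, dens h m n (x, y) ∂m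
      = sR h m y + (1 - sR h m y) * (rem h m n / rem h m n) := by
    intro y
    unfold dens
    rw [lintegral_add_left (by fun_prop)]
    simp only [div_eq_mul_inv]
    rw [lintegral_mul_const _ (by fun_prop), lintegral_mul_const _ (by fun_prop)]
    rw [mul_comm (∫⁻ x, _ ∂m) _, mul_assoc]
    rfl
  by_cases hr : rem h m n = 0
  · have : ∀ᵐ x ∂n, 1 - sR h m x = 0 :=
      (lintegral_eq_zero_iff (by fun_prop)).1 (rem_eq hh hg ▸ hr)
    filter_upwards [this, hg.2] with x h1 h2
    rw [key, h1, zero_mul, add_zero]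
    exact le_antisymm h2 (tsub_eq_zero_iff_le.1 h1)
  · filter_upwards [hg.2] with x h2
    rw [key, ENNReal.div_self hr (ne_top_of_le_ne_top one_ne_top rem_le), mul_one]
    exact add_tsub_cancel_of_le h2

lemma coup_fst (hh : Measurable h) (hg : Good h m n) :
    ((m.prod n).withDensity (dens h m n)).fst = m := by
  have hd := meas_dens (m := m) (n := n) hh
  ext B hB
  rw [Measure.fst_apply hB, withDensity_apply _ (measurable_fst hB),
    ← lintegral_indicator (measurable_fst hB),
    lintegral_prod _ (hd.indicator (measurable_fst hB)).aemeasurable]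
  have : ∀ x, ∫⁻ y, (Prod.fst ⁻¹' B).indicator (dens h m n) (x, y) ∂n
      = B.indicator (fun x => ∫⁻ y, dens h m n (x, y) ∂n) x := by
    intro x
    by_cases hx : x ∈ B <;> simp [Set.indicator, hx]
  simp_rw [this]
  rw [lintegral_indicator hB, setLIntegral_congr_fun_ae (g := fun _ => 1) hB
    ((dens_left hh hg).mono fun x hx _ => hx)]
  simp

lemma coup_snd (hh : Measurable h) (hg : Good h m n) :
    ((m.prod n).withDensity (dens h m n)).snd = n := by
  have hd := meas_dens (m := m) (n := n) hh
  ext B hB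
  rw [Measure.snd_apply hB, withDensity_apply _ (measurable_snd hB),
    ← lintegral_indicator (measurable_snd hB),
    lintegral_prod_symm _ (hd.indicator (measurable_snd hB)).aemeasurable]
  have : ∀ y, ∫⁻ x, (Prod.snd ⁻¹' B).indicator (dens h m n) (x, y) ∂m
      = B.indicator (fun y => ∫⁻ x, dens h m n (x, y) ∂m) y := by
    intro x
    by_cases hx : x ∈ B <;> simp [Set.indicator, hx]
  simp_rw [this]
  rw [lintegral_indicator hB, setLIntegral_congr_fun_ae (g := fun _ => 1) hB
    ((dens_right hh hg).mono fun x hx _ => hx)]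
  simp

/-- remainder cost bound -/
lemma cost_le (hh : Measurable h) (hg : Good h m n) {c : X × X → ℝ≥0∞} {φ : X → ℝ≥0∞}
    (hc : Measurable c) (hφ : Measurable φ) {C : ℝ≥0∞}
    (hcφ : ∀ z, c z ≤ C * (φ z.1 + φ z.2)) :
    ∫⁻ z, c z ∂((m.prod n).withDensity (dens h m n)) ≤
      ∫⁻ z, h z * c z ∂(m.prod n) +
        C * (∫⁻ x, (1 - sL h n x) * φ x ∂m + ∫⁻ y, (1 - sR h m y) * φ y ∂n) := by
  have hsL := meas_sL (n := n) hh
  have hsR := meas_sR (m := m) hh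
  rw [lintegral_withDensity_eq_lintegral_mul _ (meas_dens hh) hc]
  set r := rem h m n with hr
  have e : ∀ z, (dens h m n * c) z ≤ h z * c z + C * (
      ((1 - sL h n z.1) * φ z.1) * ((1 - sR h m z.2) * r⁻¹)
      + ((1 - sL h n z.1) * r⁻¹) * ((1 - sR h m z.2) * φ z.2)) := by
    intro z
    calc (dens h m n * c) z
        = h z * c z + ((1 - sL h n z.1) * (1 - sR h m z.2) * r⁻¹) * c z := by
          simp only [Pi.mul_apply, dens, div_eq_mul_inv, add_mul, ← hr]
      _ ≤ h z * c z + ((1 - sL h n z.1) * (1 - sR h m z.2) * r⁻¹) * (C * (φ z.1 + φ z.2)) := by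
          gcongr; exact hcφ z
      _ = _ := by ring
  refine (lintegral_mono e).trans ?_
  rw [lintegral_add_left (by fun_prop), lintegral_const_mul _ (by fun_prop),
    lintegral_add_left (by fun_prop),
    lintegral_prod_mul (f := fun x => (1 - sL h n x) * φ x)
      (g := fun y => (1 - sR h m y) * r⁻¹) (by fun_prop) (by fun_prop),
    lintegral_prod_mul (f := fun x => (1 - sL h n x) * r⁻¹)
      (g := fun y => (1 - sR h m y) * φ y) (by fun_prop) (by fun_prop),
    lintegral_mul_const _ (by fun_prop), lintegral_mul_const _ (by fun_prop),
    ← rem_eq hh hg, ← rem, ← hr]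
  have : r * r⁻¹ ≤ 1 := ENNReal.mul_inv_le_one r
  gcongr
  · exact mul_le_of_le_one_right' this
  · exact mul_le_of_le_one_left' this


/-- double index map -/
def KK (K : X → ℕ) (z : X × X) : ℕ × ℕ := (K z.1, K z.2)

lemma meas_KK {K : X → ℕ} (hK : Measurable K) : Measurable (KK K) := by
  unfold KK; fun_prop

/-- cellwise density of a coupling -/
noncomputable def cellD (K : X → ℕ) (m n : Measure X) (π : Measure (X × X)) (ij : ℕ × ℕ) : ℝ≥0∞ :=
  π (KK K ⁻¹' {ij}) / (m (K ⁻¹' {ij.1}) * n (K ⁻¹' {ij.2}))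

variable {K : X → ℕ} {π : Measure (X × X)}

lemma cell_le_left (hK : Measurable K) (h1 : π.fst = m) (ij : ℕ × ℕ) :
    π (KK K ⁻¹' {ij}) ≤ m (K ⁻¹' {ij.1}) := by
  rw [← h1, Measure.fst_apply (hK (measurableSet_singleton _))]
  apply measure_mono
  rintro z hz
  simp only [KK, Set.mem_preimage, Set.mem_singleton_iff] at hz ⊢
  rw [← hz]

lemma cell_le_right (hK : Measurable K) (h2 : π.snd = n) (ij : ℕ × ℕ) :
    π (KK K ⁻¹' {ij}) ≤ n (K ⁻¹' {ij.2}) := by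
  rw [← h2, Measure.snd_apply (hK (measurableSet_singleton _))]
  apply measure_mono
  rintro z hz
  simp only [KK, Set.mem_preimage, Set.mem_singleton_iff] at hz ⊢
  rw [← hz]

lemma cellD_mul (hK : Measurable K) (h1 : π.fst = m) (h2 : π.snd = n) (ij : ℕ × ℕ) :
    cellD K m n π ij * (m (K ⁻¹' {ij.1}) * n (K ⁻¹' {ij.2})) = π (KK K ⁻¹' {ij}) := by
  have l1 := cell_le_left hK h1 ij
  have l2 := cell_le_right hK h2 ij
  unfold cellD
  by_cases h0 : m (K ⁻¹' {ij.1}) * n (K ⁻¹' {ij.2}) = 0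
  · rw [h0, mul_zero]
    rcases mul_eq_zero.1 h0 with h | h
    · rw [h] at l1; exact (le_antisymm l1 (zero_le)).symm
    · rw [h] at l2; exact (le_antisymm l2 (zero_le)).symm
  · exact ENNReal.div_mul_cancel h0 (ENNReal.mul_ne_top (measure_ne_top _ _) (measure_ne_top _ _))

lemma cellD_ne_top (hK : Measurable K) (h1 : π.fst = m) (h2 : π.snd = n) (ij : ℕ × ℕ) :
    cellD K m n π ij ≠ ⊤ := by
  have l1 := cell_le_left hK h1 ij
  have l2 := cell_le_right hK h2 ij
  have l3 : π (KK K ⁻¹' {ij}) ≠ ⊤ := ne_top_of_le_ne_top (measure_ne_top _ _) l1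
  unfold cellD
  by_cases h0 : m (K ⁻¹' {ij.1}) * n (K ⁻¹' {ij.2}) = 0
  · have : π (KK K ⁻¹' {ij}) = 0 := by
      rcases mul_eq_zero.1 h0 with h | h
      · rw [h] at l1; exact (le_antisymm l1 (zero_le))
      · rw [h] at l2; exact (le_antisymm l2 (zero_le))
    simp [this]
  · exact ENNReal.div_ne_top l3 h0

lemma ae_cell (hK : Measurable K) : ∀ᵐ x ∂m, m (K ⁻¹' {K x}) ≠ 0 := by
  have : ∀ᵐ i ∂(m.map K), (m.map K) {i} ≠ 0 := by
    rw [ae_iff, ← Set.biUnion_of_singleton {a | ¬ _}, measure_biUnion_null_iff (Set.to_countable _)]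
    intro i hi
    simpa using hi
  have h2 := ae_of_ae_map hK.aemeasurable this
  filter_upwards [h2] with x hx
  rwa [Measure.map_apply hK (measurableSet_singleton _)] at hx

lemma cell_sum_left (hK : Measurable K) (h1 : π.fst = m) (i : ℕ) :
    ∑' j, π (KK K ⁻¹' {(i, j)}) = m (K ⁻¹' {i}) := by
  rw [← h1, Measure.fst_apply (hK (measurableSet_singleton _)), ← measure_iUnion]
  · congr 1
    ext z
    simp [KK]
  · intro a b hab
    apply Disjoint.preimage
    simpa using hab
  · intro j; exact meas_KK hK (measurableSet_singleton _)

lemma cell_sum_right (hK : Measurable K) (h2 : π.snd = n) (j : ℕ) :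
    ∑' i, π (KK K ⁻¹' {(i, j)}) = n (K ⁻¹' {j}) := by
  rw [← h2, Measure.snd_apply (hK (measurableSet_singleton _)), ← measure_iUnion]
  · congr 1
    ext z
    simp [KK]
  · intro a b hab
    apply Disjoint.preimage
    simpa using hab
  · intro j; exact meas_KK hK (measurableSet_singleton _)

lemma cellD_left (hK : Measurable K) (h1 : π.fst = m) (h2 : π.snd = n) :
    ∀ᵐ x ∂m, sL (fun z => cellD K m n π (KK K z)) n x = 1 := by
  filter_upwards [ae_cell hK] with x hx
  unfold sL
  have : ∫⁻ y, cellD K m n π (K x, K y) ∂n = ∫⁻ j, cellD K m n π (K x, j) ∂(n.map K) := by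
    rw [lintegral_map (by fun_prop) hK]
  simp only [KK]
  rw [this, lintegral_countable']
  have ht : m (K ⁻¹' {K x}) ≠ ⊤ := measure_ne_top _ _
  rw [← ENNReal.mul_right_inj hx ht, mul_one, ← ENNReal.tsum_mul_left]
  refine Eq.trans ?_ (cell_sum_left hK h1 (K x))
  congr 1
  ext j
  rw [← cellD_mul hK h1 h2, Measure.map_apply hK (measurableSet_singleton _)]
  ring

lemma cellD_right (hK : Measurable K) (h1 : π.fst = m) (h2 : π.snd = n) :
    ∀ᵐ y ∂n, sR (fun z => cellD K m n π (KK K z)) m y = 1 := by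
  filter_upwards [ae_cell hK] with y hy
  unfold sR
  have : ∫⁻ x, cellD K m n π (K x, K y) ∂m = ∫⁻ i, cellD K m n π (i, K y) ∂(m.map K) := by
    rw [lintegral_map (by fun_prop) hK]
  simp only [KK]
  rw [this, lintegral_countable']
  have ht : n (K ⁻¹' {K y}) ≠ ⊤ := measure_ne_top _ _
  rw [← ENNReal.mul_right_inj hy ht, mul_one, ← ENNReal.tsum_mul_left]
  refine Eq.trans ?_ (cell_sum_right hK h2 (K y))
  congr 1
  ext j
  rw [← cellD_mul hK h1 h2, Measure.map_apply hK (measurableSet_singleton _)]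
  ring

lemma cell_cost (hK : Measurable K) (h1 : π.fst = m) (h2 : π.snd = n) {c : X × X → ℝ≥0∞}
    {D : ℕ × ℕ → ℝ≥0∞} (hcD : ∀ z, c z ≤ D (KK K z)) :
    ∫⁻ z, cellD K m n π (KK K z) * c z ∂(m.prod n) ≤ ∫⁻ z, D (KK K z) ∂π := by
  have hKK := meas_KK hK
  calc _ ≤ ∫⁻ z, cellD K m n π (KK K z) * D (KK K z) ∂(m.prod n) := by
        gcongr with z; exact hcD z
    _ = ∫⁻ z, cellD K m n π z * D z ∂((m.prod n).map (KK K)) := by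
        rw [lintegral_map (by fun_prop) hKK]
    _ = ∫⁻ z, D z ∂(π.map (KK K)) := by
        rw [lintegral_countable', lintegral_countable']
        congr 1
        ext ij
        rw [Measure.map_apply hKK (measurableSet_singleton _),
          Measure.map_apply hKK (measurableSet_singleton _), ← cellD_mul hK h1 h2]
        have : KK K ⁻¹' {ij} = (K ⁻¹' {ij.1}) ×ˢ (K ⁻¹' {ij.2}) := by
          ext z; simp [KK, Prod.ext_iff]
        rw [this, Measure.prod_prod]
        ring
    _ = _ := by rw [lintegral_map (by fun_prop) hKK]

/-- index set of the countable family -/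
abbrev Idx := ℕ × ℕ × (ℕ × ℕ →₀ ℕ)

/-- rational cellwise density -/
noncomputable def qd (N : ℕ) (k : ℕ × ℕ →₀ ℕ) (ij : ℕ × ℕ) : ℝ≥0∞ := (k ij : ℝ≥0∞) / ((N : ℝ≥0∞) + 1)

lemma meas_qd (hK : Measurable K) (N : ℕ) (k : ℕ × ℕ →₀ ℕ) :
    Measurable (fun z => qd N k (KK K z)) := by
  have h1 : Measurable (qd N k) := measurable_of_countable _
  exact h1.comp (meas_KK hK)

/-- approximation of `f` by finite tables -/
noncomputable def appr (f : ℕ × ℕ → ℝ≥0∞) (N : ℕ) : ℕ × ℕ →₀ ℕ :=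
  Finsupp.onFinset (Finset.range N ×ˢ Finset.range N)
    (fun ij => if ij ∈ Finset.range N ×ˢ Finset.range N then ⌊(f ij).toReal * ((N + 1 : ℕ) : ℝ)⌋₊ else 0)
    (by intro a ha; by_contra h; simp [h] at ha)

lemma qd_eq (N : ℕ) (k : ℕ × ℕ →₀ ℕ) (ij : ℕ × ℕ) :
    qd N k ij = ENNReal.ofReal ((k ij : ℝ) / ((N + 1 : ℕ) : ℝ)) := by
  rw [ENNReal.ofReal_div_of_pos (by positivity), ENNReal.ofReal_natCast, ENNReal.ofReal_natCast]
  simp [qd]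

lemma appr_le (f : ℕ × ℕ → ℝ≥0∞) (N : ℕ) (ij : ℕ × ℕ) :
    qd N (appr f N) ij ≤ f ij := by
  rw [qd_eq]
  apply ENNReal.ofReal_le_of_le_toReal
  rw [div_le_iff₀ (by positivity)]
  simp only [appr, Finsupp.onFinset_apply]
  split_ifs
  · exact Nat.floor_le (by positivity)
  · simp; positivity

lemma appr_tendsto (f : ℕ × ℕ → ℝ≥0∞) (hf : ∀ ij, f ij ≠ ⊤) (ij : ℕ × ℕ) :
    Tendsto (fun N => qd N (appr f N) ij) atTop (nhds (f ij)) := by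
  simp_rw [qd_eq]
  rw [← ENNReal.ofReal_toReal (hf ij)]
  apply ENNReal.tendsto_ofReal
  have h0 := (tendsto_nat_floor_mul_div_atTop (R := ℝ) (a := (f ij).toReal) (by positivity)).comp
    ((tendsto_natCast_atTop_atTop (R := ℝ)).comp (tendsto_add_atTop_nat 1))
  refine h0.congr' ?_
  filter_upwards [eventually_gt_atTop ij.1, eventually_gt_atTop ij.2] with N a b
  simp [appr, a, b]

lemma appr_sL (hK : Measurable K) {f : ℕ × ℕ → ℝ≥0∞} (hf : ∀ ij, f ij ≠ ⊤)
    (hs : ∀ᵐ x ∂m, sL (fun z => f (KK K z)) n x = 1) {φ : X → ℝ≥0∞} (hφ : Measurable φ)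
    (hφm : ∫⁻ x, φ x ∂m ≠ ⊤) :
    Tendsto (fun N => ∫⁻ x, (1 - sL (fun z => qd N (appr f N) (KK K z)) n x) * φ x ∂m)
      atTop (nhds 0) := by
  have hKK := meas_KK hK
  have hq : ∀ N, Measurable (fun z => qd N (appr f N) (KK K z)) := fun N =>
    meas_qd hK _ _
  have hsm := fun N => meas_sL (n := n) (hq N)
  have hfin : ∀ᵐ x ∂m, φ x < ⊤ := ae_lt_top hφ hφm
  have := tendsto_lintegral_of_dominated_convergence (μ := m) (f := fun _ => 0)
    (F := fun N x => (1 - sL (fun z => qd N (appr f N) (KK K z)) n x) * φ x) φ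
    (fun N => by have := hsm N; fun_prop)
    (fun N => Eventually.of_forall fun x => mul_le_of_le_one_left' tsub_le_self) hφm ?_
  · simpa using this
  filter_upwards [hs, hfin] with x hx hx2
  have t1 : Tendsto (fun N => sL (fun z => qd N (appr f N) (KK K z)) n x) atTop (nhds 1) := by
    rw [← hx]
    unfold sL
    refine tendsto_lintegral_of_dominated_convergence (fun y => f (KK K (x, y)))
      (fun N => (hq N).comp measurable_prodMk_left) (fun N => Eventually.of_forall fun y =>
        appr_le f N _) ?_ (Eventually.of_forall fun y => appr_tendsto f hf _)
    unfold sL at hx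
    rw [hx]; simp
  have t2 := ENNReal.Tendsto.sub (tendsto_const_nhds (x := (1 : ℝ≥0∞))) t1 (by simp)
  have t3 := ENNReal.Tendsto.mul_const (b := φ x) t2 (Or.inr hx2.ne)
  simpa using t3

lemma appr_sR (hK : Measurable K) {f : ℕ × ℕ → ℝ≥0∞} (hf : ∀ ij, f ij ≠ ⊤)
    (hs : ∀ᵐ x ∂n, sR (fun z => f (KK K z)) m x = 1) {φ : X → ℝ≥0∞} (hφ : Measurable φ)
    (hφm : ∫⁻ x, φ x ∂n ≠ ⊤) :
    Tendsto (fun N => ∫⁻ x, (1 - sR (fun z => qd N (appr f N) (KK K z)) m x) * φ x ∂n)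
      atTop (nhds 0) := by
  have hKK := meas_KK hK
  have hq : ∀ N, Measurable (fun z => qd N (appr f N) (KK K z)) := fun N =>
    meas_qd hK _ _
  have hsm := fun N => meas_sR (m := m) (hq N)
  have hfin : ∀ᵐ x ∂n, φ x < ⊤ := ae_lt_top hφ hφm
  have := tendsto_lintegral_of_dominated_convergence (μ := n) (f := fun _ => 0)
    (F := fun N x => (1 - sR (fun z => qd N (appr f N) (KK K z)) m x) * φ x) φ
    (fun N => by have := hsm N; fun_prop)
    (fun N => Eventually.of_forall fun x => mul_le_of_le_one_left' tsub_le_self) hφm ?_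
  · simpa using this
  filter_upwards [hs, hfin] with x hx hx2
  have t1 : Tendsto (fun N => sR (fun z => qd N (appr f N) (KK K z)) m x) atTop (nhds 1) := by
    rw [← hx]
    unfold sR
    refine tendsto_lintegral_of_dominated_convergence (fun y => f (KK K (y, x)))
      (fun N => (hq N).comp measurable_prodMk_right) (fun N => Eventually.of_forall fun y =>
        appr_le f N _) ?_ (Eventually.of_forall fun y => appr_tendsto f hf _)
    unfold sR at hx
    rw [hx]; simp
  have t2 := ENNReal.Tendsto.sub (tendsto_const_nhds (x := (1 : ℝ≥0∞))) t1 (by simp)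
  have t3 := ENNReal.Tendsto.mul_const (b := φ x) t2 (Or.inr hx2.ne)
  simpa using t3

/-- one-scale approximation -/
lemma scale_approx (hK : Measurable K) (h1 : π.fst = m) (h2 : π.snd = n) {c : X × X → ℝ≥0∞}
    {φ : X → ℝ≥0∞} (hc : Measurable c) (hφ : Measurable φ) {C : ℝ≥0∞} (hC : C ≠ ⊤)
    (hcφ : ∀ z, c z ≤ C * (φ z.1 + φ z.2)) (hφm : ∫⁻ x, φ x ∂m ≠ ⊤) (hφn : ∫⁻ x, φ x ∂n ≠ ⊤)
    {D : ℕ × ℕ → ℝ≥0∞} (hcD : ∀ z, c z ≤ D (KK K z)) {ε : ℝ≥0∞} (hε : ε ≠ 0) :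
    ∃ N k, Good (fun z => qd N k (KK K z)) m n ∧
      ∫⁻ z, c z ∂((m.prod n).withDensity (dens (fun z => qd N k (KK K z)) m n))
        ≤ ∫⁻ z, D (KK K z) ∂π + ε := by
  set f := cellD K m n π with hf'
  have hf : ∀ ij, f ij ≠ ⊤ := cellD_ne_top hK h1 h2
  have tL := appr_sL hK hf (cellD_left hK h1 h2) hφ hφm
  have tR := appr_sR hK hf (cellD_right hK h1 h2) hφ hφn
  have t := ENNReal.Tendsto.const_mul (a := C) (tL.add tR) (Or.inr hC)
  simp only [add_zero, mul_zero] at t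
  obtain ⟨N, hN⟩ := (t.eventually (gt_mem_nhds (pos_iff_ne_zero.2 hε))).exists
  have hg : Good (fun z => qd N (appr f N) (KK K z)) m n := by
    constructor
    · filter_upwards [cellD_left hK h1 h2] with x hx
      rw [← hx]
      exact lintegral_mono fun y => appr_le f N _
    · filter_upwards [cellD_right hK h1 h2] with x hx
      rw [← hx]
      exact lintegral_mono fun y => appr_le f N _
  refine ⟨N, appr f N, hg, ?_⟩
  refine (cost_le (meas_qd hK _ _) hg hc hφ hcφ).trans ?_
  refine add_le_add ?_ hN.le
  refine le_trans ?_ (cell_cost hK h1 h2 hcD)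
  gcongr with z
  exact appr_le f N _

end SW

namespace SW

variable {X : Type*} [MetricSpace X] [SecondCountableTopology X] [MeasurableSpace X] [BorelSpace X]

lemma exists_part (x₀ : X) {δ : ℝ≥0∞} (hδ : δ ≠ 0) :
    ∃ K : X → ℕ, Measurable K ∧ ∀ x y, K x = K y → edist x y ≤ 2 * δ := by
  classical
  have : Nonempty X := ⟨x₀⟩
  have hex : ∀ x : X, ∃ k, edist x (TopologicalSpace.denseSeq X k) < δ := by
    intro x
    have hd := TopologicalSpace.denseRange_denseSeq X
    obtain ⟨_, ⟨k, rfl⟩, hy⟩ := EMetric.mem_closure_iff.1 (hd.closure_range ▸ Set.mem_univ x) δ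
      (pos_iff_ne_zero.2 hδ)
    exact ⟨k, hy⟩
  refine ⟨fun x => Nat.find (hex x), measurable_find hex fun k => ?_, fun x y hxy => ?_⟩
  · exact measurableSet_lt (by fun_prop) measurable_const
  · have h1 := Nat.find_spec (hex x)
    have h2 := Nat.find_spec (hex y)
    simp only at hxy
    rw [← hxy] at h2
    refine (edist_triangle_right _ _ _).trans ((add_le_add h1.le h2.le).trans ?_)
    rw [two_mul]

lemma edist_bound {p : ℝ} (hp : 1 ≤ p) (x₀ : X) (z : X × X) :
    edist z.1 z.2 ^ p ≤ 2 ^ (p - 1) * (edist z.1 x₀ ^ p + edist z.2 x₀ ^ p) := by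
  refine le_trans ?_ (ENNReal.rpow_add_le_mul_rpow_add_rpow _ _ hp)
  exact ENNReal.rpow_le_rpow (edist_triangle_right _ _ _) (by linarith)

lemma two_pow_ne_top {p : ℝ} (hp : 1 ≤ p) : (2 : ℝ≥0∞) ^ (p - 1) ≠ ⊤ :=
  ENNReal.rpow_ne_top_of_nonneg (by linarith) (by simp)

/-- scale -/
noncomputable def dl (i : ℕ) : ℝ≥0∞ := ((i : ℝ≥0∞) + 1)⁻¹

lemma dl_ne (i : ℕ) : dl i ≠ 0 := by simp [dl]

lemma dl_le (i : ℕ) : dl i ≤ 1 := by simp [dl]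

lemma dl_tendsto : Tendsto dl atTop (nhds 0) := by
  have := (ENNReal.tendsto_inv_nat_nhds_zero).comp (tendsto_add_atTop_nat 1)
  refine this.congr fun i => ?_
  simp [dl]

/-- partition maps -/
noncomputable def Kf (x₀ : X) (i : ℕ) : X → ℕ := (exists_part x₀ (dl_ne i)).choose

lemma Kf_meas (x₀ : X) (i : ℕ) : Measurable (Kf x₀ i) := (exists_part x₀ (dl_ne i)).choose_spec.1

lemma Kf_dist (x₀ : X) (i : ℕ) (x y : X) (h : Kf x₀ i x = Kf x₀ i y) : edist x y ≤ 2 * dl i :=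
  (exists_part x₀ (dl_ne i)).choose_spec.2 x y h

/-- the countable family of densities -/
noncomputable def hk (x₀ : X) (a : Idx) (z : X × X) : ℝ≥0∞ := qd a.2.1 a.2.2 (KK (Kf x₀ a.1) z)

lemma hk_meas (x₀ : X) (a : Idx) : Measurable (hk x₀ a) := meas_qd (Kf_meas x₀ a.1) _ _

lemma key {m n : Measure X} [IsProbabilityMeasure m] [IsProbabilityMeasure n] {π : Measure (X × X)}
    [IsProbabilityMeasure π]
    (h1 : π.fst = m) (h2 : π.snd = n) {p : ℝ} (hp : 1 ≤ p) (x₀ : X)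
    (hm : ∫⁻ x, edist x x₀ ^ p ∂m ≠ ⊤) (hn : ∫⁻ x, edist x x₀ ^ p ∂n ≠ ⊤)
    {ε : ℝ≥0∞} (hε : ε ≠ 0) :
    ∃ a, Good (hk x₀ a) m n ∧
      ∫⁻ z, edist z.1 z.2 ^ p ∂((m.prod n).withDensity (dens (hk x₀ a) m n))
        ≤ ∫⁻ z, edist z.1 z.2 ^ p ∂π + ε := by
  have hp0 : 0 ≤ p := by linarith
  have hfin : ∫⁻ z, edist z.1 z.2 ^ p ∂π ≠ ⊤ := by
    refine ne_top_of_le_ne_top ?_ (lintegral_mono (edist_bound hp x₀))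
    rw [lintegral_const_mul _ (by fun_prop), lintegral_add_left (by fun_prop)]
    refine ENNReal.mul_ne_top (two_pow_ne_top hp) (ENNReal.add_ne_top.2 ⟨?_, ?_⟩)
    · rw [← h1, Measure.fst, lintegral_map (by fun_prop) measurable_fst] at hm
      exact hm
    · rw [← h2, Measure.snd, lintegral_map (by fun_prop) measurable_snd] at hn
      exact hn
  have t : Tendsto (fun i => ∫⁻ z, (edist z.1 z.2 + 4 * dl i) ^ p ∂π) atTop
      (nhds (∫⁻ z, edist z.1 z.2 ^ p ∂π)) := by
    refine tendsto_lintegral_of_dominated_convergence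
      (fun z => 2 ^ (p - 1) * (edist z.1 z.2 ^ p + 4 ^ p)) (fun i => by fun_prop)
      (fun i => Eventually.of_forall fun z => ?_) ?_ (Eventually.of_forall fun z => ?_)
    · refine (ENNReal.rpow_add_le_mul_rpow_add_rpow _ _ hp).trans ?_
      have : (4 * dl i) ^ p ≤ 4 ^ p :=
        ENNReal.rpow_le_rpow (mul_le_of_le_one_right' (dl_le i)) hp0
      beta_reduce
      gcongr
    · rw [lintegral_const_mul _ (by fun_prop), lintegral_add_left (by fun_prop)]
      refine ENNReal.mul_ne_top (two_pow_ne_top hp) (ENNReal.add_ne_top.2 ⟨hfin, ?_⟩)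
      simp only [lintegral_const, measure_univ, mul_one]
      exact ENNReal.rpow_ne_top_of_nonneg hp0 (by simp)
    · have h4 := ENNReal.Tendsto.const_mul (a := 4) dl_tendsto (Or.inr (by simp))
      have h5 := (tendsto_const_nhds (x := edist z.1 z.2)).add h4
      simp only [mul_zero, add_zero] at h5
      exact (ENNReal.continuous_rpow_const.tendsto _).comp h5
  have hε2 : ε / 2 ≠ 0 := by simp [hε]
  obtain ⟨i, hi⟩ := (t.eventually (gt_mem_nhds (ENNReal.lt_add_right hfin hε2))).exists
  obtain ⟨N, k, hg, hcost⟩ := scale_approx (Kf_meas x₀ i) h1 h2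
    (c := fun z => edist z.1 z.2 ^ p) (φ := fun x => edist x x₀ ^ p) (by fun_prop) (by fun_prop)
    (two_pow_ne_top hp) (edist_bound hp x₀) hm hn
    (D := fun ij => ⨆ z, ⨆ (_ : KK (Kf x₀ i) z = ij), edist z.1 z.2 ^ p)
    (fun z => le_iSup₂ (f := fun z' (_ : KK (Kf x₀ i) z' = KK (Kf x₀ i) z) => edist z'.1 z'.2 ^ p) z rfl)
    hε2
  refine ⟨(i, N, k), hg, hcost.trans ?_⟩
  calc _ ≤ ∫⁻ z, (edist z.1 z.2 + 4 * dl i) ^ p ∂π + ε / 2 := by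
        gcongr with z
        refine iSup₂_le fun z' hz' => ENNReal.rpow_le_rpow ?_ hp0
        have e1 := Kf_dist x₀ i _ _ (congrArg Prod.fst hz')
        have e2 := Kf_dist x₀ i _ _ (congrArg Prod.snd hz').symm
        calc edist z'.1 z'.2 ≤ edist z'.1 z.1 + edist z.1 z.2 + edist z.2 z'.2 :=
              edist_triangle4 _ _ _ _
          _ ≤ 2 * dl i + edist z.1 z.2 + 2 * dl i := by gcongr
          _ = _ := by ring
    _ ≤ (∫⁻ z, edist z.1 z.2 ^ p ∂π + ε / 2) + ε / 2 := by gcongr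
    _ = _ := by rw [add_assoc, ENNReal.add_halves]

lemma select {Ω Y : Type*} [MeasurableSpace Ω] [MeasurableSpace Y] (G : ℕ → Kernel Ω Y)
    (q : Ω → ℕ → Prop) (hex : ∀ ω, ∃ k, q ω k) (hq : ∀ k, MeasurableSet {ω | q ω k}) :
    ∃ η : Kernel Ω Y, ∀ ω, ∃ k, q ω k ∧ η ω = G k ω := by
  classical
  have hsel : Measurable fun ω => Nat.find (hex ω) := measurable_find hex hq
  have hm : Measurable fun a : ℕ × Ω => G a.1 a.2 :=
    measurable_from_prod_countable_right fun k => (G k).measurable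
  refine ⟨⟨fun ω => G (Nat.find (hex ω)) ω, hm.comp (hsel.prodMk measurable_id)⟩, fun ω => ?_⟩
  exact ⟨Nat.find (hex ω), Nat.find_spec (hex ω), rfl⟩

end SW

/-- **The stochastic `p`-Wasserstein distance equals the `p`-mean of the ω-wise
Wasserstein distances.** For probability kernels `μ, ν` from `Ω` to `X` with finite
`p`-th moments,
`W_p(μ,ν) := ( inf_{π ∈ K(μ,ν)} E ∫ d(x,y)^p π_ω(dx,dy) )^{1/p}
           = ( E[ W_p(μ_ω,ν_ω)^p ] )^{1/p}`,
where the inner infimum on the right runs over couplings of `μ_ω` and `ν_ω`. -/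
theorem stochastic_wasserstein_eq_mean_wasserstein
    {Ω X : Type*} [MeasurableSpace Ω]
    [MetricSpace X] [CompleteSpace X] [SecondCountableTopology X]
    [MeasurableSpace X] [BorelSpace X]
    (P : Measure Ω) [IsProbabilityMeasure P]
    (p : ℝ) (hp : 1 ≤ p) (x₀ : X)
    (μ ν : Kernel Ω X) [IsMarkovKernel μ] [IsMarkovKernel ν]
    (hμ : ∫⁻ ω, ∫⁻ x, edist x x₀ ^ p ∂(μ ω) ∂P < ⊤)
    (hν : ∫⁻ ω, ∫⁻ x, edist x x₀ ^ p ∂(ν ω) ∂P < ⊤) :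
    (⨅ π ∈ {π : Kernel Ω (X × X) | IsMarkovKernel π ∧ π.fst = μ ∧ π.snd = ν},
        ∫⁻ ω, ∫⁻ q, edist q.1 q.2 ^ p ∂(π ω) ∂P) ^ (1 / p) =
      (∫⁻ ω, (⨅ π' ∈ {π' : Measure (X × X) |
            IsProbabilityMeasure π' ∧ π'.fst = μ ω ∧ π'.snd = ν ω},
          ∫⁻ q, edist q.1 q.2 ^ p ∂π') ∂P) ^ (1 / p) := by
  classical
  congr 1
  apply le_antisymm
  swap
  · refine le_iInf₂ fun π hπ => lintegral_mono fun ω => ?_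
    obtain ⟨hM, h1, h2⟩ := hπ
    refine iInf₂_le (π ω) ⟨inferInstance, ?_, ?_⟩
    · rw [← h1, Kernel.fst_apply]; rfl
    · rw [← h2, Kernel.snd_apply]; rfl
  obtain ⟨e, he⟩ := exists_surjective_nat SW.Idx
  -- the kernels
  let h : ℕ → X × X → ℝ≥0∞ := fun k => SW.hk x₀ (e k)
  have hh : ∀ k, Measurable (h k) := fun k => SW.hk_meas x₀ (e k)
  have mL : ∀ k, Measurable fun q : Ω × X => SW.sL (h k) (ν q.1) q.2 := by
    intro k
    have := Measurable.lintegral_kernel_prod_right (κ := Kernel.prodMkRight X ν)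
      (f := fun (q : Ω × X) y => h k (q.2, y)) (by have := hh k; unfold Function.uncurry; fun_prop)
    exact this
  have mR : ∀ k, Measurable fun q : Ω × X => SW.sR (h k) (μ q.1) q.2 := by
    intro k
    have := Measurable.lintegral_kernel_prod_right (κ := Kernel.prodMkRight X μ)
      (f := fun (q : Ω × X) y => h k (y, q.2)) (by have := hh k; unfold Function.uncurry; fun_prop)
    exact this
  have mr : ∀ k, Measurable fun ω => SW.rem (h k) (μ ω) (ν ω) := by
    intro k
    refine Measurable.lintegral_kernel_prod_right (κ := μ)
      (f := fun ω x => 1 - SW.sL (h k) (ν ω) x) ?_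
    exact measurable_const.sub (mL k)
  have md : ∀ k, Measurable (Function.uncurry fun ω => SW.dens (h k) (μ ω) (ν ω)) := by
    intro k
    have a1 : Measurable fun q : Ω × (X × X) => SW.sL (h k) (ν q.1) q.2.1 :=
      (mL k).comp (measurable_fst.prodMk measurable_snd.fst)
    have a2 : Measurable fun q : Ω × (X × X) => SW.sR (h k) (μ q.1) q.2.2 :=
      (mR k).comp (measurable_fst.prodMk measurable_snd.snd)
    have a3 : Measurable fun q : Ω × (X × X) => SW.rem (h k) (μ q.1) (ν q.1) :=
      (mr k).comp measurable_fst
    have a4 : Measurable fun q : Ω × (X × X) => h k q.2 := (hh k).comp measurable_snd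
    exact a4.add (((measurable_const.sub a1).mul (measurable_const.sub a2)).div a3)
  let G : ℕ → Kernel Ω (X × X) := fun k =>
    (μ ×ₖ ν).withDensity fun ω => SW.dens (h k) (μ ω) (ν ω)
  have hG : ∀ k ω, G k ω = ((μ ω).prod (ν ω)).withDensity (SW.dens (h k) (μ ω) (ν ω)) := by
    intro k ω
    simp only [G]
    rw [Kernel.withDensity_apply _ (md k), Kernel.prod_apply]
  let S : ℕ → Set Ω := fun k => {ω | SW.Good (h k) (μ ω) (ν ω)}
  have hS : ∀ k, MeasurableSet (S k) := by
    intro k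
    have b1 : MeasurableSet {q : Ω × X | ¬ SW.sL (h k) (ν q.1) q.2 ≤ 1} :=
      (measurableSet_le (mL k) measurable_const).compl
    have b2 : MeasurableSet {q : Ω × X | ¬ SW.sR (h k) (μ q.1) q.2 ≤ 1} :=
      (measurableSet_le (mR k) measurable_const).compl
    have c1 := Kernel.measurable_kernel_prodMk_left (κ := μ) b1
    have c2 := Kernel.measurable_kernel_prodMk_left (κ := ν) b2
    exact (c1 (measurableSet_singleton 0)).inter (c2 (measurableSet_singleton 0))
  let cost : ℕ → Ω → ℝ≥0∞ := fun k ω => ∫⁻ q, edist q.1 q.2 ^ p ∂(G k ω)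
  have hcost : ∀ k, Measurable (cost k) := fun k =>
    Measurable.lintegral_kernel (by fun_prop)
  let V : Ω → ℝ≥0∞ := fun ω => ⨅ k, if ω ∈ S k then cost k ω else ⊤
  have hV : Measurable V :=
    Measurable.iInf fun k => Measurable.ite (hS k) (hcost k) measurable_const
  -- good index exists everywhere
  obtain ⟨k₀, hk₀⟩ := he (0, 0, 0)
  have hS0 : ∀ ω, ω ∈ S k₀ := by
    intro ω
    have : h k₀ = fun _ => 0 := by
      ext z
      simp [h, hk₀, SW.hk, SW.qd]
    simp only [S, Set.mem_ofPred_eq, this]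
    exact ⟨by simp [SW.sL], by simp [SW.sR]⟩
  -- `V` is below the pointwise cost
  have hVW : ∀ᵐ ω ∂P, V ω ≤ ⨅ π' ∈ {π' : Measure (X × X) |
            IsProbabilityMeasure π' ∧ π'.fst = μ ω ∧ π'.snd = ν ω},
          ∫⁻ q, edist q.1 q.2 ^ p ∂π' := by
    have f1 : ∀ᵐ ω ∂P, ∫⁻ x, edist x x₀ ^ p ∂(μ ω) < ⊤ :=
      ae_lt_top (Measurable.lintegral_kernel (by fun_prop)) hμ.ne
    have f2 : ∀ᵐ ω ∂P, ∫⁻ x, edist x x₀ ^ p ∂(ν ω) < ⊤ :=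
      ae_lt_top (Measurable.lintegral_kernel (by fun_prop)) hν.ne
    filter_upwards [f1, f2] with ω g1 g2
    refine le_iInf₂ fun π' hπ' => ?_
    obtain ⟨hpr, h1, h2⟩ := hπ'
    refine ENNReal.le_of_forall_pos_le_add fun ε hε _ => ?_
    obtain ⟨a, hg, hc⟩ := SW.key h1 h2 hp x₀ g1.ne g2.ne (ε := (ε : ℝ≥0∞))
      (by exact_mod_cast hε.ne')
    obtain ⟨k, rfl⟩ := he a
    refine (iInf_le _ k).trans ?_
    have hgS : ω ∈ S k := hg
    rw [if_pos hgS]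
    simp only [cost, hG]
    exact hc
  refine ENNReal.le_of_forall_pos_le_add fun ε hε _ => ?_
  have hε0 : (ε : ℝ≥0∞) ≠ 0 := by exact_mod_cast hε.ne'
  have hex : ∀ ω, ∃ k, ω ∈ S k ∧ cost k ω ≤ V ω + ε := by
    intro ω
    by_cases hVt : V ω = ⊤
    · exact ⟨k₀, hS0 ω, by simp [hVt]⟩
    · obtain ⟨k, hk⟩ := iInf_lt_iff.1 (ENNReal.lt_add_right hVt hε0)
      by_cases hks : ω ∈ S k
      · rw [if_pos hks] at hk
        exact ⟨k, hks, hk.le⟩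
      · rw [if_neg hks] at hk
        exact absurd hk not_top_lt
  obtain ⟨selK, hSel⟩ := SW.select G (fun ω k => ω ∈ S k ∧ cost k ω ≤ V ω + ε) hex fun k =>
      (hS k).inter (measurableSet_le (hcost k) (hV.add measurable_const))
  have hfst : ∀ ω, (selK ω).fst = μ ω := by
    intro ω
    obtain ⟨k, hk, hk2⟩ := hSel ω
    rw [hk2, hG]
    exact SW.coup_fst (hh _) hk.1
  have hsnd : ∀ ω, (selK ω).snd = ν ω := by
    intro ω
    obtain ⟨k, hk, hk2⟩ := hSel ω
    rw [hk2, hG]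
    exact SW.coup_snd (hh _) hk.1
  have hle : ∀ ω, ∫⁻ q, edist q.1 q.2 ^ p ∂(selK ω) ≤ V ω + ε := by
    intro ω
    obtain ⟨k, hk, hk2⟩ := hSel ω
    rw [hk2]
    exact hk.2
  have hmem : IsMarkovKernel selK ∧ selK.fst = μ ∧ selK.snd = ν := by
    refine ⟨⟨fun ω => ⟨?_⟩⟩, ?_, ?_⟩
    · rw [← Measure.fst_univ, hfst]; simp
    · ext1 ω
      rw [Kernel.fst_apply]; exact hfst ω
    · ext1 ω
      rw [Kernel.snd_apply]; exact hsnd ω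
  refine (iInf₂_le selK hmem).trans ?_
  calc ∫⁻ ω, ∫⁻ q, edist q.1 q.2 ^ p ∂(selK ω) ∂P
      ≤ ∫⁻ ω, (V ω + ε) ∂P := lintegral_mono hle
    _ = ∫⁻ ω, V ω ∂P + ε := by
        rw [lintegral_add_right _ measurable_const]; simp
    _ ≤ _ := by
        gcongr ?_ + _
        exact lintegral_mono_ae hVW
end

section
/- Let (X,d_X) be a complete separable metric space and (Ω,F,P) a probability space whose measure algebra is separable. For p ≥ 1, let 𝒦_p(X) be the space of probability kernels μ from Ω to X with E ∫_X d_X(x,x_0)^p μ_ω(dx) < ∞ for some (hence all) x_0 ∈ X, where two kernels are identified if they agree P-almost surely, and equip 𝒦_p(X) with the distance W_p(μ,ν) := ( inf_{π ∈ K(μ,ν)} E ∫_{X×X} d_X(x,y)^p π_ω(dx,dy) )^{1/p}. Then (𝒦_p(X), W_p) is a complete separable metric space. -/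
open MeasureTheory ProbabilityTheory Filter Topology ENNReal

/-- The `p`-Wasserstein distance between two probability kernels from `Ω` to `X`:
`W_p(μ,ν) := ( inf_{π ∈ K(μ,ν)} E ∫ d(x,y)^p π_ω(dx,dy) )^{1/p}`. -/
noncomputable def kernelWasserstein {Ω X : Type*} [MeasurableSpace Ω] [MetricSpace X]
    [MeasurableSpace X] (P : Measure Ω) (p : ℝ) (μ ν : Kernel Ω X) : ℝ≥0∞ :=
  (⨅ π ∈ {π : Kernel Ω (X × X) | IsMarkovKernel π ∧ π.fst = μ ∧ π.snd = ν},
      ∫⁻ ω, ∫⁻ q, edist q.1 q.2 ^ p ∂(π ω) ∂P) ^ (1 / p)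

/-- The space `𝒦_p(X)` of probability kernels from `Ω` to `X` with a finite `p`-th
moment. -/
def kernelWassersteinSpace {Ω X : Type*} [MeasurableSpace Ω] [MetricSpace X]
    [MeasurableSpace X] (P : Measure Ω) (p : ℝ) (x₀ : X) : Set (Kernel Ω X) :=
  {μ | IsMarkovKernel μ ∧ ∫⁻ ω, ∫⁻ x, edist x x₀ ^ p ∂(μ ω) ∂P < ⊤}

noncomputable section

set_option linter.unusedSectionVars false

namespace KW

/-- The `L^p` distance between two `X`-valued random variables. -/
def lpd {Y X : Type*} [MeasurableSpace Y] [MetricSpace X] (M : Measure Y) (p : ℝ)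
    (a b : Y → X) : ℝ≥0∞ :=
  (∫⁻ y, edist (a y) (b y) ^ p ∂M) ^ (1 / p)

variable {Ω X Y : Type*} [MeasurableSpace Ω] [MeasurableSpace Y]
    [MetricSpace X] [CompleteSpace X] [SecondCountableTopology X]
    [MeasurableSpace X] [BorelSpace X]
    {P : Measure Ω} {p : ℝ}

lemma lpd_comm (M : Measure Y) (p : ℝ) (a b : Y → X) : lpd M p a b = lpd M p b a := by
  simp only [lpd, edist_comm]

lemma lpd_triangle (M : Measure Y) (hp : 1 ≤ p) {a b c : Y → X} (ha : Measurable a)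
    (hb : Measurable b) (hc : Measurable c) :
    lpd M p a c ≤ lpd M p a b + lpd M p b c := by
  have hp0 : 0 < p := by linarith
  refine le_trans ?_ (ENNReal.lintegral_Lp_add_le (μ := M) (ha.edist hb).aemeasurable
    (hb.edist hc).aemeasurable hp)
  unfold lpd
  gcongr with y
  exact edist_triangle _ _ _

lemma lpd_map {Z : Type*} [MeasurableSpace Z] (M : Measure Z) (p : ℝ) {g : Z → Y}
    (hg : Measurable g) {a b : Y → X} (ha : Measurable a) (hb : Measurable b) :
    lpd (M.map g) p a b = lpd M p (a ∘ g) (b ∘ g) := by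
  unfold lpd
  rw [lintegral_map ((ha.edist hb).pow_const p) hg]
  rfl

lemma lpd_bind (η : Kernel Ω Y) (p : ℝ) {a b : Y → X} (ha : Measurable a) (hb : Measurable b) :
    lpd (P.bind η) p a b = (∫⁻ ω, ∫⁻ y, edist (a y) (b y) ^ p ∂(η ω) ∂P) ^ (1 / p) := by
  unfold lpd
  rw [Measure.lintegral_bind η.measurable.aemeasurable ((ha.edist hb).pow_const p).aemeasurable]

lemma W_le_of_coupling (hp : 1 ≤ p) {μ ν : Kernel Ω X} (η : Kernel Ω Y) [IsMarkovKernel η]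
    {a b : Y → X} (ha : Measurable a) (hb : Measurable b) (h1 : η.map a = μ) (h2 : η.map b = ν) :
    kernelWasserstein P p μ ν ≤ lpd (P.bind η) p a b := by
  have hp0 : 0 < p := by linarith
  rw [lpd_bind η p ha hb]
  unfold kernelWasserstein
  gcongr
  refine (iInf₂_le (η.map (fun y => (a y, b y))) ?_).trans ?_
  · refine ⟨Kernel.IsMarkovKernel.map _ (ha.prodMk hb), ?_, ?_⟩
    · rw [Kernel.fst_map_prod _ hb, h1]
    · rw [Kernel.snd_map_prod _ ha, h2]
  · gcongr with ω
    rw [Kernel.map_apply _ (ha.prodMk hb), lintegral_map _ (ha.prodMk hb)]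
    exact (measurable_fst.edist measurable_snd).pow_const p

lemma exists_coupling (hp : 1 ≤ p) {μ ν : Kernel Ω X} {c : ℝ≥0∞}
    (h : kernelWasserstein P p μ ν < c) :
    ∃ π : Kernel Ω (X × X), IsMarkovKernel π ∧ π.fst = μ ∧ π.snd = ν ∧
      lpd (P.bind π) p Prod.fst Prod.snd < c := by
  have hp0 : 0 < p := by linarith
  unfold kernelWasserstein at h
  rw [one_div, ENNReal.rpow_inv_lt_iff hp0] at h
  simp only [iInf_lt_iff] at h
  obtain ⟨π, ⟨h1, h2, h3⟩, h4⟩ := h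
  refine ⟨π, h1, h2, h3, ?_⟩
  rwa [lpd_bind π p measurable_fst measurable_snd, one_div, ENNReal.rpow_inv_lt_iff hp0]

lemma W_self (hp : 1 ≤ p) (μ : Kernel Ω X) [IsMarkovKernel μ] : kernelWasserstein P p μ μ = 0 := by
  have hp0 : 0 < p := by linarith
  refine le_antisymm ((W_le_of_coupling hp μ measurable_id measurable_id (Kernel.map_id μ)
    (Kernel.map_id μ)).trans ?_) zero_le
  simp [lpd, hp0]

lemma W_comm_le (hp : 1 ≤ p) (μ ν : Kernel Ω X) :
    kernelWasserstein P p μ ν ≤ kernelWasserstein P p ν μ := by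
  refine le_of_forall_gt fun c hc => ?_
  obtain ⟨π, h1, h2, h3, h4⟩ := exists_coupling hp hc
  refine (W_le_of_coupling hp π measurable_snd measurable_fst ?_ ?_).trans_lt ?_
  · rw [← h3, Kernel.snd_eq]
  · rw [← h2, Kernel.fst_eq]
  · rwa [lpd_comm]

lemma W_comm (hp : 1 ≤ p) (μ ν : Kernel Ω X) :
    kernelWasserstein P p μ ν = kernelWasserstein P p ν μ :=
  le_antisymm (W_comm_le hp _ _) (W_comm_le hp _ _)

/-- gluing -/
lemma exists_glue [Nonempty X] (π₁ π₂ : Kernel Ω (X × X)) [IsMarkovKernel π₁] [IsMarkovKernel π₂]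
    (h : π₁.snd = π₂.fst) :
    ∃ η : Kernel Ω (X × X × X), IsMarkovKernel η ∧ η.map (fun q => (q.2.1, q.1)) = π₁ ∧
      η.map (fun q => (q.1, q.2.2)) = π₂ := by
  let σ : Kernel Ω (X × X) := π₁.map Prod.swap
  have : IsMarkovKernel σ := Kernel.IsMarkovKernel.map _ measurable_swap
  have hσ : σ.fst = π₂.fst := by
    rw [← h, Kernel.fst_eq, Kernel.snd_eq, ← Kernel.map_comp_right _ measurable_swap measurable_fst]
    rfl
  refine ⟨π₂.fst ⊗ₖ (σ.condKernel ×ₖ π₂.condKernel), inferInstance, ?_, ?_⟩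
  · have h1 : σ = σ.fst ⊗ₖ σ.condKernel := (σ.disintegrate σ.condKernel).symm
    have h2 : (π₂.fst ⊗ₖ (σ.condKernel ×ₖ π₂.condKernel)).map (fun q => (q.1, q.2.1)) = σ := by
      conv_rhs => rw [h1, hσ]
      ext ω s hs
      rw [Kernel.map_apply' _ _ _ hs, Kernel.compProd_apply, Kernel.compProd_apply hs]
      · congr 1 with x
        have : Prod.mk x ⁻¹' ((fun q : X × X × X => (q.1, q.2.1)) ⁻¹' s)
          = (Prod.mk x ⁻¹' s) ×ˢ Set.univ := by ext; simp
        rw [this, Kernel.prod_apply_prod]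
        simp
      · exact hs.preimage (by fun_prop)
      · fun_prop
    have h3 : σ.map Prod.swap = π₁ := by
      simp only [σ]
      rw [← Kernel.map_comp_right _ measurable_swap measurable_swap]
      simp
    refine Eq.trans ?_ h3
    refine Eq.trans ?_ (congrArg (fun k : Kernel Ω (X × X) => k.map Prod.swap) h2)
    rw [← Kernel.map_comp_right _ (by fun_prop) (by fun_prop)]
    rfl
  · conv_rhs => rw [(π₂.disintegrate π₂.condKernel).symm]
    ext ω s hs
    rw [Kernel.map_apply' _ _ _ hs, Kernel.compProd_apply, Kernel.compProd_apply hs]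
    · congr 1 with x
      have : Prod.mk x ⁻¹' ((fun q : X × X × X => (q.1, q.2.2)) ⁻¹' s)
          = Set.univ ×ˢ (Prod.mk x ⁻¹' s) := by ext; simp
      rw [this, Kernel.prod_apply_prod]
      simp
    · exact hs.preimage (by fun_prop)
    · fun_prop

lemma bind_map {X : Type*} [MeasurableSpace X] (η : Kernel Ω Y) {a : Y → X} (ha : Measurable a) :
    P.bind (η.map a) = (P.bind η).map a := by
  rw [Measure.map_comp _ _ ha]

lemma W_triangle [Nonempty X] (hp : 1 ≤ p) (μ ν ρ : Kernel Ω X) :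
    kernelWasserstein P p μ ρ ≤ kernelWasserstein P p μ ν + kernelWasserstein P p ν ρ := by
  by_cases ht1 : kernelWasserstein P p μ ν = ⊤
  · simp [ht1]
  by_cases ht2 : kernelWasserstein P p ν ρ = ⊤
  · simp [ht2]
  refine ENNReal.le_of_forall_pos_le_add fun ε hε _ => ?_
  have hε2 : (ε : ℝ≥0∞) / 2 ≠ 0 := by simpa using hε.ne'
  obtain ⟨π₁, i1, a1, b1, c1⟩ := exists_coupling hp (ENNReal.lt_add_right ht1 hε2)
  obtain ⟨π₂, i2, a2, b2, c2⟩ := exists_coupling hp (ENNReal.lt_add_right ht2 hε2)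
  obtain ⟨η, i3, h1, h2⟩ := exists_glue π₁ π₂ (b1.trans a2.symm)
  have m1 : Measurable (fun q : X × X × X => (q.2.1, q.1)) := by fun_prop
  have m2 : Measurable (fun q : X × X × X => (q.1, q.2.2)) := by fun_prop
  rw [← h1, bind_map _ m1, lpd_map _ _ m1 measurable_fst measurable_snd] at c1
  rw [← h2, bind_map _ m2, lpd_map _ _ m2 measurable_fst measurable_snd] at c2
  have := W_le_of_coupling (P := P) (μ := μ) (ν := ρ) hp η (a := fun q => q.2.1)
    (b := fun q => q.2.2) (by fun_prop) (by fun_prop) ?_ ?_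
  · refine this.trans ((lpd_triangle _ hp (b := fun q => q.1) (by fun_prop) (by fun_prop)
      (by fun_prop)).trans ((add_le_add c1.le c2.le).trans ?_))
    rw [add_add_add_comm, ENNReal.add_halves]
  · rw [← a1, ← h1, Kernel.fst_eq, ← Kernel.map_comp_right _ m1 measurable_fst]; rfl
  · rw [← b2, ← h2, Kernel.snd_eq, ← Kernel.map_comp_right _ m2 measurable_snd]; rfl


lemma mem_space_iff {x₀ : X} (hp : 1 ≤ p) {μ : Kernel Ω X} :
    μ ∈ kernelWassersteinSpace P p x₀ ↔
      IsMarkovKernel μ ∧ lpd (P.bind μ) p id (fun _ => x₀) < ⊤ := by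
  have hp0 : 0 < p := by linarith
  rw [lpd_bind μ p measurable_id measurable_const, one_div, ENNReal.rpow_inv_lt_iff hp0,
    ENNReal.top_rpow_of_pos hp0]
  rfl

lemma W_lt_top {x₀ : X} (hp : 1 ≤ p) {μ ν : Kernel Ω X} (hμ : μ ∈ kernelWassersteinSpace P p x₀)
    (hν : ν ∈ kernelWassersteinSpace P p x₀) : kernelWasserstein P p μ ν < ⊤ := by
  rw [mem_space_iff hp] at hμ hν
  obtain ⟨i1, h1⟩ := hμ
  obtain ⟨i2, h2⟩ := hν
  have e1 : (μ ×ₖ ν).map Prod.fst = μ := by rw [← Kernel.fst_eq, Kernel.fst_prod]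
  have e2 : (μ ×ₖ ν).map Prod.snd = ν := by rw [← Kernel.snd_eq, Kernel.snd_prod]
  refine (W_le_of_coupling hp (μ ×ₖ ν) measurable_fst measurable_snd e1 e2).trans_lt ?_
  refine (lpd_triangle _ hp measurable_fst (measurable_const (a := x₀)) measurable_snd).trans_lt ?_
  refine ENNReal.add_lt_top.2 ⟨?_, ?_⟩
  · rw [← e1, bind_map _ measurable_fst, lpd_map _ _ measurable_fst measurable_id
      measurable_const] at h1
    exact h1
  · rw [← e2, bind_map _ measurable_snd, lpd_map _ _ measurable_snd measurable_id
      measurable_const] at h2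
    rw [lpd_comm]
    exact h2

lemma mem_of_W {x₀ : X} (hp : 1 ≤ p) {μ ν : Kernel Ω X} (hμ : μ ∈ kernelWassersteinSpace P p x₀)
    [IsMarkovKernel ν] (h : kernelWasserstein P p μ ν < ⊤) :
    ν ∈ kernelWassersteinSpace P p x₀ := by
  rw [mem_space_iff hp] at hμ ⊢
  obtain ⟨i1, h1⟩ := hμ
  refine ⟨inferInstance, ?_⟩
  obtain ⟨π, i, a, b, c⟩ := exists_coupling hp h
  rw [Kernel.fst_eq] at a
  rw [Kernel.snd_eq] at b
  rw [← a, bind_map _ measurable_fst, lpd_map _ _ measurable_fst measurable_id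
      measurable_const] at h1
  rw [← b, bind_map _ measurable_snd, lpd_map _ _ measurable_snd measurable_id
      measurable_const]
  refine (lpd_triangle _ hp measurable_snd measurable_fst measurable_const).trans_lt ?_
  refine ENNReal.add_lt_top.2 ⟨?_, h1⟩
  rwa [lpd_comm]

lemma lintegral_edist_le_lpd (M : Measure Y) [IsProbabilityMeasure M] (hp : 1 ≤ p) {a b : Y → X}
    (ha : Measurable a) (hb : Measurable b) :
    ∫⁻ y, edist (a y) (b y) ∂M ≤ lpd M p a b := by
  have := eLpNorm'_le_eLpNorm'_of_exponent_le (μ := M) (f := fun y => edist (a y) (b y))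
    one_pos hp (ha.edist hb).aestronglyMeasurable
  simpa [eLpNorm', lpd] using this

lemma lip_le [IsProbabilityMeasure P] (hp : 1 ≤ p) {μ ν : Kernel Ω X}
    (h : kernelWasserstein P p μ ν = 0)
    {g : X → NNReal} {K : NNReal} (hg : LipschitzWith K g) (A : Set Ω) :
    ∫⁻ x, g x ∂((P.restrict A).bind μ) ≤ ∫⁻ x, g x ∂((P.restrict A).bind ν) := by
  have hgm : Measurable (fun x => (g x : ℝ≥0∞)) := hg.continuous.measurable.coe_nnreal_ennreal
  refine ENNReal.le_of_forall_pos_le_add fun ε hε _ => ?_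
  have hc : (0 : ℝ≥0∞) < ε / (K + 1) :=
    ENNReal.div_pos (by simpa using hε.ne') (by simp)
  obtain ⟨π, i, a, b, c⟩ := exists_coupling hp (h.trans_lt hc)
  rw [Kernel.fst_eq] at a
  rw [Kernel.snd_eq] at b
  rw [← a, ← b, bind_map _ measurable_fst, bind_map _ measurable_snd,
    lintegral_map hgm measurable_fst, lintegral_map hgm measurable_snd]
  have hle : (P.restrict A).bind π ≤ P.bind π := by
    intro s
    refine Measure.le_iff.2 ?_ s
    intro s hs
    rw [Measure.bind_apply hs π.measurable.aemeasurable,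
      Measure.bind_apply hs π.measurable.aemeasurable]
    exact lintegral_mono' Measure.restrict_le_self le_rfl
  have hpt : ∀ q : X × X, (g q.1 : ℝ≥0∞) ≤ g q.2 + K * edist q.1 q.2 := by
    intro q
    have h1 := hg q.1 q.2
    have h2 : (g q.1 : ℝ≥0∞) ≤ g q.2 + edist (g q.1) (g q.2) := by
      rw [edist_nndist]
      norm_cast
      exact NNReal.le_add_nndist _ _
    exact h2.trans (by gcongr)
  calc ∫⁻ q, (g q.1 : ℝ≥0∞) ∂((P.restrict A).bind π)
      ≤ ∫⁻ q, ((g q.2 : ℝ≥0∞) + K * edist q.1 q.2) ∂((P.restrict A).bind π) := by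
        gcongr with q; exact hpt q
    _ = ∫⁻ q, (g q.2 : ℝ≥0∞) ∂((P.restrict A).bind π)
        + K * ∫⁻ q, edist q.1 q.2 ∂((P.restrict A).bind π) := by
        have hm2 : Measurable (fun q : X × X => (g q.2 : ℝ≥0∞)) := hgm.comp measurable_snd
        rw [lintegral_add_left hm2, lintegral_const_mul _ (measurable_fst.edist measurable_snd)]
    _ ≤ ∫⁻ q, (g q.2 : ℝ≥0∞) ∂((P.restrict A).bind π) + ε := by
        gcongr
        calc (K : ℝ≥0∞) * ∫⁻ q, edist q.1 q.2 ∂((P.restrict A).bind π)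
            ≤ (K + 1) * (ε / (K + 1)) := by
              gcongr
              · exact le_self_add
              · refine (lintegral_mono' hle le_rfl).trans ?_
                exact (lintegral_edist_le_lpd (P.bind π) hp measurable_fst measurable_snd).trans c.le
          _ ≤ ε := ENNReal.mul_div_le

lemma ae_eq_of_W [Nonempty X] [IsProbabilityMeasure P] (hp : 1 ≤ p) {μ ν : Kernel Ω X}
    [IsMarkovKernel μ] [IsMarkovKernel ν]
    (h : kernelWasserstein P p μ ν = 0) : ∀ᵐ ω ∂P, μ ω = ν ω := by
  have h' : kernelWasserstein P p ν μ = 0 := by rw [W_comm hp, h]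
  have key : ∀ A : Set Ω, (P.restrict A).bind μ = (P.restrict A).bind ν := by
    intro A
    have hcl : ∀ F : Set X, IsClosed F →
        (P.restrict A).bind μ F = (P.restrict A).bind ν F := by
      intro F hF
      have hpos : ∀ n : ℕ, (0 : ℝ) < 1 / ((n : ℝ) + 1) := fun n => by positivity
      have hlim : Tendsto (fun n : ℕ => 1 / ((n : ℝ) + 1)) atTop (𝓝 0) :=
        tendsto_one_div_add_atTop_nhds_zero_nat
      have t1 := tendsto_lintegral_thickenedIndicator_of_isClosed
        ((P.restrict A).bind μ) hF hpos hlim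
      have t2 := tendsto_lintegral_thickenedIndicator_of_isClosed
        ((P.restrict A).bind ν) hF hpos hlim
      refine tendsto_nhds_unique t1 (t2.congr fun n => ?_)
      have hl := lipschitzWith_thickenedIndicator (hpos n) F
      exact le_antisymm (lip_le hp h' hl A) (lip_le hp h hl A)
    refine ext_of_generate_finite {s : Set X | IsClosed s} ?_ isPiSystem_isClosed
      (fun s hs => hcl s hs) (hcl _ isClosed_univ)
    rw [BorelSpace.measurable_eq (α := X), borel_eq_generateFrom_isClosed]
  refine Kernel.ae_eq_of_compProd_eq ?_
  refine Measure.ext_prod_iff.2 fun {s t} hs ht => ?_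
  rw [Measure.compProd_apply_prod hs ht, Measure.compProd_apply_prod hs ht]
  have := congrArg (fun m : Measure X => m t) (key s)
  rwa [Measure.bind_apply ht μ.measurable.aemeasurable,
    Measure.bind_apply ht ν.measurable.aemeasurable] at this

lemma W_of_ae_eq (hp : 1 ≤ p) {μ ν : Kernel Ω X}
    [IsMarkovKernel μ] [IsMarkovKernel ν] (h : ∀ᵐ ω ∂P, μ ω = ν ω) :
    kernelWasserstein P p μ ν = 0 := by
  classical
  have hp0 : 0 < p := by linarith
  have md : Measurable (fun x : X => (x, x)) := by fun_prop
  have : IsMarkovKernel (μ.map (fun x : X => (x, x))) := Kernel.IsMarkovKernel.map _ md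
  set t := toMeasurable P {ω | ¬ μ ω = ν ω} with ht
  have htm : MeasurableSet t := measurableSet_toMeasurable _ _
  have ht0 : P t = 0 := by rw [ht, measure_toMeasurable]; exact h
  have hnt : ∀ ω, ω ∉ t → μ ω = ν ω := by
    intro ω hω
    by_contra hne
    exact hω (subset_toMeasurable P _ hne)
  let π : Kernel Ω (X × X) := Kernel.piecewise htm (μ ×ₖ ν) (μ.map (fun x : X => (x, x)))
  have e1 : π.map Prod.fst = μ := by
    ext1 ω
    rw [Kernel.map_apply _ measurable_fst, Kernel.piecewise_apply]
    split_ifs with hω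
    · rw [← Kernel.map_apply _ measurable_fst, ← Kernel.fst_eq, Kernel.fst_prod]
    · rw [Kernel.map_apply _ md, Measure.map_map measurable_fst md]
      exact Measure.map_id
  have e2 : π.map Prod.snd = ν := by
    ext1 ω
    rw [Kernel.map_apply _ measurable_snd, Kernel.piecewise_apply]
    split_ifs with hω
    · rw [← Kernel.map_apply _ measurable_snd, ← Kernel.snd_eq, Kernel.snd_prod]
    · rw [Kernel.map_apply _ md, Measure.map_map measurable_snd md, ← hnt ω hω]
      exact Measure.map_id
  refine le_antisymm ((W_le_of_coupling hp π measurable_fst measurable_snd e1 e2).trans ?_) zero_le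
  rw [lpd_bind π p measurable_fst measurable_snd]
  have : ∫⁻ ω, ∫⁻ y, edist y.1 y.2 ^ p ∂(π ω) ∂P = 0 := by
    rw [lintegral_congr_ae (g := fun _ => 0)]
    · simp
    · filter_upwards [measure_eq_zero_iff_ae_notMem.1 ht0] with ω hω
      simp only [π]
      rw [Kernel.piecewise_apply, if_neg hω, Kernel.map_apply _ md, lintegral_map _ md]
      · simp [hp0]
      · exact (measurable_fst.edist measurable_snd).pow_const p
  rw [this]
  simp [hp0]


/-- Markov chains with given initial kernel and transition kernels. -/
lemma exists_chain {E : Type*} [MeasurableSpace E] (init : Kernel Ω E) [IsMarkovKernel init]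
    (step : ℕ → Kernel E E) [∀ n, IsMarkovKernel (step n)] :
    ∃ η : Kernel Ω (ℕ → E), IsMarkovKernel η ∧ (∀ ω, (η ω).map (fun x => x 0) = init ω) ∧
      ∀ ω n, (η ω).map (fun x => (x n, x (n + 1))) = ((η ω).map (fun x => x n)) ⊗ₘ step n := by
  let κ : (n : ℕ) → Kernel ((i : Finset.Iic n) → E) E := fun n =>
    (step n).comap (fun x => x ⟨n, Finset.mem_Iic.2 le_rfl⟩) (by fun_prop)
  have hκ : ∀ n, IsMarkovKernel (κ n) := fun n => by dsimp only [κ]; infer_instance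
  have mc : Measurable (fun (e : E) (_ : Finset.Iic 0) => e) := by fun_prop
  let Q : Kernel E (ℕ → E) := (Kernel.traj (X := fun _ => E) κ 0).comap (fun e _ => e) mc
  have hQ : IsMarkovKernel Q := by dsimp only [Q]; infer_instance
  have hQ0 : Q.map (fun x => x 0) = Kernel.id := by
    ext1 e
    rw [Kernel.map_apply _ (by fun_prop), Kernel.comap_apply]
    have h0 := Kernel.traj_map_frestrictLe_apply (X := fun _ => E) (κ := κ) 0 0 (fun _ => e)
    have hf : (fun x : ℕ → E => x 0) =
        (fun y : (i : Finset.Iic 0) → E => y ⟨0, Finset.mem_Iic.2 le_rfl⟩) ∘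
          (Preorder.frestrictLe 0 (π := fun _ => E)) := rfl
    rw [hf, ← Measure.map_map (by fun_prop) (by fun_prop), h0, Kernel.partialTraj_self,
      Kernel.id_apply, Kernel.id_apply]
    have m0 : Measurable (fun y : (i : Finset.Iic 0) → E => y ⟨0, Finset.mem_Iic.2 le_rfl⟩) := by
      fun_prop
    exact Measure.map_dirac' m0 _
  have hQs : ∀ e n, (Q e).map (fun x => (x n, x (n + 1))) =
      ((Q e).map (fun x => x n)) ⊗ₘ step n := by
    intro e n
    rw [Kernel.comap_apply]
    have h1 := Kernel.partialTraj_compProd_eq_map_traj (X := fun _ => E) (κ := κ)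
      (Nat.zero_le n) (x₀ := fun _ => e)
    have h2 := Kernel.traj_map_frestrictLe_apply (X := fun _ => E) (κ := κ) 0 n (fun _ => e)
    have hf : (fun x : ℕ → E => (x n, x (n + 1))) =
        (fun y : ((i : Finset.Iic n) → E) × E => (y.1 ⟨n, Finset.mem_Iic.2 le_rfl⟩, y.2)) ∘
          (fun x => (Preorder.frestrictLe n (π := fun _ => E) x, x (n + 1))) := rfl
    have hg : (fun x : ℕ → E => x n) =
        (fun y : ((i : Finset.Iic n) → E) => y ⟨n, Finset.mem_Iic.2 le_rfl⟩) ∘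
          (Preorder.frestrictLe n (π := fun _ => E)) := rfl
    rw [hf, hg, ← Measure.map_map (by fun_prop) (by fun_prop),
      ← Measure.map_map (by fun_prop) (by fun_prop), h2, ← h1]
    ext s hs
    have : IsFiniteMeasure ((Kernel.partialTraj (X := fun _ => E) κ 0 n fun _ => e).map
      (fun y : ((i : Finset.Iic n) → E) => y ⟨n, Finset.mem_Iic.2 le_rfl⟩)) := inferInstance
    rw [Measure.map_apply (by fun_prop) hs, Measure.compProd_apply, Measure.compProd_apply hs,
      lintegral_map (Kernel.measurable_kernel_prodMk_left hs) (by fun_prop)]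
    · rfl
    · exact hs.preimage (by fun_prop)
  refine ⟨Q ∘ₖ init, inferInstance, fun ω => ?_, fun ω n => ?_⟩
  · rw [← Kernel.map_apply _ (by fun_prop), Kernel.map_comp, hQ0, Kernel.id_comp]
  · ext s hs
    rw [← Kernel.map_apply _ (by fun_prop), ← Kernel.map_apply _ (by fun_prop),
      Kernel.map_comp, Kernel.map_comp, Kernel.comp_apply' _ _ _ hs, Measure.compProd_apply hs,
      Kernel.lintegral_comp _ _ _ (Kernel.measurable_kernel_prodMk_left hs)]
    congr 1 with e
    rw [Kernel.map_apply _ (by fun_prop), hQs, Kernel.map_apply _ (by fun_prop),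
      Measure.compProd_apply hs]

/-- Gluing infinitely many couplings. -/
lemma exists_infinite_glue [Nonempty X] (f : ℕ → Kernel Ω X) (π : ℕ → Kernel Ω (X × X))
    (hf : ∀ n, IsMarkovKernel (f n)) (hπ : ∀ n, IsMarkovKernel (π n))
    (h1 : ∀ n, (π n).fst = f n) (h2 : ∀ n, (π n).snd = f (n + 1)) :
    ∃ η : Kernel Ω (ℕ → Ω × X), IsMarkovKernel η ∧ (∀ n, η.map (fun x => (x n).2) = f n) ∧
      ∀ n, η.map (fun x => ((x n).2, (x (n + 1)).2)) = π n := by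
  let step : ℕ → Kernel (Ω × X) (Ω × X) := fun n =>
    Kernel.deterministic Prod.fst measurable_fst ×ₖ (π n).condKernel
  have hstep : ∀ n, IsMarkovKernel (step n) := fun n => by dsimp only [step]; infer_instance
  obtain ⟨η, hη, h0, hs⟩ := exists_chain (Kernel.id ×ₖ f 0) step
  have key : ∀ n ω, (η ω).map (fun x => x n) = (f n ω).map (fun x => (ω, x)) →
      (η ω).map (fun x => (x n, x (n + 1))) =
        (π n ω).map (fun q => ((ω, q.1), (ω, q.2))) := by
    intro n ω hn
    rw [hs, hn]
    ext s hs
    have : IsFiniteMeasure ((f n ω).map (fun x => (ω, x))) := inferInstance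
    rw [Measure.compProd_apply hs, lintegral_map (Kernel.measurable_kernel_prodMk_left hs)
      (by fun_prop), Measure.map_apply (by fun_prop) hs]
    conv_rhs => rw [← (π n).disintegrate (π n).condKernel, h1]
    rw [Kernel.compProd_apply (hs.preimage (by fun_prop))]
    congr 1 with x
    simp only [step]
    rw [Kernel.prod_apply, Kernel.deterministic_apply, Measure.dirac_prod,
      Measure.map_apply (by fun_prop) (hs.preimage (by fun_prop))]
    rfl
  have marg : ∀ n ω, (η ω).map (fun x => x n) = (f n ω).map (fun x => (ω, x)) := by
    intro n
    induction n with
    | zero =>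
      intro ω
      rw [h0, Kernel.prod_apply, Kernel.id_apply, Measure.dirac_prod]
    | succ n ih =>
      intro ω
      have := congrArg (fun m => m.map Prod.snd) (key n ω (ih ω))
      rw [Measure.map_map (by fun_prop) (by fun_prop),
        Measure.map_map (by fun_prop) (by fun_prop)] at this
      rw [← h2, Kernel.snd_apply, Measure.map_map (by fun_prop) (by fun_prop)]
      exact this
  refine ⟨η, hη, fun n => ?_, fun n => ?_⟩
  · ext1 ω
    have := congrArg (fun m => m.map Prod.snd) (marg n ω)
    rw [Measure.map_map (by fun_prop) (by fun_prop),
        Measure.map_map (by fun_prop) (by fun_prop)] at this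
    rw [Kernel.map_apply _ (by fun_prop)]
    refine this.trans ?_
    exact Measure.map_id
  · ext1 ω
    have := congrArg (fun m => m.map (fun q : (Ω × X) × (Ω × X) => (q.1.2, q.2.2)))
      (key n ω (marg n ω))
    rw [Measure.map_map (by fun_prop) (by fun_prop),
        Measure.map_map (by fun_prop) (by fun_prop)] at this
    rw [Kernel.map_apply _ (by fun_prop)]
    refine this.trans ?_
    exact Measure.map_id


lemma exists_limit [IsProbabilityMeasure P] [Nonempty X] (hp : 1 ≤ p) (f : ℕ → Kernel Ω X)
    (hf : ∀ n, IsMarkovKernel (f n))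
    (hW : ∀ n, kernelWasserstein P p (f n) (f (n + 1)) < 2⁻¹ ^ n) :
    ∃ g : Kernel Ω X, IsMarkovKernel g ∧
      ∀ n, kernelWasserstein P p (f n) g ≤ 2⁻¹ ^ n * 2 := by
  have hp0 : 0 < p := by linarith
  choose π hπ h1 h2 h3 using fun n => exists_coupling hp (hW n)
  obtain ⟨η, hη, m1, m2⟩ := exists_infinite_glue f π hf hπ h1 h2
  set M := P.bind η with hM
  let Z : ℕ → (ℕ → Ω × X) → X := fun n x => (x n).2
  have hZ : ∀ n, Measurable (Z n) := fun n => by dsimp only [Z]; fun_prop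
  have hd : ∀ n, lpd M p (Z n) (Z (n + 1)) ≤ 2⁻¹ ^ n := by
    intro n
    have hm : Measurable (fun x : ℕ → Ω × X => ((x n).2, (x (n + 1)).2)) := by fun_prop
    have := (h3 n).le
    rw [← m2 n, bind_map _ hm, lpd_map _ _ hm measurable_fst measurable_snd] at this
    exact this
  have hsum : ∀ n k, lpd M p (Z n) (Z (n + k)) ≤ ∑ i ∈ Finset.range k, (2⁻¹ : ℝ≥0∞) ^ (n + i) := by
    intro n k
    induction k with
    | zero => simp [lpd, hp0]
    | succ k ih =>
      rw [Finset.sum_range_succ]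
      exact (lpd_triangle M hp (hZ n) (hZ (n + k)) (hZ (n + (k + 1)))).trans
        (add_le_add ih (hd (n + k)))
  have hbd : ∀ n k, lpd M p (Z n) (Z (n + k)) ≤ 2⁻¹ ^ n * 2 := by
    intro n k
    refine (hsum n k).trans ((ENNReal.sum_le_tsum _).trans ?_)
    simp_rw [pow_add]
    rw [ENNReal.tsum_mul_left, ENNReal.tsum_geometric, ENNReal.one_sub_inv_two, inv_inv]
  have hconv : ∀ᵐ x ∂M, ∃ l : X, Tendsto (fun n => Z n x) atTop (𝓝 l) := by
    have hfin : ∫⁻ x, ∑' n, edist (Z n x) (Z (n + 1) x) ∂M ≠ ⊤ := by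
      rw [lintegral_tsum (fun n => ((hZ n).edist (hZ (n + 1))).aemeasurable)]
      refine ne_top_of_le_ne_top (b := ∑' n, (2⁻¹ : ℝ≥0∞) ^ n) ?_ ?_
      · rw [ENNReal.tsum_geometric, ENNReal.one_sub_inv_two, inv_inv]
        simp
      · exact ENNReal.tsum_le_tsum fun n =>
          (lintegral_edist_le_lpd M hp (hZ n) (hZ (n + 1))).trans (hd n)
    filter_upwards [ae_lt_top (Measurable.tsum fun n => (hZ n).edist (hZ (n + 1))) hfin]
      with x hx
    exact cauchySeq_tendsto_of_complete
      (cauchySeq_of_edist_le_of_tsum_ne_top _ (fun n => le_rfl) hx.ne)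
  obtain ⟨Zl, hZl, hlim⟩ := measurable_limit_of_tendsto_metrizable_ae
    (fun n => (hZ n).aemeasurable) hconv
  refine ⟨η.map Zl, Kernel.IsMarkovKernel.map _ hZl, fun n => ?_⟩
  refine (W_le_of_coupling hp η (hZ n) hZl (m1 n) rfl).trans ?_
  unfold lpd
  rw [one_div, ENNReal.rpow_inv_le_iff hp0]
  have hF := lintegral_liminf_le (μ := M) (u := atTop)
    (f := fun k x => edist (Z n x) (Z (n + k) x) ^ p)
    (fun k => ((hZ n).edist (hZ (n + k))).pow_const p)
  have hEq : ∫⁻ y, edist (Z n y) (Zl y) ^ p ∂M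
      = ∫⁻ y, liminf (fun k => edist (Z n y) (Z (n + k) y) ^ p) atTop ∂M := by
    refine lintegral_congr_ae ?_
    filter_upwards [hlim] with y hy
    refine (Tendsto.liminf_eq ?_).symm
    have h4 : Tendsto (fun k => Z (n + k) y) atTop (𝓝 (Zl y)) := by
      have := (tendsto_add_atTop_iff_nat n).2 hy
      simpa [add_comm] using this
    exact ((ENNReal.continuous_rpow_const (y := p)).tendsto _).comp
      (tendsto_const_nhds.edist h4)
  rw [hEq]
  refine hF.trans ?_
  refine liminf_le_of_le (by isBoundedDefault) fun b hb => ?_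
  obtain ⟨k, hk⟩ := hb.exists
  refine hk.trans ?_
  have := hbd n k
  unfold lpd at this
  rwa [one_div, ENNReal.rpow_inv_le_iff hp0] at this

lemma W_complete [IsProbabilityMeasure P] (hp : 1 ≤ p) (x₀ : X) (f : ℕ → Kernel Ω X)
    (hf : ∀ n, f n ∈ kernelWassersteinSpace P p x₀)
    (hC : ∀ ε : ℝ≥0∞, 0 < ε → ∃ N : ℕ, ∀ m ≥ N, ∀ n ≥ N,
          kernelWasserstein P p (f m) (f n) < ε) :
    ∃ g ∈ kernelWassersteinSpace P p x₀,
          Tendsto (fun n => kernelWasserstein P p (f n) g) atTop (𝓝 0) := by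
  have : Nonempty X := ⟨x₀⟩
  have hpos : ∀ k : ℕ, (0 : ℝ≥0∞) < 2⁻¹ ^ k := fun k => by
    apply ENNReal.pow_pos; simp
  choose N hN using fun k : ℕ => hC (2⁻¹ ^ k) (hpos k)
  let φ : ℕ → ℕ := fun k => (Finset.range (k + 1)).sup N
  have hφ : ∀ k, N k ≤ φ k := fun k => Finset.le_sup (by simp)
  have hφ' : ∀ k, N k ≤ φ (k + 1) := fun k => Finset.le_sup (by simp)
  obtain ⟨g, hg, hW⟩ := exists_limit hp (fun k => f (φ k)) (fun k => (hf _).1)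
    (fun k => hN k _ (hφ k) _ (hφ' k))
  refine ⟨g, ?_, ?_⟩
  · refine mem_of_W hp (hf (φ 0)) ((hW 0).trans_lt ?_)
    simp
  · have hb : ∀ k, ∀ n ≥ N k, kernelWasserstein P p (f n) g ≤ 2⁻¹ ^ k * 3 := by
      intro k n hn
      refine (W_triangle hp (f n) (f (φ k)) g).trans
        ((add_le_add (hN k n hn _ (hφ k)).le (hW k)).trans ?_)
      rw [← mul_one_add]
      gcongr
      norm_num
    have ht : Tendsto (fun k : ℕ => (2⁻¹ : ℝ≥0∞) ^ k * 3) atTop (𝓝 0) := by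
      have := ENNReal.Tendsto.mul_const (b := 3)
        (ENNReal.tendsto_pow_atTop_nhds_zero_of_lt_one (r := 2⁻¹) (by simp)) (Or.inr (by simp))
      simpa using this
    rw [ENNReal.tendsto_atTop_zero]
    intro ε hε
    obtain ⟨k, hk⟩ := (ht.eventually_lt_const hε).exists
    exact ⟨N k, fun n hn => (hb k n hn).trans hk.le⟩


lemma isSeparable_prod (P : Measure Ω) [IsProbabilityMeasure P] (Q : Measure Y)
    [IsProbabilityMeasure Q] [IsSeparable Q]
    (hsep : ∃ S : Set (Set Ω), S.Countable ∧ (∀ B ∈ S, MeasurableSet B) ∧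
      ∀ A : Set Ω, MeasurableSet A → ∀ ε : ℝ≥0∞, 0 < ε →
        ∃ B ∈ S, P (symmDiff A B) < ε) : IsSeparable (P.prod Q) := by
  obtain ⟨S, hSc, hSm, hS⟩ := hsep
  obtain ⟨T, hTc, hT⟩ := exists_countable_measureDense Q
  let R : Set (Set (Ω × Y)) := Set.image2 (· ×ˢ ·) {s | MeasurableSet s} {t | MeasurableSet t}
  let R₀ : Set (Set (Ω × Y)) := Set.image2 (· ×ˢ ·) S T
  have hR₀m : ∀ s ∈ generateSetAlgebra R₀, MeasurableSet s := by
    intro s hs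
    induction hs with
    | base s hs =>
      obtain ⟨a, ha, b, hb, rfl⟩ := hs
      exact (hSm a ha).prod (hT.measurable b hb)
    | empty => exact MeasurableSet.empty
    | compl s _ ih => exact ih.compl
    | union s t _ _ ih1 ih2 => exact ih1.union ih2
  have happ : ∀ s ∈ generateSetAlgebra R, ∀ ε : ℝ≥0∞, 0 < ε →
      ∃ t ∈ generateSetAlgebra R₀, P.prod Q (symmDiff s t) < ε := by
    intro s hs
    induction hs with
    | base s hs =>
      intro ε hε
      obtain ⟨a, ha, b, hb, rfl⟩ := hs
      obtain ⟨δ, hδ0, hδ⟩ : ∃ δ : ℝ, 0 < δ ∧ ENNReal.ofReal δ < ε / 2 := by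
        obtain ⟨r, hr0, hr⟩ := ENNReal.lt_iff_exists_nnreal_btwn.1 (ENNReal.half_pos hε.ne')
        refine ⟨r, by simpa using hr0, by simpa using hr⟩
      obtain ⟨a', ha', h1⟩ := hS a ha (ε / 2) (ENNReal.half_pos hε.ne')
      obtain ⟨b', hb', h2⟩ := hT.approx b hb (measure_ne_top _ _) δ hδ0
      refine ⟨a' ×ˢ b', generateSetAlgebra.base _ ⟨a', ha', b', hb', rfl⟩, ?_⟩
      have hsub : symmDiff (a ×ˢ b) (a' ×ˢ b') ⊆
          (symmDiff a a') ×ˢ Set.univ ∪ Set.univ ×ˢ (symmDiff b b') := by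
        rintro ⟨x, y⟩ h
        simp only [Set.mem_symmDiff, Set.mem_prod, Set.mem_union, Set.mem_univ, and_true,
          true_and] at h ⊢
        tauto
      refine (measure_mono hsub).trans_lt ((measure_union_le _ _).trans_lt ?_)
      rw [Measure.prod_prod, Measure.prod_prod, measure_univ, measure_univ, mul_one, one_mul,
        ← ENNReal.add_halves ε]
      exact ENNReal.add_lt_add h1 (h2.trans hδ)
    | empty =>
      intro ε hε
      exact ⟨∅, generateSetAlgebra.empty, by simpa using hε⟩
    | compl s _ ih =>
      intro ε hε
      obtain ⟨t, ht, h⟩ := ih ε hε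
      refine ⟨tᶜ, generateSetAlgebra.compl _ ht, ?_⟩
      rwa [compl_symmDiff_compl]
    | union s t _ _ ih1 ih2 =>
      intro ε hε
      obtain ⟨s', hs', h1⟩ := ih1 (ε / 2) (ENNReal.half_pos hε.ne')
      obtain ⟨t', ht', h2⟩ := ih2 (ε / 2) (ENNReal.half_pos hε.ne')
      refine ⟨s' ∪ t', generateSetAlgebra.union _ _ hs' ht', ?_⟩
      have hsub : symmDiff (s ∪ t) (s' ∪ t') ⊆ symmDiff s s' ∪ symmDiff t t' := by
        intro x h
        simp only [Set.mem_symmDiff, Set.mem_union] at h ⊢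
        tauto
      refine (measure_mono hsub).trans_lt ((measure_union_le _ _).trans_lt ?_)
      rw [← ENNReal.add_halves ε]
      exact ENNReal.add_lt_add h1 h2
  have hdense : (P.prod Q).MeasureDense (generateSetAlgebra R) := by
    refine Measure.MeasureDense.of_generateFrom_isSetAlgebra_finite _
      isSetAlgebra_generateSetAlgebra ?_
    rw [generateFrom_generateSetAlgebra_eq]
    exact generateFrom_prod.symm
  refine ⟨generateSetAlgebra R₀, countable_generateSetAlgebra (hSc.image2 hTc _), ⟨hR₀m, ?_⟩⟩
  intro s hs hfin ε hε
  obtain ⟨t, ht, h1⟩ := hdense.approx s hs hfin (ε / 2) (by positivity)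
  obtain ⟨u, hu, h2⟩ := happ t ht (ENNReal.ofReal (ε / 2)) (by simpa using hε)
  refine ⟨u, hu, (measure_symmDiff_le s t u).trans_lt ?_⟩
  rw [← add_halves ε, ENNReal.ofReal_add (by positivity) (by positivity)]
  exact ENNReal.add_lt_add h1 h2

lemma exists_embedding (X : Type*) [MetricSpace X] [SecondCountableTopology X] :
    ∃ (V : Submodule ℝ (lp (fun _ : ℕ => ℝ) ⊤)) (i : X → V),
      TopologicalSpace.SeparableSpace V ∧ Isometry i := by
  let k := kuratowskiEmbedding X
  have hk : Isometry k := kuratowskiEmbedding.isometry X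
  refine ⟨Submodule.span ℝ (Set.range k),
    fun x => ⟨k x, Submodule.subset_span ⟨x, rfl⟩⟩, ?_, ?_⟩
  · have h1 : TopologicalSpace.IsSeparable (Set.range k) :=
      TopologicalSpace.isSeparable_range hk.continuous
    exact (h1.span (R := ℝ)).separableSpace
  · intro x y
    exact hk x y

/-- Separability of the space of `X`-valued `L^p` random variables. -/
lemma exists_countable_dense_rv_aux {V : Type*} [NormedAddCommGroup V]
    [TopologicalSpace.SeparableSpace V] (i : X → V) (hi : Isometry i) (M : Measure Y) [IsSeparable M] (hp : 1 ≤ p) (x₀ : X) :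
    ∃ D : Set (Y → X), D.Countable ∧ (∀ F ∈ D, Measurable F ∧ lpd M p F (fun _ => x₀) < ⊤) ∧
      ∀ F : Y → X, Measurable F → lpd M p F (fun _ => x₀) < ⊤ → ∀ ε : ℝ≥0∞, 0 < ε →
        ∃ G ∈ D, lpd M p F G < ε := by
  have hp0 : 0 < p := by linarith
  let q : ℝ≥0∞ := ENNReal.ofReal p
  have hq1 : Fact (1 ≤ q) := ⟨by simpa [q] using hp⟩
  have hq2 : Fact (q ≠ ⊤) := ⟨by simp [q]⟩
  have hq0 : q ≠ 0 := by simpa [q] using hp0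
  have hqr : q.toReal = p := ENNReal.toReal_ofReal hp0.le
  have hnorm : ∀ F G : Y → X, eLpNorm (fun y => i (F y) - i (G y)) q M = lpd M p F G := by
    intro F G
    rw [eLpNorm_eq_lintegral_rpow_enorm_toReal hq0 hq2.out, hqr]
    unfold lpd
    congr 2 with y
    rw [← edist_eq_enorm_sub, hi]
  have hsm : ∀ F : Y → X, Measurable F → AEStronglyMeasurable (fun y => i (F y) - i x₀) M := by
    intro F hF
    exact ((hi.continuous.comp_stronglyMeasurable hF.stronglyMeasurable).sub
      stronglyMeasurable_const).aestronglyMeasurable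
  let T := {F : Y → X // Measurable F ∧ lpd M p F (fun _ => x₀) < ⊤}
  have : Nonempty T := ⟨⟨fun _ => x₀, measurable_const, by simp [lpd, hp0]⟩⟩
  have hmem : ∀ F : T, MemLp (fun y => i (F.1 y) - i x₀) q M := fun F =>
    ⟨hsm F.1 F.2.1, by rw [hnorm F.1 (fun _ => x₀)]; exact F.2.2⟩
  let Φ : T → Lp V q M := fun F => (hmem F).toLp
  have hΦ : ∀ F G : T, edist (Φ F) (Φ G) = lpd M p F.1 G.1 := by
    intro F G
    simp only [Φ]
    rw [Lp.edist_toLp_toLp, ← hnorm]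
    congr 1 with y
    simp
  obtain ⟨t, hts, htc, htd⟩ :=
    (TopologicalSpace.IsSeparable.of_separableSpace (Set.range Φ)).exists_countable_dense_subset
  have hsec : ∀ e ∈ t, ∃ F : T, Φ F = e := fun e he => hts he
  choose! sec hsec using hsec
  refine ⟨(fun e => (sec e).1) '' t, htc.image _, ?_, ?_⟩
  · rintro _ ⟨e, he, rfl⟩
    exact (sec e).2
  · intro F hF hF' ε hε
    obtain ⟨e, he, hd⟩ := EMetric.mem_closure_iff.1 (htd ⟨⟨F, hF, hF'⟩, rfl⟩) ε hε
    refine ⟨_, ⟨e, he, rfl⟩, ?_⟩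
    rwa [← hsec e he, hΦ] at hd

lemma exists_countable_dense_rv (M : Measure Y) [IsSeparable M] (hp : 1 ≤ p) (x₀ : X) :
    ∃ D : Set (Y → X), D.Countable ∧ (∀ F ∈ D, Measurable F ∧ lpd M p F (fun _ => x₀) < ⊤) ∧
      ∀ F : Y → X, Measurable F → lpd M p F (fun _ => x₀) < ⊤ → ∀ ε : ℝ≥0∞, 0 < ε →
        ∃ G ∈ D, lpd M p F G < ε := by
  obtain ⟨V, i, hV, hi⟩ := exists_embedding X
  exact exists_countable_dense_rv_aux i hi M hp x₀

lemma W_separable [IsProbabilityMeasure P] (hp : 1 ≤ p) (x₀ : X)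
    (hsep : ∃ S : Set (Set Ω), S.Countable ∧ (∀ B ∈ S, MeasurableSet B) ∧
      ∀ A : Set Ω, MeasurableSet A → ∀ ε : ℝ≥0∞, 0 < ε →
        ∃ B ∈ S, P (symmDiff A B) < ε) :
    ∃ D : Set (Kernel Ω X), D.Countable ∧ D ⊆ kernelWassersteinSpace P p x₀ ∧
        ∀ μ ∈ kernelWassersteinSpace P p x₀, ∀ ε : ℝ≥0∞, 0 < ε →
          ∃ ν ∈ D, kernelWasserstein P p μ ν < ε := by
  have : Nonempty X := ⟨x₀⟩
  let θ : Kernel Ω (Ω × unitInterval) := Kernel.id ×ₖ Kernel.const Ω volume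
  have hθ : P.bind θ = P.prod volume := by
    rw [← Measure.compProd_const, Measure.compProd_eq_comp_prod]
  have : IsSeparable (P.bind θ) := by
    rw [hθ]
    exact isSeparable_prod P volume hsep
  have hmem : ∀ F : Ω × unitInterval → X, Measurable F →
      (θ.map F ∈ kernelWassersteinSpace P p x₀ ↔ lpd (P.bind θ) p F (fun _ => x₀) < ⊤) := by
    intro F hF
    rw [mem_space_iff hp, bind_map _ hF, lpd_map _ _ hF measurable_id measurable_const]
    refine ⟨fun h => h.2, fun h => ⟨Kernel.IsMarkovKernel.map _ hF, h⟩⟩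
  obtain ⟨D, hDc, hD, hd⟩ := exists_countable_dense_rv (P.bind θ) hp x₀
  refine ⟨(fun F => θ.map F) '' D, hDc.image _, ?_, ?_⟩
  · rintro _ ⟨F, hF, rfl⟩
    exact (hmem F (hD F hF).1).2 (hD F hF).2
  · intro μ hμ ε hε
    have := hμ.1
    obtain ⟨f, hf, hfμ⟩ := Kernel.exists_measurable_map_eq_unitInterval μ
    have he : θ.map (Function.uncurry f) = μ := by
      ext1 ω
      rw [Kernel.map_apply _ hf, ← hfμ ω]
      simp only [θ]
      rw [Kernel.prod_apply, Kernel.id_apply, Kernel.const_apply, Measure.dirac_prod,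
        Measure.map_map hf (by fun_prop)]
      rfl
    obtain ⟨G, hG, hlt⟩ := hd (Function.uncurry f) hf ((hmem _ hf).1 (he ▸ hμ)) ε hε
    exact ⟨_, ⟨G, hG, rfl⟩, (W_le_of_coupling hp θ hf (hD G hG).1 he rfl).trans_lt hlt⟩

end KW

end

/-- **`(𝒦_p(X), W_p)` is a complete separable metric space.** Let `X` be a complete
separable metric space and `(Ω,F,P)` a probability space with separable measure algebra.
Then, on the space of probability kernels with finite `p`-th moment, `W_p` is a finite
pseudometric whose vanishing characterizes `P`-a.e. equality (so it is a metric after the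
a.e. identification), and it is complete and separable. -/
theorem kernelWasserstein_complete_separable_metric
    {Ω X : Type*} [MeasurableSpace Ω]
    [MetricSpace X] [CompleteSpace X] [SecondCountableTopology X]
    [MeasurableSpace X] [BorelSpace X]
    (P : Measure Ω) [IsProbabilityMeasure P]
    (p : ℝ) (hp : 1 ≤ p) (x₀ : X)
    (hsep : ∃ S : Set (Set Ω), S.Countable ∧ (∀ B ∈ S, MeasurableSet B) ∧
      ∀ A : Set Ω, MeasurableSet A → ∀ ε : ℝ≥0∞, 0 < ε →
        ∃ B ∈ S, P (symmDiff A B) < ε) :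
    -- `W_p` is finite on `𝒦_p(X)`
    (∀ μ ∈ kernelWassersteinSpace P p x₀, ∀ ν ∈ kernelWassersteinSpace P p x₀,
        kernelWasserstein P p μ ν < ⊤) ∧
    -- `W_p(μ,μ) = 0`
    (∀ μ ∈ kernelWassersteinSpace P p x₀, kernelWasserstein P p μ μ = 0) ∧
    -- symmetry
    (∀ μ ∈ kernelWassersteinSpace P p x₀, ∀ ν ∈ kernelWassersteinSpace P p x₀,
        kernelWasserstein P p μ ν = kernelWasserstein P p ν μ) ∧
    -- triangle inequality
    (∀ μ ∈ kernelWassersteinSpace P p x₀, ∀ ν ∈ kernelWassersteinSpace P p x₀,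
        ∀ ρ ∈ kernelWassersteinSpace P p x₀,
        kernelWasserstein P p μ ρ ≤
          kernelWasserstein P p μ ν + kernelWasserstein P p ν ρ) ∧
    -- `W_p(μ,ν) = 0` iff `μ = ν` `P`-a.e. (identification of a.e. equal kernels)
    (∀ μ ∈ kernelWassersteinSpace P p x₀, ∀ ν ∈ kernelWassersteinSpace P p x₀,
        (kernelWasserstein P p μ ν = 0 ↔ ∀ᵐ ω ∂P, μ ω = ν ω)) ∧
    -- completeness: every `W_p`-Cauchy sequence in `𝒦_p(X)` converges in `𝒦_p(X)`
    (∀ f : ℕ → Kernel Ω X, (∀ n, f n ∈ kernelWassersteinSpace P p x₀) →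
        (∀ ε : ℝ≥0∞, 0 < ε → ∃ N : ℕ, ∀ m ≥ N, ∀ n ≥ N,
          kernelWasserstein P p (f m) (f n) < ε) →
        ∃ g ∈ kernelWassersteinSpace P p x₀,
          Tendsto (fun n => kernelWasserstein P p (f n) g) atTop (𝓝 0)) ∧
    -- separability: a countable `W_p`-dense subset of `𝒦_p(X)`
    (∃ D : Set (Kernel Ω X), D.Countable ∧ D ⊆ kernelWassersteinSpace P p x₀ ∧
        ∀ μ ∈ kernelWassersteinSpace P p x₀, ∀ ε : ℝ≥0∞, 0 < ε →
          ∃ ν ∈ D, kernelWasserstein P p μ ν < ε) := by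
  have : Nonempty X := ⟨x₀⟩
  refine ⟨fun μ hμ ν hν => KW.W_lt_top hp hμ hν, fun μ hμ => ?_, fun μ _ ν _ => KW.W_comm hp μ ν,
    fun μ _ ν _ ρ _ => KW.W_triangle hp μ ν ρ, fun μ hμ ν hν => ?_,
    fun f hf hC => KW.W_complete hp x₀ f hf hC, KW.W_separable hp x₀ hsep⟩
  · have := hμ.1
    exact KW.W_self hp μ
  · have := hμ.1
    have := hν.1
    exact ⟨KW.ae_eq_of_W hp, KW.W_of_ae_eq hp⟩
end
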